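/- There is an absolute constant C > 0 such that for every 1 < p < ∞ and every Schwartz function f : ℝ → ℂ, the Littlewood–Paley–Stein square function G^P f(x) = (∫_0^∞ |t·(∂/∂t) P_t f(x)|² dt/t)^{1/2} associated with the subordinated Poisson semigroup of the translation group satisfies ‖G^P f‖_{L_p(ℝ)} ≤ C·max{p, p/(p−1)}·‖f‖_{L_p(ℝ)}. -/

import Mathlib

open MeasureTheory

/-- The subordinated Poisson semigroup of the translation group on `ℝ`:
`P_t f (x) = (1/√π) ∫_0^∞ (e^{−u}/√u) f(x + t²/(4u)) du`. -/
noncomputable def poissonP (f : ℝ → ℂ) (t : ℝ) (x : ℝ) : ℂ :=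
  ((Real.sqrt Real.pi)⁻¹ : ℂ) *
    ∫ u in Set.Ioi (0 : ℝ), ((Real.exp (-u) / Real.sqrt u : ℝ) : ℂ) * f (x + t ^ 2 / (4 * u))

/-! ### Layer cake and distributional inequalities -/

namespace PoissonSquare

open Set ENNReal

lemma lintegral_Ioo_rpow {p c : ℝ} (hp : 0 < p) (hc : 0 ≤ c) :
    ∫⁻ l in Ioo 0 c, ENNReal.ofReal (p * l ^ (p - 1)) = ENNReal.ofReal (c ^ p) := by
  rw [← ofReal_integral_eq_lintegral_ofReal]
  · rw [← integral_Ioc_eq_integral_Ioo, ← intervalIntegral.integral_of_le hc,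
      intervalIntegral.integral_const_mul, integral_rpow (Or.inl (by linarith))]
    congr 1
    rw [sub_add_cancel, Real.zero_rpow hp.ne', sub_zero]
    field_simp
  · have := (intervalIntegral.intervalIntegrable_rpow' (a := 0) (b := c)
      (r := p - 1) (by linarith)).const_mul p
    rw [intervalIntegrable_iff_integrableOn_Ioo_of_le hc] at this
    exact this
  · refine (ae_restrict_iff' measurableSet_Ioo).2 (.of_forall fun l hl => ?_)
    have := Real.rpow_nonneg hl.1.le (p - 1)
    exact mul_nonneg hp.le this

lemma rpow_eq_lintegral_indicator {p : ℝ} (hp : 0 < p) (a : ℝ≥0∞) :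
    a ^ p = ∫⁻ l in Ioi (0 : ℝ),
      {l : ℝ | ENNReal.ofReal l < a}.indicator (fun l => ENNReal.ofReal (p * l ^ (p - 1))) l := by
  have key : ∀ c : ℝ, 0 ≤ c → ENNReal.ofReal c ≤ a →
      ENNReal.ofReal c ^ p ≤ ∫⁻ l in Ioi (0 : ℝ),
      {l : ℝ | ENNReal.ofReal l < a}.indicator (fun l => ENNReal.ofReal (p * l ^ (p - 1))) l := by
    intro c hc hca
    rw [ENNReal.ofReal_rpow_of_nonneg hc hp.le, ← lintegral_Ioo_rpow hp hc,
      ← lintegral_indicator measurableSet_Ioo, ← lintegral_indicator measurableSet_Ioi]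
    refine lintegral_mono fun l => ?_
    by_cases hl : l ∈ Ioo 0 c
    · have h1 : l ∈ Ioi (0 : ℝ) := hl.1
      have h2 : l ∈ {l : ℝ | ENNReal.ofReal l < a} :=
        lt_of_lt_of_le ((ENNReal.ofReal_lt_ofReal_iff_of_nonneg hl.1.le).2 hl.2) hca
      rw [indicator_of_mem hl, indicator_of_mem h1, indicator_of_mem h2]
    · rw [indicator_of_notMem hl]; exact zero_le
  have hm : MeasurableSet {l : ℝ | ENNReal.ofReal l < a} :=
    measurableSet_lt ENNReal.measurable_ofReal measurable_const
  apply le_antisymm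
  · by_cases ha : a = ∞
    · subst ha
      rw [ENNReal.top_rpow_of_pos hp]
      refine le_of_forall_lt fun b hb => ?_
      obtain ⟨n, hn⟩ := ENNReal.exists_nat_gt
        (ENNReal.rpow_ne_top_of_nonneg (inv_nonneg.2 hp.le) hb.ne : b ^ p⁻¹ ≠ ∞)
      refine lt_of_lt_of_le ?_ (key n (Nat.cast_nonneg n) le_top)
      rw [ENNReal.ofReal_natCast]
      rwa [← ENNReal.rpow_lt_rpow_iff hp, ENNReal.rpow_inv_rpow hp.ne'] at hn
    · have := key a.toReal ENNReal.toReal_nonneg (ENNReal.ofReal_toReal ha).le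
      rwa [ENNReal.ofReal_toReal ha] at this
  · by_cases ha : a = ∞
    · subst ha; rw [ENNReal.top_rpow_of_pos hp]; exact le_top
    · lift a to NNReal using ha
      have ha0 : (0 : ℝ) ≤ a := a.2
      rw [← ENNReal.ofReal_coe_nnreal, ENNReal.ofReal_rpow_of_nonneg ha0 hp.le,
        ← lintegral_Ioo_rpow hp ha0,
        ← lintegral_indicator measurableSet_Ioo, ← lintegral_indicator measurableSet_Ioi]
      refine lintegral_mono fun l => ?_
      by_cases hl : l ∈ Ioi (0 : ℝ)
      · rw [indicator_of_mem hl]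
        by_cases h2 : ENNReal.ofReal l < ENNReal.ofReal a
        · have h3 : l ∈ Ioo (0 : ℝ) a :=
            ⟨hl, (ENNReal.ofReal_lt_ofReal_iff_of_nonneg (le_of_lt hl)).1 h2⟩
          rw [indicator_of_mem h3]
          exact indicator_le_self' (fun _ _ => zero_le) _
        · rw [indicator_of_notMem (by exact h2)]; exact zero_le
      · rw [indicator_of_notMem hl]; exact zero_le

/-- Layer-cake formula for extended nonnegative functions. -/
lemma lintegral_rpow_eq_layercake {F : ℝ → ℝ≥0∞} (hF : Measurable F) {p : ℝ} (hp : 0 < p) :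
    ∫⁻ x, F x ^ p = ∫⁻ l in Ioi (0 : ℝ),
      volume {x | ENNReal.ofReal l < F x} * ENNReal.ofReal (p * l ^ (p - 1)) := by
  simp_rw [fun x => rpow_eq_lintegral_indicator hp (F x)]
  have hm : MeasurableSet {q : ℝ × ℝ | ENNReal.ofReal q.2 < F q.1} :=
    measurableSet_lt (ENNReal.measurable_ofReal.comp measurable_snd) (hF.comp measurable_fst)
  rw [lintegral_lintegral_swap]
  · refine lintegral_congr fun l => ?_
    have : ∀ x, {l : ℝ | ENNReal.ofReal l < F x}.indicator
        (fun l => ENNReal.ofReal (p * l ^ (p - 1))) l =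
        {x | ENNReal.ofReal l < F x}.indicator (fun _ => ENNReal.ofReal (p * l ^ (p - 1))) x :=
      fun x => rfl
    simp_rw [this]
    rw [lintegral_indicator_const (measurableSet_lt measurable_const hF), mul_comm]
  · apply Measurable.aemeasurable
    have : Function.uncurry (fun x l => {l : ℝ | ENNReal.ofReal l < F x}.indicator
        (fun l => ENNReal.ofReal (p * l ^ (p - 1))) l) =
        {q : ℝ × ℝ | ENNReal.ofReal q.2 < F q.1}.indicator
          (fun q => ENNReal.ofReal (p * q.2 ^ (p - 1))) := by
      ext ⟨x, l⟩; rfl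
    rw [this]
    exact Measurable.indicator (by fun_prop) hm

lemma lt_inv_mul_iff {b : ℝ} (hb : 0 < b) (l : ℝ) (a : ℝ≥0∞) :
    ENNReal.ofReal l < ENNReal.ofReal b⁻¹ * a ↔ ENNReal.ofReal (b * l) < a := by
  rw [ENNReal.ofReal_inv_of_pos hb, ENNReal.ofReal_mul hb.le, mul_comm _ a, ← div_eq_mul_inv,
    ENNReal.lt_div_iff_mul_lt (Or.inl (by simpa using hb)) (Or.inl ENNReal.ofReal_ne_top), mul_comm]

/-- Integrated form of a relative distributional inequality. -/
lemma lintegral_rpow_le_of_distribution {F m : ℝ → ℝ≥0∞} (hF : Measurable F) (hm : Measurable m)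
    {p b c : ℝ} (hp : 0 < p) (hb : 0 < b) (hc : 0 < c) (η : ℝ≥0∞)
    (h : ∀ l : ℝ, 0 < l → volume {x | ENNReal.ofReal (b * l) < F x} ≤
      volume {x | ENNReal.ofReal (c * l) < m x} + η * volume {x | ENNReal.ofReal l < F x}) :
    ∫⁻ x, F x ^ p ≤ ENNReal.ofReal b ^ p *
      (ENNReal.ofReal c⁻¹ ^ p * (∫⁻ x, m x ^ p) + η * ∫⁻ x, F x ^ p) := by
  have h1 : ∫⁻ x, (ENNReal.ofReal b⁻¹ * F x) ^ p ≤
      (∫⁻ x, (ENNReal.ofReal c⁻¹ * m x) ^ p) + η * ∫⁻ x, F x ^ p := by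
    rw [lintegral_rpow_eq_layercake (hF.const_mul _) hp,
      lintegral_rpow_eq_layercake (hm.const_mul _) hp, lintegral_rpow_eq_layercake hF hp]
    have hdec : ∀ {F : ℝ → ℝ≥0∞}, Measurable fun l : ℝ => volume {x | ENNReal.ofReal l < F x} := by
      intro F
      refine Antitone.measurable fun l l' hl => measure_mono fun x hx => ?_
      exact lt_of_le_of_lt (ENNReal.ofReal_le_ofReal hl) hx
    have hw : Measurable fun l : ℝ => ENNReal.ofReal (p * l ^ (p - 1)) := by fun_prop
    have hdw : ∀ F : ℝ → ℝ≥0∞, Measurable fun l : ℝ =>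
        volume {x | ENNReal.ofReal l < F x} * ENNReal.ofReal (p * l ^ (p - 1)) :=
      fun F => hdec.mul hw
    rw [← lintegral_const_mul _ (hdw F), ← lintegral_add_left (hdw _)]
    refine setLIntegral_mono' measurableSet_Ioi fun l hl => ?_
    simp_rw [lt_inv_mul_iff hb, lt_inv_mul_iff hc]
    calc _ ≤ (_ + _) * _ := mul_le_mul_left (h l hl) _
      _ = _ := by ring
  simp_rw [ENNReal.mul_rpow_of_nonneg _ _ hp.le] at h1
  rw [lintegral_const_mul _ (hF.pow_const p), lintegral_const_mul _ (hm.pow_const p)] at h1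
  calc ∫⁻ x, F x ^ p = ENNReal.ofReal b ^ p * (ENNReal.ofReal b⁻¹ ^ p * ∫⁻ x, F x ^ p) := by
        rw [← mul_assoc, ← ENNReal.mul_rpow_of_nonneg _ _ hp.le, ← ENNReal.ofReal_mul hb.le,
          mul_inv_cancel₀ hb.ne', ENNReal.ofReal_one, ENNReal.one_rpow, one_mul]
    _ ≤ _ := by gcongr

end PoissonSquare

/-! ### The maximal function -/

namespace PoissonSquare

open Set ENNReal Metric

/-- The centred maximal function over dyadic radii, normalised by the radius. -/
noncomputable def maximalFn (g : ℝ → ℝ≥0∞) (x : ℝ) : ℝ≥0∞ :=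
  ⨆ n : ℤ, (ENNReal.ofReal ((2 : ℝ) ^ n))⁻¹ * ∫⁻ y in closedBall x ((2 : ℝ) ^ n), g y

lemma measurable_setLIntegral_closedBall {g : ℝ → ℝ≥0∞} (hg : Measurable g) (r : ℝ) :
    Measurable fun x => ∫⁻ y in closedBall x r, g y := by
  have hs : MeasurableSet {q : ℝ × ℝ | dist q.2 q.1 ≤ r} :=
    (isClosed_le (by fun_prop) continuous_const).measurableSet
  have h := ((hg.comp measurable_snd).indicator hs).lintegral_prod_right' (ν := volume)
  convert h using 2 with x
  rw [← lintegral_indicator measurableSet_closedBall]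
  rfl

lemma measurable_maximalFn {g : ℝ → ℝ≥0∞} (hg : Measurable g) : Measurable (maximalFn g) :=
  .iSup fun _ => (measurable_setLIntegral_closedBall hg _).const_mul _

lemma ofReal_two_zpow_ne_zero (n : ℤ) : ENNReal.ofReal ((2 : ℝ) ^ n) ≠ 0 := by
  have : (0 : ℝ) < 2 ^ n := by positivity
  simpa using this

lemma setLIntegral_two_zpow_le (g : ℝ → ℝ≥0∞) (x : ℝ) (n : ℤ) :
    ∫⁻ y in closedBall x ((2 : ℝ) ^ n), g y ≤ ENNReal.ofReal ((2 : ℝ) ^ n) * maximalFn g x := by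
  rw [← ENNReal.inv_mul_le_iff (ofReal_two_zpow_ne_zero n) ENNReal.ofReal_ne_top]
  exact le_iSup (fun n : ℤ => (ENNReal.ofReal ((2 : ℝ) ^ n))⁻¹ *
    ∫⁻ y in closedBall x ((2 : ℝ) ^ n), g y) n

lemma setLIntegral_closedBall_le (g : ℝ → ℝ≥0∞) (x : ℝ) {r : ℝ} (hr : 0 < r) :
    ∫⁻ y in closedBall x r, g y ≤ ENNReal.ofReal (2 * r) * maximalFn g x := by
  obtain ⟨n, hn⟩ := exists_mem_Ioc_zpow hr (one_lt_two (α := ℝ))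
  calc ∫⁻ y in closedBall x r, g y ≤ ∫⁻ y in closedBall x ((2 : ℝ) ^ (n + 1)), g y :=
        lintegral_mono_set (closedBall_subset_closedBall hn.2)
    _ ≤ _ := setLIntegral_two_zpow_le g x _
    _ ≤ _ := by
        gcongr
        rw [zpow_add_one₀ two_ne_zero]
        linarith [hn.1]

/-- Weak type `(1,1)` bound. -/
lemma maximalFn_weak (g : ℝ → ℝ≥0∞) {l : ℝ} (hl : 0 < l) :
    ENNReal.ofReal l * volume {x | ENNReal.ofReal l < maximalFn g x} ≤ 10 * ∫⁻ y, g y := by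
  by_cases hg : ∫⁻ y, g y = ∞
  · simp [hg]
  set t := {x | ENNReal.ofReal l < maximalFn g x}
  have hex : ∀ x ∈ t, ∃ n : ℤ,
      ENNReal.ofReal (l * 2 ^ n) < ∫⁻ y in closedBall x ((2 : ℝ) ^ n), g y := by
    intro x hx
    obtain ⟨n, hn⟩ := lt_iSup_iff.1 (show ENNReal.ofReal l < maximalFn g x from hx)
    refine ⟨n, ?_⟩
    rw [mul_comm, ← div_eq_mul_inv, ENNReal.lt_div_iff_mul_lt
      (Or.inl (ofReal_two_zpow_ne_zero n)) (Or.inl ENNReal.ofReal_ne_top)] at hn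
    rwa [ENNReal.ofReal_mul hl.le]
  choose! n hn using hex
  have hR : ∀ x ∈ t, (2 : ℝ) ^ n x ≤ (∫⁻ y, g y).toReal / l := by
    intro x hx
    rw [le_div_iff₀ hl, mul_comm]
    exact (ENNReal.ofReal_le_iff_le_toReal hg).1 ((hn x hx).le.trans (setLIntegral_le_lintegral _ _))
  obtain ⟨u, hut, hdisj, hcov⟩ := Vitali.exists_disjoint_subfamily_covering_enlargement_closedBall
    t (fun x => x) (fun x => (2 : ℝ) ^ n x) _ hR 5 (by norm_num)
  have hpos : ∀ x, (0 : ℝ) < 2 ^ n x := fun x => by positivity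
  have hu : u.Countable := hdisj.countable_of_nonempty_interior fun x _ => by
    rw [interior_closedBall _ (hpos x).ne']
    exact nonempty_ball.2 (hpos x)
  have hsub : t ⊆ ⋃ x ∈ u, closedBall x (5 * (2 : ℝ) ^ n x) := fun x hx => by
    obtain ⟨b, hb, hxb⟩ := hcov x hx
    exact mem_biUnion hb (hxb (mem_closedBall_self (hpos x).le))
  calc ENNReal.ofReal l * volume t
      ≤ ENNReal.ofReal l * ∑' x : u, volume (closedBall (x : ℝ) (5 * (2 : ℝ) ^ n x)) := by
        gcongr
        exact (measure_mono hsub).trans (measure_biUnion_le _ hu _)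
    _ = ∑' x : u, 10 * ENNReal.ofReal (l * 2 ^ n (x : ℝ)) := by
        rw [← ENNReal.tsum_mul_left]
        congr 1 with x
        rw [Real.volume_closedBall, ← ENNReal.ofReal_mul hl.le,
          show (10 : ℝ≥0∞) = ENNReal.ofReal 10 by norm_num, ← ENNReal.ofReal_mul (by norm_num)]
        congr 1; ring
    _ ≤ ∑' x : u, 10 * ∫⁻ y in closedBall (x : ℝ) ((2 : ℝ) ^ n (x : ℝ)), g y :=
        ENNReal.tsum_le_tsum fun x => mul_le_mul_right (hn x (hut x.2)).le _
    _ = 10 * ∫⁻ y in ⋃ x ∈ u, closedBall x ((2 : ℝ) ^ n x), g y := by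
        rw [ENNReal.tsum_mul_left, lintegral_biUnion hu (fun _ _ => measurableSet_closedBall) hdisj]
    _ ≤ _ := by gcongr; exact Measure.restrict_le_self

lemma maximalFn_le_of_split (g : ℝ → ℝ≥0∞) (hg : Measurable g) {l : ℝ} (hl : 0 < l) (x : ℝ) :
    maximalFn g x ≤ maximalFn ({y | ENNReal.ofReal l < 4 * g y}.indicator g) x
      + ENNReal.ofReal (l / 2) := by
  refine iSup_le fun n => ?_
  have hs : MeasurableSet {y | ENNReal.ofReal l < 4 * g y} :=
    measurableSet_lt measurable_const (hg.const_mul 4)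
  have h1 : ∀ y, g y ≤ {y | ENNReal.ofReal l < 4 * g y}.indicator g y + ENNReal.ofReal (l / 4) := by
    intro y
    by_cases hy : y ∈ {y | ENNReal.ofReal l < 4 * g y}
    · rw [indicator_of_mem hy]; exact le_self_add
    · rw [indicator_of_notMem hy, zero_add]
      rw [mem_ofPred_eq, not_lt] at hy
      rw [ENNReal.ofReal_div_of_pos (by norm_num),
        ENNReal.le_div_iff_mul_le (by norm_num) (by norm_num), mul_comm]
      simpa using hy
  calc _ ≤ (ENNReal.ofReal ((2 : ℝ) ^ n))⁻¹ * ∫⁻ y in closedBall x ((2 : ℝ) ^ n),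
          ({y | ENNReal.ofReal l < 4 * g y}.indicator g y + ENNReal.ofReal (l / 4)) := by
        gcongr with y; exact h1 y
    _ = (ENNReal.ofReal ((2 : ℝ) ^ n))⁻¹ * (∫⁻ y in closedBall x ((2 : ℝ) ^ n),
          {y | ENNReal.ofReal l < 4 * g y}.indicator g y) + ENNReal.ofReal (l / 2) := by
        rw [lintegral_add_right _ measurable_const, mul_add, setLIntegral_const,
          Real.volume_closedBall, ← ENNReal.ofReal_mul (by positivity),
          ← ENNReal.ofReal_inv_of_pos (by positivity), ← ENNReal.ofReal_mul (by positivity)]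
        congr 2
        field_simp
        norm_num
    _ ≤ _ := by
        gcongr
        exact le_iSup (fun n : ℤ => (ENNReal.ofReal ((2 : ℝ) ^ n))⁻¹ *
          ∫⁻ y in closedBall x ((2 : ℝ) ^ n), {y | ENNReal.ofReal l < 4 * g y}.indicator g y) n

/-- Strong type `(p,p)` bound with the growth `p/(p-1)`. -/
lemma maximalFn_strong {g : ℝ → ℝ≥0∞} (hg : Measurable g) {p : ℝ} (hp : 1 < p) :
    ∫⁻ x, maximalFn g x ^ p ≤ ENNReal.ofReal (5 * 4 ^ p * (p / (p - 1))) * ∫⁻ y, g y ^ p := by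
  have hp0 : 0 < p := by linarith
  have hp1 : 0 < p - 1 := by linarith
  have hm : MeasurableSet {q : ℝ × ℝ | ENNReal.ofReal q.1 < 4 * g q.2} :=
    measurableSet_lt (ENNReal.measurable_ofReal.comp measurable_fst)
      ((hg.comp measurable_snd).const_mul 4)
  rw [lintegral_rpow_eq_layercake (measurable_maximalFn hg) hp0]
  have hlev : ∀ l : ℝ, 0 < l → volume {x | ENNReal.ofReal l < maximalFn g x} ≤
      ENNReal.ofReal (20 / l) * ∫⁻ y, {y | ENNReal.ofReal l < 4 * g y}.indicator g y := by
    intro l hl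
    have h2 : {x | ENNReal.ofReal l < maximalFn g x} ⊆ {x | ENNReal.ofReal (l / 2) <
        maximalFn ({y | ENNReal.ofReal l < 4 * g y}.indicator g) x} := by
      intro x hx
      by_contra hx'
      rw [mem_ofPred_eq, not_lt] at hx'
      have := (maximalFn_le_of_split g hg hl x).trans (add_le_add_left hx' _)
      rw [← ENNReal.ofReal_add (by positivity) (by positivity), add_halves] at this
      exact absurd hx (not_lt.2 this)
    have h3 := maximalFn_weak ({y | ENNReal.ofReal l < 4 * g y}.indicator g) (half_pos hl)
    calc _ ≤ _ := measure_mono h2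
      _ = ENNReal.ofReal (2 / l) * (ENNReal.ofReal (l / 2) * volume {x | ENNReal.ofReal (l / 2) <
        maximalFn ({y | ENNReal.ofReal l < 4 * g y}.indicator g) x}) := by
          rw [← mul_assoc, ← ENNReal.ofReal_mul (by positivity), div_mul_div_cancel₀ hl.ne',
            div_self two_ne_zero, ENNReal.ofReal_one, one_mul]
      _ ≤ ENNReal.ofReal (2 / l) * (10 * ∫⁻ y, _) := by gcongr
      _ = _ := by
          rw [← mul_assoc, show (10 : ℝ≥0∞) = ENNReal.ofReal 10 by norm_num,
            ← ENNReal.ofReal_mul (by positivity)]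
          congr 2; ring
  have hmeas : Measurable (Function.uncurry fun (l : ℝ) (y : ℝ) =>
      ENNReal.ofReal (20 * p / (p - 1)) * (ENNReal.ofReal ((p - 1) * l ^ (p - 1 - 1)) *
        {y | ENNReal.ofReal l < 4 * g y}.indicator g y)) := by
    have : Measurable ({q : ℝ × ℝ | ENNReal.ofReal q.1 < 4 * g q.2}.indicator fun q => g q.2) :=
      (hg.comp measurable_snd).indicator hm
    have h2 : Measurable fun q : ℝ × ℝ => ENNReal.ofReal ((p - 1) * q.1 ^ (p - 1 - 1)) := by fun_prop
    exact (h2.mul this).const_mul _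
  calc _ ≤ ∫⁻ l in Ioi (0 : ℝ), ∫⁻ y, ENNReal.ofReal (20 * p / (p - 1)) *
        (ENNReal.ofReal ((p - 1) * l ^ (p - 1 - 1)) *
          {y | ENNReal.ofReal l < 4 * g y}.indicator g y) := by
        refine setLIntegral_mono' measurableSet_Ioi fun l hl => ?_
        have hl0 : (0 : ℝ) < l := hl
        rw [lintegral_const_mul _ (by exact (hg.indicator (measurableSet_lt measurable_const
            (hg.const_mul 4))).const_mul _),
          lintegral_const_mul _ (hg.indicator (measurableSet_lt measurable_const (hg.const_mul 4)))]
        refine (mul_le_mul_left (hlev l hl) _).trans (le_of_eq ?_)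
        rw [mul_right_comm, ← mul_assoc, ← ENNReal.ofReal_mul (by positivity),
          ← ENNReal.ofReal_mul (by positivity)]
        congr 2
        rw [Real.rpow_sub_one hl0.ne' (p - 1)]
        field_simp
    _ = ∫⁻ y, ∫⁻ l in Ioi (0 : ℝ), ENNReal.ofReal (20 * p / (p - 1)) *
        (ENNReal.ofReal ((p - 1) * l ^ (p - 1 - 1)) *
          {y | ENNReal.ofReal l < 4 * g y}.indicator g y) :=
        lintegral_lintegral_swap hmeas.aemeasurable
    _ = ∫⁻ y, ENNReal.ofReal (5 * 4 ^ p * (p / (p - 1))) * g y ^ p := by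
        refine lintegral_congr fun y => ?_
        have h4 : ∀ l : ℝ, ENNReal.ofReal ((p - 1) * l ^ (p - 1 - 1)) *
          {y | ENNReal.ofReal l < 4 * g y}.indicator g y = g y * {l : ℝ | ENNReal.ofReal l <
            4 * g y}.indicator (fun l => ENNReal.ofReal ((p - 1) * l ^ (p - 1 - 1))) l := by
          intro l
          simp only [indicator, mem_ofPred_eq]
          split_ifs
          · rw [mul_comm]
          · simp
        simp_rw [h4]
        have hm2 : Measurable ({l : ℝ | ENNReal.ofReal l < 4 * g y}.indicator
            (fun l => ENNReal.ofReal ((p - 1) * l ^ (p - 1 - 1)))) :=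
          Measurable.indicator (by fun_prop)
            (measurableSet_lt ENNReal.measurable_ofReal measurable_const)
        rw [lintegral_const_mul _ (hm2.const_mul _), lintegral_const_mul _ hm2,
          ← rpow_eq_lintegral_indicator hp1, ENNReal.mul_rpow_of_nonneg _ _ hp1.le,
          show (4 : ℝ≥0∞) = ENNReal.ofReal 4 by norm_num,
          ENNReal.ofReal_rpow_of_nonneg (by norm_num) hp1.le]
        have h5 : g y * g y ^ (p - 1) = g y ^ p := by
          conv_lhs => rw [← ENNReal.rpow_one (g y)]
          rw [ENNReal.rpow_one, show p = 1 + (p - 1) by ring,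
            ENNReal.rpow_add_of_nonneg _ _ zero_le_one (by linarith), ENNReal.rpow_one]
          congr 2; ring
        rw [mul_left_comm (g y), h5, ← mul_assoc, ← ENNReal.ofReal_mul (by positivity)]
        congr 2
        rw [Real.rpow_sub_one (by norm_num)]
        field_simp
        norm_num
    _ = _ := lintegral_const_mul _ (hg.pow_const p)

end PoissonSquare

/-! ### The majorant of the kernels -/

namespace PoissonSquare

open Set ENNReal Metric

lemma lintegral_Ioi_add_rpow {a b c : ℝ} (ha : 0 < a) (hb : 1 < b) (hc : 0 ≤ c) :
    ∫⁻ r in Ioi c, ENNReal.ofReal ((b - 1) * (a + r) ^ (-b)) =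
      ENNReal.ofReal ((a + c) ^ (1 - b)) := by
  have hd : ∀ r ∈ Ici c, HasDerivAt (fun r => -(a + r) ^ (1 - b)) ((b - 1) * (a + r) ^ (-b)) r := by
    intro r hr
    have h0 : 0 < a + r := by linarith [mem_Ici.1 hr]
    refine (((hasDerivAt_id' r).const_add a).rpow_const
      (p := 1 - b) (Or.inl h0.ne')).neg.congr_deriv ?_
    rw [show 1 - b - 1 = -b by ring]
    ring
  have hpos : ∀ r ∈ Ioi c, 0 ≤ (b - 1) * (a + r) ^ (-b) := fun r hr => by
    have h0 : 0 < a + r := by linarith [mem_Ioi.1 hr]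
    have := Real.rpow_nonneg h0.le (-b)
    exact mul_nonneg (by linarith) this
  have ht : Filter.Tendsto (fun r => -(a + r) ^ (1 - b)) Filter.atTop (nhds 0) := by
    have h1 := (tendsto_rpow_neg_atTop (y := b - 1) (by linarith)).comp
      (Filter.tendsto_atTop_add_const_left Filter.atTop a Filter.tendsto_id)
    have h2 := h1.neg
    rw [neg_zero] at h2
    refine h2.congr fun r => ?_
    simp [neg_sub]
  have hi := integrableOn_Ioi_deriv_of_nonneg' hd hpos ht
  have he := integral_Ioi_of_hasDerivAt_of_nonneg' hd hpos ht
  rw [← ofReal_integral_eq_lintegral_ofReal hi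
    ((ae_restrict_iff' measurableSet_Ioi).2 (.of_forall hpos)), he]
  congr 1; ring

/-- The majorant `t (t² + |s|)^(-3/2)` of the subordinated Poisson kernel. -/
noncomputable def majorant (t s : ℝ) : ℝ := t * (t ^ 2 + |s|) ^ (-(3 / 2) : ℝ)

lemma measurable_majorant : Measurable fun q : ℝ × ℝ => majorant q.1 q.2 := by
  unfold majorant
  have : Measurable fun q : ℝ × ℝ => |q.2| := measurable_snd.abs
  fun_prop

lemma measurable_majorant_right (t : ℝ) : Measurable (majorant t) :=
  measurable_majorant.comp measurable_prodMk_left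

lemma majorant_le {t : ℝ} (ht : 0 < t) (s : ℝ) : majorant t s ≤ (t ^ 2)⁻¹ := by
  have h1 : (t ^ 2 + |s|) ^ (-(3 / 2) : ℝ) ≤ (t ^ 2) ^ (-(3 / 2) : ℝ) :=
    Real.rpow_le_rpow_of_nonpos (by positivity) (by linarith [abs_nonneg s]) (by norm_num)
  have h2 : (t ^ 2) ^ (-(3 / 2) : ℝ) = (t ^ 3)⁻¹ := by
    rw [← Real.rpow_natCast, ← Real.rpow_mul ht.le, ← Real.rpow_natCast,
      ← Real.rpow_neg ht.le]
    norm_num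
  rw [h2] at h1
  calc majorant t s ≤ t * (t ^ 3)⁻¹ := by unfold majorant; gcongr
    _ = _ := by field_simp

/-- Convolution against the majorant. -/
noncomputable def majorantConv (t : ℝ) (g : ℝ → ℝ≥0∞) (x : ℝ) : ℝ≥0∞ :=
  ∫⁻ y, ENNReal.ofReal (majorant t (y - x)) * g y

lemma majorantConv_le_maximalFn {g : ℝ → ℝ≥0∞} (hg : Measurable g) {t : ℝ} (ht : 0 < t) (x : ℝ) :
    majorantConv t g x ≤ 6 * maximalFn g x := by
  have ht2 : 0 < t ^ 2 := by positivity
  set w : ℝ → ℝ≥0∞ := fun r => ENNReal.ofReal ((5 / 2 - 1) * (t ^ 2 + r) ^ (-(5 / 2) : ℝ)) with hw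
  have hwm : Measurable w := by simp only [hw]; fun_prop
  have hs : MeasurableSet {q : ℝ × ℝ | |q.1 - x| < q.2} :=
    (isOpen_lt (by fun_prop) (by fun_prop)).measurableSet
  have h1 : ∀ y, ENNReal.ofReal (majorant t (y - x)) * g y =
      ENNReal.ofReal t * ∫⁻ r in Ioi (0 : ℝ), {r | |y - x| < r}.indicator (fun r => w r * g y) r := by
    intro y
    rw [setLIntegral_indicator (show MeasurableSet {r : ℝ | |y - x| < r} from measurableSet_Ioi),
      show {r | |y - x| < r} ∩ Ioi 0 = Ioi |y - x| by
        ext r; simp only [mem_inter_iff, mem_ofPred_eq, mem_Ioi]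
        exact ⟨fun h => h.1, fun h => ⟨h, (abs_nonneg _).trans_lt h⟩⟩,
      lintegral_mul_const _ hwm, lintegral_Ioi_add_rpow ht2 (by norm_num) (abs_nonneg _),
      ← mul_assoc, ← ENNReal.ofReal_mul ht.le]
    congr 2
    rw [majorant]
    norm_num
  unfold majorantConv
  simp_rw [h1]
  have hm : Measurable (Function.uncurry fun (y r : ℝ) =>
      {r | |y - x| < r}.indicator (fun r => w r * g y) r) :=
    Measurable.indicator (f := fun q : ℝ × ℝ => w q.2 * g q.1)
      ((hwm.comp measurable_snd).mul (hg.comp measurable_fst)) hs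
  rw [lintegral_const_mul' _ _ ENNReal.ofReal_ne_top,
    lintegral_lintegral_swap hm.aemeasurable]
  have h2 : ∀ r ∈ Ioi (0 : ℝ), ∫⁻ y, {r | |y - x| < r}.indicator (fun r => w r * g y) r ≤
      ENNReal.ofReal ((3 / 2 - 1) * (t ^ 2 + r) ^ (-(3 / 2) : ℝ)) * (6 * maximalFn g x) := by
    intro r hr
    have hr0 : (0 : ℝ) < r := hr
    have h3 : ∀ y, {r | |y - x| < r}.indicator (fun r => w r * g y) r ≤
        (closedBall x r).indicator (fun y => w r * g y) y := by
      intro y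
      by_cases hy : |y - x| < r
      · have : y ∈ closedBall x r := by rw [mem_closedBall, Real.dist_eq]; exact hy.le
        rw [indicator_of_mem (by exact hy), indicator_of_mem this]
      · rw [indicator_of_notMem (by exact hy)]; exact zero_le
    calc _ ≤ _ := lintegral_mono h3
      _ = w r * ∫⁻ y in closedBall x r, g y := by
        rw [lintegral_indicator measurableSet_closedBall, lintegral_const_mul _ hg]
      _ ≤ w r * (ENNReal.ofReal (2 * r) * maximalFn g x) := by
        gcongr; exact setLIntegral_closedBall_le g x hr0
      _ ≤ _ := by
        rw [← mul_assoc, ← mul_assoc]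
        refine mul_le_mul_left ?_ _
        rw [hw, ← ENNReal.ofReal_mul (by positivity), show (6 : ℝ≥0∞) = ENNReal.ofReal 6 by norm_num,
          ← ENNReal.ofReal_mul (by positivity)]
        apply ENNReal.ofReal_le_ofReal
        have : (t ^ 2 + r) ^ (-(3 / 2) : ℝ) = (t ^ 2 + r) ^ (-(5 / 2) : ℝ) * (t ^ 2 + r) := by
          rw [← Real.rpow_add_one (by positivity)]; norm_num
        rw [this]
        have h5 : 0 ≤ (t ^ 2 + r) ^ (-(5 / 2) : ℝ) := by positivity
        nlinarith [mul_nonneg h5 ht2.le]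
  calc _ ≤ ENNReal.ofReal t * ∫⁻ r in Ioi (0 : ℝ),
        ENNReal.ofReal ((3 / 2 - 1) * (t ^ 2 + r) ^ (-(3 / 2) : ℝ)) * (6 * maximalFn g x) := by
        gcongr ENNReal.ofReal t * ?_
        exact setLIntegral_mono' measurableSet_Ioi h2
    _ = _ := by
        rw [lintegral_mul_const _ (by fun_prop), lintegral_Ioi_add_rpow ht2 (by norm_num) le_rfl,
          ← mul_assoc, ← ENNReal.ofReal_mul ht.le, add_zero, ← Real.rpow_natCast,
          ← Real.rpow_mul ht.le]
        norm_num
        rw [Real.rpow_neg_one, mul_inv_cancel₀ ht.ne', ENNReal.ofReal_one, one_mul]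

lemma majorantConv_one_le {t : ℝ} (ht : 0 < t) (x : ℝ) : majorantConv t (fun _ => 1) x ≤ 12 := by
  refine (majorantConv_le_maximalFn measurable_const ht x).trans ?_
  have : maximalFn (fun _ => 1) x ≤ 2 := by
    refine iSup_le fun n => ?_
    rw [setLIntegral_const, one_mul, Real.volume_closedBall, ENNReal.ofReal_mul zero_le_two,
      mul_left_comm, ENNReal.inv_mul_cancel (ofReal_two_zpow_ne_zero n) ENNReal.ofReal_ne_top]
    simp
  calc 6 * maximalFn (fun _ => 1) x ≤ 6 * 2 := by gcongr
    _ = 12 := by norm_num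

lemma majorant_neg (t s : ℝ) : majorant t (-s) = majorant t s := by simp [majorant]

lemma lintegral_majorant_le {t : ℝ} (ht : 0 < t) (y : ℝ) :
    ∫⁻ x, ENNReal.ofReal (majorant t (y - x)) ≤ 12 := by
  have := majorantConv_one_le ht y
  unfold majorantConv at this
  simp_rw [mul_one] at this
  convert this using 4 with x
  rw [← majorant_neg, neg_sub]

lemma lintegral_majorantConv_rpow_le {g : ℝ → ℝ≥0∞} (hg : Measurable g) {t : ℝ} (ht : 0 < t)
    {p : ℝ} (hp : 1 ≤ p) :
    ∫⁻ x, majorantConv t g x ^ p ≤ 12 ^ p * ∫⁻ y, g y ^ p := by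
  have hp0 : 0 < p := by linarith
  have hk : ∀ x, Measurable fun y => ENNReal.ofReal (majorant t (y - x)) := fun x =>
    ENNReal.measurable_ofReal.comp ((measurable_majorant_right t).comp (by fun_prop))
  have hol : ∀ x, majorantConv t g x ^ p ≤ 12 ^ (p - 1) * majorantConv t (fun y => g y ^ p) x := by
    intro x
    have h := ENNReal.lintegral_mul_norm_pow_le (μ := volume)
      (f := fun y => ENNReal.ofReal (majorant t (y - x)) * g y ^ p)
      (g := fun y => ENNReal.ofReal (majorant t (y - x)))
      ((hk x).mul (hg.pow_const p)).aemeasurable (hk x).aemeasurable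
      (p := p⁻¹) (q := 1 - p⁻¹) (by positivity) (by linarith [inv_le_one_of_one_le₀ hp]) (by ring)
    have h1 : ∀ y, (ENNReal.ofReal (majorant t (y - x)) * g y ^ p) ^ p⁻¹ *
        ENNReal.ofReal (majorant t (y - x)) ^ (1 - p⁻¹) =
        ENNReal.ofReal (majorant t (y - x)) * g y := by
      intro y
      rw [ENNReal.mul_rpow_of_nonneg _ _ (by positivity), ENNReal.rpow_rpow_inv hp0.ne',
        mul_right_comm, ← ENNReal.rpow_add_of_nonneg _ _ (by positivity)
          (by linarith [inv_le_one_of_one_le₀ hp])]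
      simp
    simp_rw [h1] at h
    have h2 : (∫⁻ y, ENNReal.ofReal (majorant t (y - x))) ≤ 12 := by
      simpa [majorantConv] using majorantConv_one_le ht x
    calc majorantConv t g x ^ p
        ≤ (majorantConv t (fun y => g y ^ p) x ^ p⁻¹ *
            (∫⁻ y, ENNReal.ofReal (majorant t (y - x))) ^ (1 - p⁻¹)) ^ p := by
          gcongr; exact h
      _ ≤ (majorantConv t (fun y => g y ^ p) x ^ p⁻¹ * 12 ^ (1 - p⁻¹)) ^ p := by
          gcongr
          linarith [inv_le_one_of_one_le₀ hp]
      _ = _ := by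
          rw [ENNReal.mul_rpow_of_nonneg _ _ hp0.le, ENNReal.rpow_inv_rpow hp0.ne',
            ← ENNReal.rpow_mul, mul_comm, sub_mul, inv_mul_cancel₀ hp0.ne', one_mul]
  calc _ ≤ ∫⁻ x, 12 ^ (p - 1) * majorantConv t (fun y => g y ^ p) x := lintegral_mono hol
    _ = 12 ^ (p - 1) * ∫⁻ y, ∫⁻ x, ENNReal.ofReal (majorant t (y - x)) * g y ^ p := by
        rw [lintegral_const_mul']
        · congr 1
          unfold majorantConv
          refine lintegral_lintegral_swap (Measurable.aemeasurable ?_)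
          exact (ENNReal.measurable_ofReal.comp
            ((measurable_majorant_right t).comp (by fun_prop))).mul
            ((hg.comp measurable_snd).pow_const p)
        · exact ENNReal.rpow_ne_top_of_nonneg (by linarith) (by norm_num)
    _ ≤ 12 ^ (p - 1) * ∫⁻ y, 12 * g y ^ p := by
        gcongr with y
        have hk' : Measurable fun x => ENNReal.ofReal (majorant t (y - x)) :=
          ENNReal.measurable_ofReal.comp ((measurable_majorant_right t).comp (by fun_prop))
        rw [lintegral_mul_const _ hk']
        gcongr
        exact lintegral_majorant_le ht y
    _ = _ := by
        rw [lintegral_const_mul _ (hg.pow_const p), ← mul_assoc]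
        congr 1
        conv_lhs => rw [← ENNReal.rpow_one 12]
        rw [ENNReal.rpow_one, show p = (p - 1) + 1 by ring,
          ENNReal.rpow_add_of_nonneg _ _ (by linarith) zero_le_one, ENNReal.rpow_one]
        congr 2; ring

end PoissonSquare

/-! ### The subordinated Poisson kernel and its derivatives -/

namespace PoissonSquare

open Set ENNReal Metric

/-- Functions `s^(-a) Q(t²/s) exp(-t²/(4s))` on `s > 0`, extended by zero. -/
noncomputable def gaussKernel (a : ℝ) (Q : ℝ → ℝ) (t s : ℝ) : ℝ :=
  if 0 < s then s ^ (-a) * Q (t ^ 2 / s) * Real.exp (-(t ^ 2 / s) / 4) else 0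

lemma gaussKernel_of_pos (a : ℝ) (Q : ℝ → ℝ) (t : ℝ) {s : ℝ} (hs : 0 < s) :
    gaussKernel a Q t s = s ^ (-a) * Q (t ^ 2 / s) * Real.exp (-(t ^ 2 / s) / 4) := if_pos hs

lemma gaussKernel_of_nonpos (a : ℝ) (Q : ℝ → ℝ) (t : ℝ) {s : ℝ} (hs : s ≤ 0) :
    gaussKernel a Q t s = 0 := if_neg (not_lt.2 hs)

lemma measurable_gaussKernel (a : ℝ) {Q : ℝ → ℝ} (hQ : Measurable Q) :
    Measurable fun q : ℝ × ℝ => gaussKernel a Q q.1 q.2 := by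
  unfold gaussKernel
  refine Measurable.ite (measurableSet_lt measurable_const measurable_snd) ?_ measurable_const
  fun_prop

/-- A constant with `(1+w)^7 exp(-w/4) ≤ expConst`. -/
def expConst : ℝ := 2 * (4 ^ 7 * 5040)

lemma one_add_pow_mul_exp_le {w : ℝ} (hw : 0 ≤ w) :
    (1 + w) ^ 7 * Real.exp (-w / 4) ≤ expConst := by
  have h := Real.pow_div_factorial_le_exp ((1 + w) / 4) (by positivity) 7
  have h2 : Real.exp ((1 + w) / 4) = Real.exp (1 / 4) * Real.exp (w / 4) := by
    rw [← Real.exp_add]; ring_nf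
  have h3 : Real.exp (1 / 4) ≤ 2 := by
    have h4 : Real.exp (1 / 4) ^ 4 ≤ 2 ^ 4 := by
      rw [← Real.exp_nat_mul]
      have := Real.exp_one_lt_d9
      norm_num
      linarith
    exact le_of_pow_le_pow_left₀ (by norm_num) (by norm_num) h4
  have h5 : (1 + w) ^ 7 ≤ expConst * Real.exp (w / 4) := by
    have h6 : ((1 + w) / 4) ^ 7 / (Nat.factorial 7 : ℝ) = (1 + w) ^ 7 / (4 ^ 7 * 5040) := by
      rw [div_pow, show Nat.factorial 7 = 5040 from rfl]; push_cast; ring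
    rw [h6, h2, div_le_iff₀ (by norm_num)] at h
    refine h.trans ?_
    unfold expConst
    have := Real.exp_pos (w / 4)
    nlinarith
  calc _ ≤ expConst * Real.exp (w / 4) * Real.exp (-w / 4) := by gcongr
    _ = expConst := by rw [mul_assoc, ← Real.exp_add]; ring_nf; simp

lemma abs_gaussKernel_le {a : ℝ} (ha5 : a ≤ 3) {Q : ℝ → ℝ} {A : ℝ}
    (hQ : ∀ w, 0 ≤ w → |Q w| ≤ A * (1 + w) ^ 2) {t : ℝ} (ht : 0 < t) (s : ℝ) :
    |gaussKernel a Q t s| ≤ A * expConst * (s ^ 2 * (t ^ 2 + |s|) ^ (-(a + 2))) := by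
  have hA : 0 ≤ A := by simpa using (abs_nonneg _).trans (hQ 0 le_rfl)
  have hE : 0 ≤ expConst := by unfold expConst; norm_num
  rcases le_or_gt s 0 with hs | hs
  · rw [gaussKernel_of_nonpos _ _ _ hs, abs_zero]
    have : 0 ≤ (t ^ 2 + |s|) ^ (-(a + 2)) := Real.rpow_nonneg (by positivity) _
    positivity
  · rw [gaussKernel_of_pos _ _ _ hs, abs_of_pos hs]
    set w := t ^ 2 / s with hw
    have hw0 : 0 ≤ w := by positivity
    have h1 : t ^ 2 + s = s * (1 + w) := by rw [hw]; field_simp; ring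
    have h2 := one_add_pow_mul_exp_le hw0
    have h3 : (1 + w) ^ 2 * Real.exp (-w / 4) ≤ expConst * (1 + w) ^ (-(a + 2)) := by
      calc (1 + w) ^ 2 * Real.exp (-w / 4)
          = ((1 + w) ^ 7 * Real.exp (-w / 4)) * (1 + w) ^ (-5 : ℝ) := by
            rw [show (-5 : ℝ) = ((-5 : ℤ) : ℝ) by norm_num, Real.rpow_intCast]
            field_simp
        _ ≤ expConst * (1 + w) ^ (-(a + 2)) := by
            gcongr
            · linarith
            · linarith
    rw [h1, abs_mul, abs_mul, Real.abs_exp, abs_of_nonneg (Real.rpow_nonneg hs.le _),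
      Real.mul_rpow hs.le (by positivity), neg_add, Real.rpow_add hs, Real.rpow_neg hs.le 2,
      ← neg_add]
    have h4 : s ^ 2 * (s ^ (-a) * (s ^ (2 : ℝ))⁻¹ * (1 + w) ^ (-(a + 2))) =
        s ^ (-a) * (1 + w) ^ (-(a + 2)) := by
      rw [Real.rpow_two]; field_simp
    rw [h4]
    have hsa : 0 ≤ s ^ (-a) := Real.rpow_nonneg hs.le _
    calc s ^ (-a) * |Q w| * Real.exp (-w / 4)
        ≤ s ^ (-a) * (A * (1 + w) ^ 2) * Real.exp (-w / 4) := by gcongr; exact hQ w hw0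
      _ = A * s ^ (-a) * ((1 + w) ^ 2 * Real.exp (-w / 4)) := by ring
      _ ≤ A * s ^ (-a) * (expConst * (1 + w) ^ (-(a + 2))) := by gcongr
      _ = _ := by ring

lemma abs_gaussKernel_le' {a : ℝ} (ha5 : a ≤ 3) {Q : ℝ → ℝ} {A : ℝ}
    (hQ : ∀ w, 0 ≤ w → |Q w| ≤ A * (1 + w) ^ 2) {t : ℝ} (ht : 0 < t) (s : ℝ) :
    |gaussKernel a Q t s| ≤ A * expConst * (t ^ 2 + |s|) ^ (-a) := by
  have hA : 0 ≤ A := by simpa using (abs_nonneg _).trans (hQ 0 le_rfl)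
  have hE : 0 ≤ expConst := by unfold expConst; norm_num
  refine (abs_gaussKernel_le ha5 hQ ht s).trans ?_
  have hp : 0 < t ^ 2 + |s| := by positivity
  gcongr
  calc s ^ 2 * (t ^ 2 + |s|) ^ (-(a + 2)) ≤ (t ^ 2 + |s|) ^ 2 * (t ^ 2 + |s|) ^ (-(a + 2)) := by
        have := Real.rpow_nonneg hp.le (-(a + 2))
        rw [← sq_abs s]
        gcongr
        linarith [sq_nonneg t]
    _ = _ := by
        rw [← Real.rpow_two, ← Real.rpow_add hp]; ring_nf

/-- The (unnormalised) subordinated Poisson kernel. -/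
noncomputable def ker (t s : ℝ) : ℝ := t * gaussKernel (3 / 2) (fun _ => 1) t s

/-- The time derivative of `ker`. -/
noncomputable def kerT (t s : ℝ) : ℝ := gaussKernel (3 / 2) (fun w => 1 - w / 2) t s

/-- The space derivative of `ker`, which is also its second time derivative. -/
noncomputable def kerS (t s : ℝ) : ℝ := t * gaussKernel (5 / 2) (fun w => w / 4 - 3 / 2) t s

/-- The mixed derivative of `ker`. -/
noncomputable def kerTS (t s : ℝ) : ℝ :=
  gaussKernel (5 / 2) (fun w => -(3 / 2) + 3 / 2 * w - w ^ 2 / 8) t s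

/-- A constant dominating all kernel estimates. -/
noncomputable def kerConst : ℝ := 2 * expConst

lemma kerConst_pos : 0 < kerConst := by unfold kerConst expConst; norm_num

lemma abs_ker_le {t : ℝ} (ht : 0 < t) (s : ℝ) : |ker t s| ≤ kerConst * majorant t s := by
  rw [ker, abs_mul, abs_of_pos ht, majorant]
  have := abs_gaussKernel_le' (a := 3 / 2) (by norm_num) (Q := fun _ => 1) (A := 2)
    (fun w hw => by rw [abs_one]; nlinarith) ht s
  calc t * _ ≤ t * _ := mul_le_mul_of_nonneg_left this ht.le
    _ = _ := by rw [kerConst]; ring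

lemma abs_kerT_le' {t : ℝ} (ht : 0 < t) (s : ℝ) :
    |kerT t s| ≤ kerConst * (t ^ 2 + |s|) ^ (-(3 / 2) : ℝ) :=
  abs_gaussKernel_le' (a := 3 / 2) (by norm_num) (A := 2)
    (fun w hw => by rw [abs_le]; constructor <;> nlinarith) ht s

lemma abs_kerT_le {t : ℝ} (ht : 0 < t) (s : ℝ) :
    |kerT t s| ≤ kerConst * t⁻¹ * majorant t s := by
  refine (abs_kerT_le' ht s).trans (le_of_eq ?_)
  rw [majorant]; field_simp

lemma rpow_five_half_le {t : ℝ} (ht : 0 < t) (s : ℝ) :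
    (t ^ 2 + |s|) ^ (-(5 / 2) : ℝ) ≤ (t ^ 3)⁻¹ * majorant t s := by
  have hp : 0 < t ^ 2 + |s| := by positivity
  have h1 : (t ^ 2 + |s|) ^ (-(5 / 2) : ℝ) =
      (t ^ 2 + |s|) ^ (-(3 / 2) : ℝ) * (t ^ 2 + |s|)⁻¹ := by
    rw [← Real.rpow_neg_one, ← Real.rpow_add hp]; norm_num
  rw [h1, majorant]
  calc _ ≤ (t ^ 2 + |s|) ^ (-(3 / 2) : ℝ) * (t ^ 2)⁻¹ := by
        gcongr
        linarith [abs_nonneg s]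
    _ = _ := by field_simp

lemma abs_kerS_le {t : ℝ} (ht : 0 < t) (s : ℝ) :
    |kerS t s| ≤ kerConst * (t ^ 2)⁻¹ * majorant t s := by
  rw [kerS, abs_mul, abs_of_pos ht]
  have := abs_gaussKernel_le' (a := 5 / 2) (by norm_num) (Q := fun w => w / 4 - 3 / 2) (A := 2)
    (fun w hw => by rw [abs_le]; constructor <;> nlinarith) ht s
  calc t * _ ≤ t * _ := mul_le_mul_of_nonneg_left this ht.le
    _ ≤ t * (2 * expConst * ((t ^ 3)⁻¹ * majorant t s)) := by
        have := rpow_five_half_le ht s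
        have h2 : 0 ≤ 2 * expConst := by unfold expConst; norm_num
        gcongr
    _ = _ := by rw [kerConst]; field_simp

lemma abs_kerTS_le {t : ℝ} (ht : 0 < t) (s : ℝ) :
    |kerTS t s| ≤ kerConst * (t ^ 2 + |s|) ^ (-(5 / 2) : ℝ) :=
  abs_gaussKernel_le' (a := 5 / 2) (by norm_num) (A := 2)
    (fun w hw => by rw [abs_le]; constructor <;> nlinarith) ht s

lemma measurable_ker : Measurable fun q : ℝ × ℝ => ker q.1 q.2 :=
  measurable_fst.mul (measurable_gaussKernel _ measurable_const)

lemma measurable_kerT : Measurable fun q : ℝ × ℝ => kerT q.1 q.2 :=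
  measurable_gaussKernel _ (by fun_prop)

lemma measurable_kerS : Measurable fun q : ℝ × ℝ => kerS q.1 q.2 :=
  measurable_fst.mul (measurable_gaussKernel _ (by fun_prop))

lemma measurable_kerTS : Measurable fun q : ℝ × ℝ => kerTS q.1 q.2 :=
  measurable_gaussKernel _ (by fun_prop)

lemma hasDerivAt_exp_time (t s : ℝ) : HasDerivAt (fun t : ℝ => Real.exp (-(t ^ 2 / s) / 4))
    (Real.exp (-(t ^ 2 / s) / 4) * (-(2 * t / s) / 4)) t := by
  have h : HasDerivAt (fun t : ℝ => -(t ^ 2 / s) / 4) (-(2 * t / s) / 4) t := by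
    simpa using (((hasDerivAt_pow 2 t).div_const s).neg).div_const 4
  exact h.exp

lemma hasDerivAt_exp_space (t : ℝ) {s : ℝ} (hs : 0 < s) :
    HasDerivAt (fun s : ℝ => Real.exp (-(t ^ 2 / s) / 4))
      (Real.exp (-(t ^ 2 / s) / 4) * (t ^ 2 / s ^ 2 / 4)) s := by
  have h : HasDerivAt (fun s : ℝ => -(t ^ 2 / s) / 4) (t ^ 2 / s ^ 2 / 4) s := by
    have := ((((hasDerivAt_inv hs.ne').const_mul (t ^ 2)).neg).div_const 4)
    refine (this.congr_deriv ?_)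
    field_simp
  exact h.exp

lemma hasDerivAt_ker_time (t s : ℝ) : HasDerivAt (fun t => ker t s) (kerT t s) t := by
  rcases le_or_gt s 0 with hs | hs
  · simp only [ker, kerT, gaussKernel_of_nonpos _ _ _ hs, mul_zero]
    exact hasDerivAt_const t 0
  · simp only [ker, kerT, gaussKernel_of_pos _ _ _ hs]
    refine ((hasDerivAt_id' t).mul ((hasDerivAt_exp_time t s).const_mul
      (s ^ (-(3 / 2) : ℝ) * 1))).congr_deriv ?_
    field_simp
    ring

lemma rpow_five_half {s : ℝ} (hs : 0 < s) : s ^ (-(5 / 2) : ℝ) = s ^ (-(3 / 2) : ℝ) / s := by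
  rw [← Real.rpow_sub_one hs.ne']; norm_num

lemma hasDerivAt_kerT_time (t s : ℝ) : HasDerivAt (fun t => kerT t s) (kerS t s) t := by
  rcases le_or_gt s 0 with hs | hs
  · simp only [kerT, kerS, gaussKernel_of_nonpos _ _ _ hs, mul_zero]
    exact hasDerivAt_const t 0
  · simp only [kerT, kerS, gaussKernel_of_pos _ _ _ hs]
    have h1 : HasDerivAt (fun t : ℝ => s ^ (-(3 / 2) : ℝ) * (1 - t ^ 2 / s / 2))
        (s ^ (-(3 / 2) : ℝ) * (-(2 * t / s / 2))) t := by
      have := ((((hasDerivAt_pow 2 t).div_const s).div_const 2).const_sub 1).const_mul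
        (s ^ (-(3 / 2) : ℝ))
      simpa using this
    refine (h1.mul (hasDerivAt_exp_time t s)).congr_deriv ?_
    rw [rpow_five_half hs]
    field_simp
    ring

lemma hasDerivAt_of_abs_le_sq {f : ℝ → ℝ} {C : ℝ} (h : ∀ s, |f s| ≤ C * s ^ 2) :
    HasDerivAt f 0 0 := by
  have h0 : f 0 = 0 := by simpa using h 0
  rw [hasDerivAt_iff_isLittleO_nhds_zero]
  simp only [zero_add, h0, sub_zero, smul_zero]
  have h1 : f =O[nhds 0] fun s : ℝ => s ^ 2 :=
    Asymptotics.IsBigO.of_bound C (.of_forall fun s => by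
      simpa [Real.norm_eq_abs] using h s)
  exact h1.trans_isLittleO (by simpa using Asymptotics.isLittleO_pow_id one_lt_two)

lemma abs_gaussKernel_le_sq {a : ℝ} (ha0 : 0 ≤ a) (ha5 : a ≤ 3) {Q : ℝ → ℝ} {A : ℝ}
    (hQ : ∀ w, 0 ≤ w → |Q w| ≤ A * (1 + w) ^ 2) {t : ℝ} (ht : 0 < t) (s : ℝ) :
    |gaussKernel a Q t s| ≤ A * expConst * (t ^ 2) ^ (-(a + 2)) * s ^ 2 := by
  have hA : 0 ≤ A := by simpa using (abs_nonneg _).trans (hQ 0 le_rfl)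
  have hE : 0 ≤ expConst := by unfold expConst; norm_num
  refine (abs_gaussKernel_le ha5 hQ ht s).trans ?_
  rw [mul_assoc (A * expConst), mul_comm (s ^ 2)]
  have : (t ^ 2 + |s|) ^ (-(a + 2)) ≤ (t ^ 2) ^ (-(a + 2)) :=
    Real.rpow_le_rpow_of_nonpos (by positivity) (by linarith [abs_nonneg s]) (by linarith)
  gcongr

lemma hasDerivAt_ker_space {t : ℝ} (ht : 0 < t) (s : ℝ) :
    HasDerivAt (fun s => ker t s) (kerS t s) s := by
  rcases lt_trichotomy s 0 with hs | rfl | hs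
  · rw [kerS, gaussKernel_of_nonpos _ _ _ hs.le, mul_zero]
    refine (hasDerivAt_const s (0 : ℝ)).congr_of_eventuallyEq ?_
    filter_upwards [gt_mem_nhds hs] with r hr
    rw [ker, gaussKernel_of_nonpos _ _ _ hr.le, mul_zero]
  · rw [kerS, gaussKernel_of_nonpos _ _ _ le_rfl]
    exact (hasDerivAt_of_abs_le_sq (abs_gaussKernel_le_sq (a := 3 / 2) (by norm_num) (by norm_num)
      (Q := fun _ => 1) (A := 2) (fun w hw => by rw [abs_one]; nlinarith) ht)).const_mul t
  · have h1 : HasDerivAt (fun s : ℝ => t * (s ^ (-(3 / 2) : ℝ) * 1 * Real.exp (-(t ^ 2 / s) / 4)))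
        (kerS t s) s := by
      refine ((((Real.hasDerivAt_rpow_const (p := (-(3 / 2) : ℝ)) (Or.inl hs.ne')).mul_const 1).mul
        (hasDerivAt_exp_space t hs)).const_mul t).congr_deriv ?_
      rw [kerS, gaussKernel_of_pos _ _ _ hs, rpow_five_half hs, Real.rpow_sub_one hs.ne']
      field_simp
      ring
    refine h1.congr_of_eventuallyEq ?_
    filter_upwards [lt_mem_nhds hs] with r hr
    rw [ker, gaussKernel_of_pos _ _ _ hr]

lemma hasDerivAt_kerT_space {t : ℝ} (ht : 0 < t) (s : ℝ) :
    HasDerivAt (fun s => kerT t s) (kerTS t s) s := by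
  rcases lt_trichotomy s 0 with hs | rfl | hs
  · rw [kerTS, gaussKernel_of_nonpos _ _ _ hs.le]
    refine (hasDerivAt_const s (0 : ℝ)).congr_of_eventuallyEq ?_
    filter_upwards [gt_mem_nhds hs] with r hr
    rw [kerT, gaussKernel_of_nonpos _ _ _ hr.le]
  · rw [kerTS, gaussKernel_of_nonpos _ _ _ le_rfl]
    exact hasDerivAt_of_abs_le_sq (abs_gaussKernel_le_sq (a := 3 / 2) (by norm_num) (by norm_num)
      (Q := fun w => 1 - w / 2) (A := 2)
      (fun w hw => by rw [abs_le]; constructor <;> nlinarith) ht)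
  · have h0 : HasDerivAt (fun s : ℝ => 1 - t ^ 2 / s / 2) (t ^ 2 / s ^ 2 / 2) s := by
      have := (((hasDerivAt_inv hs.ne').const_mul (t ^ 2)).div_const 2).const_sub 1
      refine this.congr_deriv ?_
      field_simp
    have h1 : HasDerivAt (fun s : ℝ =>
        s ^ (-(3 / 2) : ℝ) * (1 - t ^ 2 / s / 2) * Real.exp (-(t ^ 2 / s) / 4)) (kerTS t s) s := by
      refine (((Real.hasDerivAt_rpow_const (p := (-(3 / 2) : ℝ)) (Or.inl hs.ne')).mul h0).mul
        (hasDerivAt_exp_space t hs)).congr_deriv ?_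
      rw [kerTS, gaussKernel_of_pos _ _ _ hs, rpow_five_half hs, Real.rpow_sub_one hs.ne']
      simp only [Pi.mul_apply]
      field_simp
      ring
    refine h1.congr_of_eventuallyEq ?_
    filter_upwards [lt_mem_nhds hs] with r hr
    rw [kerT, gaussKernel_of_pos _ _ _ hr]

end PoissonSquare

/-! ### Convolution against the kernels -/

namespace PoissonSquare

open Set ENNReal Metric

/-- Measurable kernels on the right half-line dominated by `t^(-n) * majorant`. -/
structure IsKernel (k : ℝ → ℝ → ℝ) (n : ℕ) : Prop where
  meas : Measurable fun q : ℝ × ℝ => k q.1 q.2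
  bound : ∀ t, 0 < t → ∀ s, |k t s| ≤ kerConst * (t ^ n)⁻¹ * majorant t s

lemma isKernel_ker : IsKernel ker 0 :=
  ⟨measurable_ker, fun t ht s => by simpa using abs_ker_le ht s⟩

lemma isKernel_kerT : IsKernel kerT 1 :=
  ⟨measurable_kerT, fun t ht s => by simpa using abs_kerT_le ht s⟩

lemma isKernel_kerS : IsKernel kerS 2 :=
  ⟨measurable_kerS, fun _ ht s => abs_kerS_le ht s⟩

lemma isKernel_kerTS : IsKernel kerTS 3 :=
  ⟨measurable_kerTS, fun t ht s => (abs_kerTS_le ht s).trans (by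
    rw [mul_assoc]
    exact mul_le_mul_of_nonneg_left (rpow_five_half_le ht s) kerConst_pos.le)⟩

/-- The integral operator `f ↦ ∫ k t (y - x) f y dy`. -/
noncomputable def conv (k : ℝ → ℝ → ℝ) (f : ℝ → ℝ) (t x : ℝ) : ℝ := ∫ y, k t (y - x) * f y

namespace IsKernel

variable {k k' : ℝ → ℝ → ℝ} {n n' : ℕ} {f : ℝ → ℝ}

lemma abs_le (hk : IsKernel k n) {t : ℝ} (ht : 0 < t) (s : ℝ) :
    |k t s| ≤ kerConst * (t ^ (n + 2))⁻¹ := by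
  refine (hk.bound t ht s).trans ?_
  rw [pow_add, mul_inv, ← mul_assoc]
  have := kerConst_pos
  gcongr
  exact majorant_le ht s

lemma meas_right (hk : IsKernel k n) (t x : ℝ) : Measurable fun y => k t (y - x) :=
  hk.meas.comp (by fun_prop : Measurable fun y : ℝ => (t, y - x))

lemma integrable (hk : IsKernel k n) (hf : Integrable f) {t : ℝ} (ht : 0 < t) (x : ℝ) :
    Integrable fun y => k t (y - x) * f y :=
  hf.bdd_mul (c := kerConst * (t ^ (n + 2))⁻¹) (hk.meas_right t x).aestronglyMeasurable
    (.of_forall fun y => by rw [Real.norm_eq_abs]; exact hk.abs_le ht _)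

lemma enorm_conv_le (hk : IsKernel k n) (f : ℝ → ℝ) {t : ℝ} (ht : 0 < t) (x : ℝ) :
    ‖conv k f t x‖ₑ ≤
      ENNReal.ofReal (kerConst * (t ^ n)⁻¹) * majorantConv t (fun y => ‖f y‖ₑ) x := by
  refine (enorm_integral_le_lintegral_enorm _).trans ?_
  rw [majorantConv, ← lintegral_const_mul' _ _ ofReal_ne_top]
  refine lintegral_mono fun y => ?_
  have := kerConst_pos
  rw [enorm_mul, ← mul_assoc, ← ofReal_mul (by positivity), Real.enorm_eq_ofReal_abs]
  gcongr
  exact hk.bound t ht _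

lemma enorm_conv_le_maximalFn (hk : IsKernel k n) (hf : Measurable f) {t : ℝ} (ht : 0 < t)
    (x : ℝ) :
    ‖conv k f t x‖ₑ ≤
      ENNReal.ofReal (kerConst * (t ^ n)⁻¹) * (6 * maximalFn (fun y => ‖f y‖ₑ) x) :=
  (hk.enorm_conv_le f ht x).trans
    (mul_le_mul_right (majorantConv_le_maximalFn hf.enorm ht x) _)

lemma abs_conv_le (hk : IsKernel k n) (hf : Integrable f) {t : ℝ} (ht : 0 < t) (x : ℝ) :
    |conv k f t x| ≤ kerConst * (t ^ (n + 2))⁻¹ * ∫ y, |f y| := by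
  rw [conv, ← Real.norm_eq_abs, ← integral_const_mul]
  refine norm_integral_le_of_norm_le (hf.abs.const_mul _) (.of_forall fun y => ?_)
  rw [Real.norm_eq_abs, abs_mul]
  exact mul_le_mul_of_nonneg_right (hk.abs_le ht _) (abs_nonneg _)

lemma measurable_conv (hk : IsKernel k n) (hf : Measurable f) :
    Measurable fun q : ℝ × ℝ => conv k f q.1 q.2 := by
  have h : StronglyMeasurable fun z : (ℝ × ℝ) × ℝ => k z.1.1 (z.2 - z.1.2) * f z.2 := by
    refine Measurable.stronglyMeasurable ?_
    exact (hk.meas.comp (by fun_prop : Measurable fun z : (ℝ × ℝ) × ℝ =>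
      (z.1.1, z.2 - z.1.2))).mul (hf.comp measurable_snd)
  exact h.integral_prod_right.measurable

lemma conv_add (hk : IsKernel k n) {f g : ℝ → ℝ} (hf : Integrable f) (hg : Integrable g) {t : ℝ}
    (ht : 0 < t) (x : ℝ) :
    conv k (fun y => f y + g y) t x = conv k f t x + conv k g t x := by
  simp only [conv, mul_add]
  exact integral_add (hk.integrable hf ht x) (hk.integrable hg ht x)

lemma hasDerivAt_time (hk : IsKernel k n) (hk' : IsKernel k' n')
    (hd : ∀ t s, HasDerivAt (fun t => k t s) (k' t s) t) (hf : Integrable f) {t : ℝ}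
    (ht : 0 < t) (x : ℝ) : HasDerivAt (fun t => conv k f t x) (conv k' f t x) t := by
  have hs : Ioi (t / 2) ∈ nhds t := Ioi_mem_nhds (by linarith)
  refine (hasDerivAt_integral_of_dominated_loc_of_deriv_le
    (F := fun t y => k t (y - x) * f y) (F' := fun t y => k' t (y - x) * f y)
    (bound := fun y => kerConst * ((t / 2) ^ (n' + 2))⁻¹ * |f y|) hs
    (.of_forall fun r => (hk.meas_right r x).aestronglyMeasurable.mul hf.aestronglyMeasurable)
    (hk.integrable hf ht x)
    ((hk'.meas_right t x).aestronglyMeasurable.mul hf.aestronglyMeasurable)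
    (.of_forall fun y r hr => ?_) (hf.abs.const_mul _)
    (.of_forall fun y r hr => (hd r (y - x)).mul_const (f y))).2
  have hr : t / 2 < r := hr
  rw [Real.norm_eq_abs, abs_mul]
  refine mul_le_mul_of_nonneg_right ((hk'.abs_le (by linarith) _).trans ?_) (abs_nonneg _)
  have := kerConst_pos
  gcongr

lemma hasDerivAt_space (hk : IsKernel k n) (hk' : IsKernel k' n') {t : ℝ} (ht : 0 < t)
    (hd : ∀ s, HasDerivAt (fun s => k t s) (k' t s) s) (hf : Integrable f) (x : ℝ) :
    HasDerivAt (fun x => conv k f t x) (-conv k' f t x) x := by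
  have h := (hasDerivAt_integral_of_dominated_loc_of_deriv_le (x₀ := x)
    (F := fun x y => k t (y - x) * f y) (F' := fun x y => -(k' t (y - x) * f y))
    (bound := fun y => kerConst * (t ^ (n' + 2))⁻¹ * |f y|) Filter.univ_mem
    (.of_forall fun r => (hk.meas_right t r).aestronglyMeasurable.mul hf.aestronglyMeasurable)
    (hk.integrable hf ht x)
    ((hk'.meas_right t x).aestronglyMeasurable.mul hf.aestronglyMeasurable).neg
    (.of_forall fun y r _ => ?_) (hf.abs.const_mul _)
    (.of_forall fun y r _ => ?_)).2
  · rw [integral_neg] at h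
    exact h
  · rw [norm_neg, Real.norm_eq_abs, abs_mul]
    exact mul_le_mul_of_nonneg_right (hk'.abs_le ht _) (abs_nonneg _)
  · have h1 : HasDerivAt (fun x : ℝ => y - x) (-1) r := by
      simpa using (hasDerivAt_id r).const_sub y
    have := ((hd (y - r)).comp r h1).mul_const (f y)
    simpa using this

end IsKernel

variable {f : ℝ → ℝ}

lemma hasDerivAt_ext_time (hf : Integrable f) {t : ℝ} (ht : 0 < t) (x : ℝ) :
    HasDerivAt (fun t => conv ker f t x) (conv kerT f t x) t :=
  isKernel_ker.hasDerivAt_time isKernel_kerT hasDerivAt_ker_time hf ht x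

lemma hasDerivAt_extT_time (hf : Integrable f) {t : ℝ} (ht : 0 < t) (x : ℝ) :
    HasDerivAt (fun t => conv kerT f t x) (conv kerS f t x) t :=
  isKernel_kerT.hasDerivAt_time isKernel_kerS hasDerivAt_kerT_time hf ht x

lemma hasDerivAt_ext_space (hf : Integrable f) {t : ℝ} (ht : 0 < t) (x : ℝ) :
    HasDerivAt (fun x => conv ker f t x) (-conv kerS f t x) x :=
  isKernel_ker.hasDerivAt_space isKernel_kerS ht (hasDerivAt_ker_space ht) hf x

lemma hasDerivAt_extT_space (hf : Integrable f) {t : ℝ} (ht : 0 < t) (x : ℝ) :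
    HasDerivAt (fun x => conv kerT f t x) (-conv kerTS f t x) x :=
  isKernel_kerT.hasDerivAt_space isKernel_kerTS ht (hasDerivAt_kerT_space ht) hf x

lemma conv_ker_abs_le_tail (hf : Integrable f) {t : ℝ} (ht : 0 < t) (x : ℝ) :
    |conv ker f t x| ≤ kerConst * (t ^ 2)⁻¹ * ∫ y in Ioi x, |f y| := by
  rw [conv, ← Real.norm_eq_abs, ← integral_const_mul, ← integral_indicator measurableSet_Ioi]
  refine norm_integral_le_of_norm_le
    ((hf.abs.const_mul _).indicator measurableSet_Ioi) (.of_forall fun y => ?_)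
  by_cases hy : x < y
  · rw [indicator_of_mem (show y ∈ Ioi x from hy), Real.norm_eq_abs, abs_mul]
    exact mul_le_mul_of_nonneg_right (by simpa using isKernel_ker.abs_le ht (y - x)) (abs_nonneg _)
  · rw [indicator_of_notMem (show y ∉ Ioi x from hy), ker,
      gaussKernel_of_nonpos _ _ _ (by linarith)]
    simp

end PoissonSquare

/-! ### Regularised powers -/

namespace PoissonSquare

open Set ENNReal Metric

/-- The regularised power `(v² + ε²)^(p/2) - ε^p`. -/
noncomputable def regPow (p ε v : ℝ) : ℝ := (v ^ 2 + ε ^ 2) ^ (p / 2) - ε ^ p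

/-- The first derivative of `regPow`. -/
noncomputable def regPow' (p ε v : ℝ) : ℝ := p * v * (v ^ 2 + ε ^ 2) ^ (p / 2 - 1)

/-- The second derivative of `regPow`. -/
noncomputable def regPow'' (p ε v : ℝ) : ℝ :=
  p * (v ^ 2 + ε ^ 2) ^ (p / 2 - 1) + p * (p - 2) * v ^ 2 * (v ^ 2 + ε ^ 2) ^ (p / 2 - 2)

section regPow

variable {p ε : ℝ}

lemma hasDerivAt_sq_add_rpow (hε : 0 < ε) (q v : ℝ) :
    HasDerivAt (fun v : ℝ => (v ^ 2 + ε ^ 2) ^ q) (2 * v * q * (v ^ 2 + ε ^ 2) ^ (q - 1)) v := by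
  have h : HasDerivAt (fun v : ℝ => v ^ 2 + ε ^ 2) (2 * v) v := by
    simpa using (hasDerivAt_pow 2 v).add_const (ε ^ 2)
  exact h.rpow_const (Or.inl (by positivity))

lemma hasDerivAt_regPow (hε : 0 < ε) (p v : ℝ) :
    HasDerivAt (regPow p ε) (regPow' p ε v) v := by
  refine ((hasDerivAt_sq_add_rpow hε (p / 2) v).sub_const (ε ^ p)).congr_deriv ?_
  rw [regPow']; ring

lemma hasDerivAt_regPow' (hε : 0 < ε) (p v : ℝ) :
    HasDerivAt (regPow' p ε) (regPow'' p ε v) v := by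
  have h1 : HasDerivAt (fun v : ℝ => p * v) p v := by
    simpa using (hasDerivAt_id v).const_mul p
  refine (h1.mul (hasDerivAt_sq_add_rpow hε (p / 2 - 1) v)).congr_deriv ?_
  rw [regPow'', show p / 2 - 1 - 1 = p / 2 - 2 by ring]; ring

lemma regPow''_ge (hε : 0 < ε) (hp : 1 < p) (hp2 : p ≤ 2) (v : ℝ) :
    p * (p - 1) * (v ^ 2 + ε ^ 2) ^ (p / 2 - 1) ≤ regPow'' p ε v := by
  have hW : 0 < v ^ 2 + ε ^ 2 := by positivity
  have h : (v ^ 2 + ε ^ 2) ^ (p / 2 - 1) = (v ^ 2 + ε ^ 2) ^ (p / 2 - 2) * (v ^ 2 + ε ^ 2) := by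
    rw [← Real.rpow_add_one hW.ne']; ring_nf
  have h0 := Real.rpow_nonneg hW.le (p / 2 - 2)
  rw [regPow'', h]
  have : 0 ≤ (v ^ 2 + ε ^ 2) ^ (p / 2 - 2) * (p * (2 - p) * ε ^ 2) := by
    have : 0 ≤ 2 - p := by linarith
    positivity
  nlinarith

lemma sq_add_rpow_le (hε : 0 < ε) (hp2 : p ≤ 2) (v : ℝ) :
    (v ^ 2 + ε ^ 2) ^ (p / 2 - 1) ≤ (ε ^ 2) ^ (p / 2 - 1) :=
  Real.rpow_le_rpow_of_nonpos (by positivity) (by linarith [sq_nonneg v]) (by linarith)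

lemma regPow''_nonneg (hε : 0 < ε) (hp : 1 < p) (hp2 : p ≤ 2) (v : ℝ) :
    0 ≤ regPow'' p ε v := by
  refine le_trans ?_ (regPow''_ge hε hp hp2 v)
  have : 0 ≤ p - 1 := by linarith
  positivity

lemma regPow''_le (hε : 0 < ε) (hp : 1 < p) (hp2 : p ≤ 2) (v : ℝ) :
    regPow'' p ε v ≤ p * (ε ^ 2) ^ (p / 2 - 1) := by
  have h1 := sq_add_rpow_le hε hp2 v
  have : 0 ≤ p * (2 - p) * v ^ 2 * (v ^ 2 + ε ^ 2) ^ (p / 2 - 2) := by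
    have : 0 ≤ 2 - p := by linarith
    positivity
  rw [regPow'']
  nlinarith

lemma abs_regPow'_le (hε : 0 < ε) (hp : 1 < p) (hp2 : p ≤ 2) (v : ℝ) :
    |regPow' p ε v| ≤ p * (ε ^ 2) ^ (p / 2 - 1) * |v| := by
  have h1 := sq_add_rpow_le hε hp2 v
  rw [regPow', abs_mul, abs_mul, abs_of_pos (by linarith : 0 < p),
    abs_of_nonneg (Real.rpow_nonneg (by positivity) _)]
  calc p * |v| * (v ^ 2 + ε ^ 2) ^ (p / 2 - 1) ≤ p * |v| * (ε ^ 2) ^ (p / 2 - 1) := by gcongr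
    _ = _ := by ring

lemma sq_rpow_half {a : ℝ} (ha : 0 ≤ a) (p : ℝ) : (a ^ 2) ^ (p / 2) = a ^ p := by
  rw [← Real.rpow_two, ← Real.rpow_mul ha]; congr 1; ring

lemma regPow_nonneg (hε : 0 < ε) (hp : 1 < p) (v : ℝ) : 0 ≤ regPow p ε v := by
  rw [regPow, ← sq_rpow_half hε.le, sub_nonneg]
  gcongr
  linarith [sq_nonneg v]

lemma regPow_le (hε : 0 < ε) (hp : 1 < p) (hp2 : p ≤ 2) (v : ℝ) : regPow p ε v ≤ |v| ^ p := by
  rw [regPow, ← sq_rpow_half hε.le, ← sq_rpow_half (abs_nonneg v), sq_abs, sub_le_iff_le_add]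
  exact Real.rpow_add_le_add_rpow (sq_nonneg _) (sq_nonneg _) (by linarith) (by linarith)

@[fun_prop]
lemma measurable_regPow : Measurable (regPow p ε) := by unfold regPow; fun_prop

@[fun_prop]
lemma measurable_regPow' : Measurable (regPow' p ε) := by unfold regPow'; fun_prop

@[fun_prop]
lemma measurable_regPow'' : Measurable (regPow'' p ε) := by unfold regPow''; fun_prop

end regPow

end PoissonSquare

/-! ### The energy identity on a box -/

namespace PoissonSquare

open Set ENNReal Metric

section box

variable {p ε δ T R : ℝ} {f : ℝ → ℝ}

lemma IsKernel.abs_conv_le_of_le {k : ℝ → ℝ → ℝ} {n : ℕ} (hk : IsKernel k n) (hf : Integrable f)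
    (hδ : 0 < δ) {t : ℝ} (ht : δ ≤ t) (x : ℝ) :
    |conv k f t x| ≤ kerConst * (δ ^ (n + 2))⁻¹ * ∫ y, |f y| := by
  refine (hk.abs_conv_le hf (hδ.trans_le ht) x).trans ?_
  have := kerConst_pos
  have : 0 ≤ ∫ y, |f y| := integral_nonneg fun y => abs_nonneg _
  gcongr

lemma IsKernel.measurable_conv_time {k : ℝ → ℝ → ℝ} {n : ℕ} (hk : IsKernel k n)
    (hf : Measurable f) (x : ℝ) : Measurable fun t => conv k f t x :=
  (hk.measurable_conv hf).comp (measurable_id.prodMk measurable_const)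

lemma IsKernel.measurable_conv_space {k : ℝ → ℝ → ℝ} {n : ℕ} (hk : IsKernel k n)
    (hf : Measurable f) (t : ℝ) : Measurable fun x => conv k f t x :=
  (hk.measurable_conv hf).comp (measurable_const.prodMk measurable_id)

lemma integrableOn_Ioc_of_bounded {g : ℝ → ℝ} {a b C : ℝ} (hg : Measurable g)
    (h : ∀ t ∈ Ioc a b, |g t| ≤ C) : IntegrableOn g (Ioc a b) :=
  Measure.integrableOn_of_bounded measure_Ioc_lt_top.ne hg.aestronglyMeasurable
    ((ae_restrict_iff' measurableSet_Ioc).2 (.of_forall h))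

/-- The second time derivative of `regPow p ε (conv ker f)`, first part. -/
lemma abs_weighted_second_le (hε : 0 < ε) (hp : 1 < p) (hp2 : p ≤ 2) (hf : Integrable f)
    (hδ : 0 < δ) {t : ℝ} (ht : t ∈ Ioc δ T) (x : ℝ) :
    |(t - δ) * (regPow'' p ε (conv ker f t x) * conv kerT f t x ^ 2)| ≤
      (T - δ) * (p * (ε ^ 2) ^ (p / 2 - 1) *
        (kerConst * (δ ^ (1 + 2))⁻¹ * ∫ y, |f y|) ^ 2) := by
  have h1 := isKernel_kerT.abs_conv_le_of_le hf hδ ht.1.le x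
  have h2 := regPow''_le hε hp hp2 (conv ker f t x)
  have h3 := regPow''_nonneg hε hp hp2 (conv ker f t x)
  rw [abs_mul, abs_mul, abs_of_pos (sub_pos.2 ht.1), abs_of_nonneg h3, abs_pow]
  have := ht.1
  gcongr
  · linarith [ht.2]
  · exact ht.2

lemma abs_weighted_first_le (hε : 0 < ε) (hp : 1 < p) (hp2 : p ≤ 2) (hf : Integrable f)
    (hδ : 0 < δ) {t : ℝ} (ht : t ∈ Ioc δ T) (x : ℝ) :
    |(t - δ) * (regPow' p ε (conv ker f t x) * conv kerS f t x)| ≤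
      (T - δ) * (p * (ε ^ 2) ^ (p / 2 - 1) * (kerConst * (δ ^ (0 + 2))⁻¹ * ∫ y, |f y|) *
        (kerConst * (δ ^ (2 + 2))⁻¹ * ∫ y, |f y|)) := by
  have h1 := isKernel_ker.abs_conv_le_of_le hf hδ ht.1.le x
  have h2 := isKernel_kerS.abs_conv_le_of_le hf hδ ht.1.le x
  have h3 := abs_regPow'_le hε hp hp2 (conv ker f t x)
  have h4 : 0 ≤ kerConst * (δ ^ (0 + 2))⁻¹ * ∫ y, |f y| := (abs_nonneg _).trans h1
  rw [abs_mul, abs_mul, abs_of_pos (sub_pos.2 ht.1)]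
  have := ht.1
  gcongr
  · linarith [ht.2]
  · exact ht.2
  · exact h3.trans (by gcongr)

lemma integral_time (hε : 0 < ε) (hp : 1 < p) (hp2 : p ≤ 2) (hf : Integrable f)
    (hfm : Measurable f) (hδ : 0 < δ) (hT : δ ≤ T) (x : ℝ) :
    ∫ t in Ioc δ T, ((t - δ) * (regPow'' p ε (conv ker f t x) * conv kerT f t x ^ 2)
        + (t - δ) * (regPow' p ε (conv ker f t x) * conv kerS f t x)) =
      (T - δ) * (regPow' p ε (conv ker f T x) * conv kerT f T x)
        - regPow p ε (conv ker f T x) + regPow p ε (conv ker f δ x) := by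
  have hm0 := isKernel_ker.measurable_conv_time hfm x
  have hm1 := isKernel_kerT.measurable_conv_time hfm x
  have hm2 := isKernel_kerS.measurable_conv_time hfm x
  have hint : IntegrableOn (fun t =>
      ((t - δ) * (regPow'' p ε (conv ker f t x) * conv kerT f t x ^ 2)
        + (t - δ) * (regPow' p ε (conv ker f t x) * conv kerS f t x))) (Ioc δ T) :=
    (integrableOn_Ioc_of_bounded (by fun_prop) fun t ht =>
      abs_weighted_second_le hε hp hp2 hf hδ ht x).add
    (integrableOn_Ioc_of_bounded (by fun_prop) fun t ht =>
      abs_weighted_first_le hε hp hp2 hf hδ ht x)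
  have hd : ∀ t ∈ uIcc δ T, HasDerivAt (fun t =>
      (t - δ) * (regPow' p ε (conv ker f t x) * conv kerT f t x) - regPow p ε (conv ker f t x))
      ((t - δ) * (regPow'' p ε (conv ker f t x) * conv kerT f t x ^ 2)
        + (t - δ) * (regPow' p ε (conv ker f t x) * conv kerS f t x)) t := by
    intro t ht
    rw [uIcc_of_le hT] at ht
    have ht0 : 0 < t := hδ.trans_le ht.1
    have d0 := hasDerivAt_ext_time hf ht0 x
    have d1 := hasDerivAt_extT_time hf ht0 x
    have e0 := (hasDerivAt_regPow hε p (conv ker f t x)).comp t d0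
    have e1 := (hasDerivAt_regPow' hε p (conv ker f t x)).comp t d0
    have e2 := ((hasDerivAt_id' t).sub_const δ).mul (e1.mul d1)
    refine (e2.sub e0).congr_deriv ?_
    simp only [Pi.mul_apply, Function.comp_apply]
    ring
  rw [← intervalIntegral.integral_of_le hT, intervalIntegral.integral_eq_sub_of_hasDerivAt hd
    ((intervalIntegrable_iff_integrableOn_Ioc_of_le hT).2 hint)]
  ring

lemma integral_space (hε : 0 < ε) (hp : 1 < p) (hp2 : p ≤ 2) (hf : Integrable f)
    (hfm : Measurable f) (hδ : 0 < δ) (hR : 0 < R) {t : ℝ} (ht : t ∈ Ioc δ T) :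
    ∫ x in Ioc (-R) R, (t - δ) * (regPow' p ε (conv ker f t x) * conv kerS f t x) =
      -((t - δ) * (regPow p ε (conv ker f t R) - regPow p ε (conv ker f t (-R)))) := by
  have hm0 := isKernel_ker.measurable_conv_space hfm t
  have hm2 := isKernel_kerS.measurable_conv_space hfm t
  have ht0 : 0 < t := hδ.trans ht.1
  have hR' : -R ≤ R := by linarith
  have hd : ∀ x ∈ uIcc (-R) R, HasDerivAt (fun x => -((t - δ) * regPow p ε (conv ker f t x)))
      ((t - δ) * (regPow' p ε (conv ker f t x) * conv kerS f t x)) x := by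
    intro x _
    have d0 := hasDerivAt_ext_space hf ht0 x
    have e0 := (hasDerivAt_regPow hε p (conv ker f t x)).comp x d0
    refine (e0.const_mul (t - δ)).neg.congr_deriv ?_
    ring
  rw [← intervalIntegral.integral_of_le hR', intervalIntegral.integral_eq_sub_of_hasDerivAt hd
    ((intervalIntegrable_iff_integrableOn_Ioc_of_le hR').2
      (integrableOn_Ioc_of_bounded (by fun_prop) fun x _ =>
        abs_weighted_first_le hε hp hp2 hf hδ ht x))]
  ring

lemma integrable_box {g : ℝ → ℝ → ℝ} {C : ℝ} (hg : Measurable fun q : ℝ × ℝ => g q.1 q.2)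
    (h : ∀ x, ∀ t ∈ Ioc δ T, |g x t| ≤ C) :
    Integrable (Function.uncurry g)
      ((volume.restrict (Ioc (-R) R)).prod (volume.restrict (Ioc δ T))) := by
  rw [Measure.prod_restrict]
  refine Measure.integrableOn_of_bounded (M := C) ?_ hg.aestronglyMeasurable
    ((ae_restrict_iff' (measurableSet_Ioc.prod measurableSet_Ioc)).2
      (.of_forall fun q hq => h q.1 q.2 hq.2))
  rw [Measure.prod_prod]
  exact (mul_lt_top measure_Ioc_lt_top measure_Ioc_lt_top).ne

lemma box_identity (hε : 0 < ε) (hp : 1 < p) (hp2 : p ≤ 2) (hf : Integrable f)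
    (hfm : Measurable f) (hδ : 0 < δ) (hT : δ ≤ T) (hR : 0 < R) :
    ∫ x in Ioc (-R) R, ∫ t in Ioc δ T,
        (t - δ) * (regPow'' p ε (conv ker f t x) * conv kerT f t x ^ 2) =
      (∫ x in Ioc (-R) R, ((T - δ) * (regPow' p ε (conv ker f T x) * conv kerT f T x)
        - regPow p ε (conv ker f T x) + regPow p ε (conv ker f δ x))) +
      ∫ t in Ioc δ T, (t - δ) * (regPow p ε (conv ker f t R) - regPow p ε (conv ker f t (-R))) := by
  have hm0 := (isKernel_ker.measurable_conv hfm).comp measurable_swap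
  have hm1 := (isKernel_kerT.measurable_conv hfm).comp measurable_swap
  have hm2 := (isKernel_kerS.measurable_conv hfm).comp measurable_swap
  simp only [Function.comp_def, Prod.fst_swap, Prod.snd_swap] at hm0 hm1 hm2
  have hA := integrable_box (δ := δ) (T := T) (R := R) (g := fun x t =>
    (t - δ) * (regPow'' p ε (conv ker f t x) * conv kerT f t x ^ 2)) (by fun_prop)
    fun x t ht => abs_weighted_second_le hε hp hp2 hf hδ ht x
  have hB := integrable_box (δ := δ) (T := T) (R := R) (g := fun x t =>
    (t - δ) * (regPow' p ε (conv ker f t x) * conv kerS f t x)) (by fun_prop)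
    fun x t ht => abs_weighted_first_le hε hp hp2 hf hδ ht x
  have h1 : ∫ x in Ioc (-R) R, ∫ t in Ioc δ T,
      (t - δ) * (regPow' p ε (conv ker f t x) * conv kerS f t x) =
      -∫ t in Ioc δ T,
        (t - δ) * (regPow p ε (conv ker f t R) - regPow p ε (conv ker f t (-R))) := by
    rw [integral_integral_swap hB, ← integral_neg]
    exact setIntegral_congr_fun measurableSet_Ioc fun t ht =>
      integral_space hε hp hp2 hf hfm hδ hR ht
  have h2 := integral_integral_add hA hB
  simp only [Function.uncurry_apply_pair] at h2
  have h3 := setIntegral_congr_fun (μ := volume) (measurableSet_Ioc (a := -R) (b := R))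
    fun x _ => integral_time hε hp hp2 hf hfm hδ hT x
  linarith

end box

end PoissonSquare

/-! ### Energy bounds on a box -/

namespace PoissonSquare

open Set ENNReal Metric

lemma ofReal_integral_le_lintegral {α : Type*} [MeasurableSpace α] {μ : Measure α} (g : α → ℝ) :
    ENNReal.ofReal (∫ x, g x ∂μ) ≤ ∫⁻ x, ENNReal.ofReal (g x) ∂μ := by
  by_cases hg : Integrable g μ
  · rw [integral_eq_lintegral_pos_part_sub_lintegral_neg_part hg]
    exact (ofReal_le_ofReal (sub_le_self _ toReal_nonneg)).trans ofReal_toReal_le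
  · simp [integral_undef hg]

lemma lintegral_enorm_conv_rpow_le {k : ℝ → ℝ → ℝ} (hk : IsKernel k 0) {f : ℝ → ℝ}
    (hf : Measurable f) {t p : ℝ} (ht : 0 < t) (hp : 1 ≤ p) :
    ∫⁻ x, ‖conv k f t x‖ₑ ^ p ≤ ENNReal.ofReal (12 * kerConst) ^ p * ∫⁻ x, ‖f x‖ₑ ^ p := by
  have hp0 : 0 ≤ p := by linarith
  calc ∫⁻ x, ‖conv k f t x‖ₑ ^ p
      ≤ ∫⁻ x, ENNReal.ofReal kerConst ^ p * majorantConv t (fun y => ‖f y‖ₑ) x ^ p := by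
        refine lintegral_mono fun x => ?_
        rw [← ENNReal.mul_rpow_of_nonneg _ _ hp0]
        gcongr
        simpa using hk.enorm_conv_le f ht x
    _ = ENNReal.ofReal kerConst ^ p * ∫⁻ x, majorantConv t (fun y => ‖f y‖ₑ) x ^ p :=
        lintegral_const_mul' _ _ (rpow_ne_top_of_nonneg hp0 ofReal_ne_top)
    _ ≤ ENNReal.ofReal kerConst ^ p * (12 ^ p * ∫⁻ x, ‖f x‖ₑ ^ p) := by
        gcongr
        exact lintegral_majorantConv_rpow_le hf.enorm ht hp
    _ = _ := by
        rw [mul_comm (12 : ℝ), ofReal_mul kerConst_pos.le, ENNReal.mul_rpow_of_nonneg _ _ hp0,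
          mul_assoc]
        norm_num

section box

variable {p ε δ T R : ℝ} {f : ℝ → ℝ}

/-- The weighted energy density of the extension. -/
noncomputable def energy (p ε δ : ℝ) (f : ℝ → ℝ) (q : ℝ × ℝ) : ℝ :=
  (q.2 - δ) * ((conv ker f q.2 q.1 ^ 2 + ε ^ 2) ^ (p / 2 - 1) * conv kerT f q.2 q.1 ^ 2)

lemma measurable_energy (hfm : Measurable f) : Measurable (energy p ε δ f) := by
  have hm0 := (isKernel_ker.measurable_conv hfm).comp measurable_swap
  have hm1 := (isKernel_kerT.measurable_conv hfm).comp measurable_swap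
  simp only [Function.comp_def, Prod.fst_swap, Prod.snd_swap] at hm0 hm1
  unfold energy
  fun_prop

lemma energy_box_le (hε : 0 < ε) (hp : 1 < p) (hp2 : p ≤ 2) (hf : Integrable f)
    (hfm : Measurable f) (hδ : 0 < δ) (hT : δ ≤ T) (hR : 0 < R) :
    ENNReal.ofReal (p * (p - 1)) *
        ∫⁻ q in Ioc (-R) R ×ˢ Ioc δ T, ENNReal.ofReal (energy p ε δ f q) ≤
      (ENNReal.ofReal (p * (ε ^ 2) ^ (p / 2 - 1) * kerConst * (∫ y, |f y|) * (T ^ 2)⁻¹) *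
          (ENNReal.ofReal (12 * kerConst) * ∫⁻ x, ‖f x‖ₑ)) +
        (ENNReal.ofReal (12 * kerConst) ^ p * ∫⁻ x, ‖f x‖ₑ ^ p) +
        ENNReal.ofReal (T * T * (kerConst * (δ ^ 2)⁻¹ * ∫ y in Ioi R, |f y|) ^ p) := by
  have hm0 := (isKernel_ker.measurable_conv hfm).comp measurable_swap
  have hm1 := (isKernel_kerT.measurable_conv hfm).comp measurable_swap
  simp only [Function.comp_def, Prod.fst_swap, Prod.snd_swap] at hm0 hm1
  have hp1 : 0 < p - 1 := by linarith
  have hp0 : 0 < p := by linarith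
  have hT0 : 0 < T := hδ.trans_le hT
  have hA := integrable_box (δ := δ) (T := T) (R := R) (g := fun x t =>
    (t - δ) * (regPow'' p ε (conv ker f t x) * conv kerT f t x ^ 2)) (by fun_prop)
    fun x t ht => abs_weighted_second_le hε hp hp2 hf hδ ht x
  have hA' := hA
  simp only [Function.uncurry_def] at hA'
  have step1 : ENNReal.ofReal (p * (p - 1)) *
        ∫⁻ q in Ioc (-R) R ×ˢ Ioc δ T, ENNReal.ofReal (energy p ε δ f q) ≤
      ENNReal.ofReal (∫ x in Ioc (-R) R, ∫ t in Ioc δ T,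
        (t - δ) * (regPow'' p ε (conv ker f t x) * conv kerT f t x ^ 2)) := by
    rw [integral_integral hA, ofReal_integral_eq_lintegral_ofReal hA', Measure.prod_restrict,
      ← Measure.volume_eq_prod, ← lintegral_const_mul' _ _ ofReal_ne_top]
    · refine setLIntegral_mono' (measurableSet_Ioc.prod measurableSet_Ioc) fun q hq => ?_
      rw [← ofReal_mul (by positivity)]
      refine ofReal_le_ofReal ?_
      have h1 := regPow''_ge hε hp hp2 (conv ker f q.2 q.1)
      have h2 : 0 ≤ q.2 - δ := sub_nonneg.2 hq.2.1.le
      calc p * (p - 1) * energy p ε δ f q = (q.2 - δ) * (p * (p - 1) *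
            (conv ker f q.2 q.1 ^ 2 + ε ^ 2) ^ (p / 2 - 1) * conv kerT f q.2 q.1 ^ 2) := by
            rw [energy]; ring
        _ ≤ _ := by
            gcongr
    · rw [Measure.prod_restrict]
      refine (ae_restrict_iff' (measurableSet_Ioc.prod measurableSet_Ioc)).2 (.of_forall ?_)
      intro q hq
      have h2 : 0 ≤ q.2 - δ := sub_nonneg.2 hq.2.1.le
      exact mul_nonneg h2 (mul_nonneg (regPow''_nonneg hε hp hp2 _) (sq_nonneg _))
  refine step1.trans ?_
  rw [box_identity hε hp hp2 hf hfm hδ hT hR]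
  refine ofReal_add_le.trans (add_le_add ?_ ?_)
  · refine (ofReal_integral_le_lintegral _).trans ?_
    have h1 : ∀ x, ENNReal.ofReal ((T - δ) * (regPow' p ε (conv ker f T x) * conv kerT f T x)
        - regPow p ε (conv ker f T x) + regPow p ε (conv ker f δ x)) ≤
        (ENNReal.ofReal (p * (ε ^ 2) ^ (p / 2 - 1) * kerConst * (∫ y, |f y|) * (T ^ 2)⁻¹) *
          ‖conv ker f T x‖ₑ ^ (1 : ℝ)) + ‖conv ker f δ x‖ₑ ^ p := by
      intro x
      refine ofReal_add_le.trans (add_le_add ?_ ?_)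
      · have h2 := regPow_nonneg (p := p) hε hp (conv ker f T x)
        have h3 := abs_regPow'_le hε hp hp2 (conv ker f T x)
        have h4 := isKernel_kerT.abs_conv_le hf hT0 x
        have hf0 : 0 ≤ ∫ y, |f y| := integral_nonneg fun y => abs_nonneg _
        have := kerConst_pos
        rw [ENNReal.rpow_one, Real.enorm_eq_ofReal_abs, ← ofReal_mul (by positivity)]
        refine ofReal_le_ofReal ?_
        calc _ ≤ |(T - δ) * (regPow' p ε (conv ker f T x) * conv kerT f T x)| := by
              have := le_abs_self ((T - δ) * (regPow' p ε (conv ker f T x) * conv kerT f T x))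
              linarith
          _ ≤ T * ((p * (ε ^ 2) ^ (p / 2 - 1) * |conv ker f T x|) *
              (kerConst * (T ^ (1 + 2))⁻¹ * ∫ y, |f y|)) := by
              rw [abs_mul, abs_mul, abs_of_nonneg (by linarith : 0 ≤ T - δ)]
              gcongr
              linarith
          _ = _ := by field_simp; ring
      · rw [Real.enorm_eq_ofReal_abs, ofReal_rpow_of_nonneg (abs_nonneg _) hp0.le]
        exact ofReal_le_ofReal (regPow_le hε hp hp2 _)
    calc _ ≤ ∫⁻ x, (ENNReal.ofReal (p * (ε ^ 2) ^ (p / 2 - 1) * kerConst * (∫ y, |f y|) *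
            (T ^ 2)⁻¹) * ‖conv ker f T x‖ₑ ^ (1 : ℝ)) + ‖conv ker f δ x‖ₑ ^ p :=
          (setLIntegral_le_lintegral _ _).trans (lintegral_mono h1)
      _ = ENNReal.ofReal (p * (ε ^ 2) ^ (p / 2 - 1) * kerConst * (∫ y, |f y|) *
            (T ^ 2)⁻¹) * (∫⁻ x, ‖conv ker f T x‖ₑ ^ (1 : ℝ)) +
            ∫⁻ x, ‖conv ker f δ x‖ₑ ^ p := by
          rw [lintegral_add_right _ ((isKernel_ker.measurable_conv_space hfm δ).enorm.pow_const p),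
            lintegral_const_mul' _ _ ofReal_ne_top]
      _ ≤ _ := by
          have h5 := lintegral_enorm_conv_rpow_le isKernel_ker hfm hT0 (p := 1) le_rfl
          have h6 := lintegral_enorm_conv_rpow_le isKernel_ker hfm hδ (p := p) hp.le
          simp only [ENNReal.rpow_one] at h5 ⊢
          gcongr
  · refine (ofReal_integral_le_lintegral _).trans ?_
    have h1 : ∀ t ∈ Ioc δ T, ENNReal.ofReal
        ((t - δ) * (regPow p ε (conv ker f t R) - regPow p ε (conv ker f t (-R)))) ≤
        ENNReal.ofReal (T * (kerConst * (δ ^ 2)⁻¹ * ∫ y in Ioi R, |f y|) ^ p) := by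
      intro t ht
      refine ofReal_le_ofReal ?_
      have h2 := regPow_nonneg (p := p) hε hp (conv ker f t (-R))
      have h3 := regPow_le hε hp hp2 (conv ker f t R)
      have h4 := conv_ker_abs_le_tail hf (hδ.trans ht.1) R
      have hf0 : 0 ≤ ∫ y in Ioi R, |f y| := integral_nonneg fun y => abs_nonneg _
      have := kerConst_pos
      have h5 : |conv ker f t R| ≤ kerConst * (δ ^ 2)⁻¹ * ∫ y in Ioi R, |f y| := by
        refine h4.trans ?_
        have := ht.1.le
        gcongr
      have h6 : 0 ≤ t - δ := sub_nonneg.2 ht.1.le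
      calc _ ≤ (t - δ) * |conv ker f t R| ^ p := by gcongr; linarith
        _ ≤ _ := by
          gcongr
          linarith [ht.2]
    refine (setLIntegral_mono' measurableSet_Ioc h1).trans ?_
    rw [lintegral_const, Measure.restrict_apply_univ, Real.volume_Ioc, mul_comm,
      ← ofReal_mul (by linarith)]
    refine ofReal_le_ofReal ?_
    have hf0 : 0 ≤ ∫ y in Ioi R, |f y| := integral_nonneg fun y => abs_nonneg _
    have := kerConst_pos
    rw [mul_assoc T T]
    gcongr
    linarith

end box

end PoissonSquare

/-! ### The global energy bound -/

namespace PoissonSquare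

open Set ENNReal Metric Filter Topology

variable {p ε : ℝ} {f : ℝ → ℝ}

lemma tendsto_tail (hf : Integrable f) :
    Tendsto (fun n : ℕ => ∫ y in Ioi (n : ℝ), |f y|) atTop (𝓝 0) := by
  have h := tendsto_setIntegral_of_antitone (μ := volume) (f := fun y => |f y|)
    (s := fun n : ℕ => Ioi (n : ℝ)) (fun n => measurableSet_Ioi)
    (fun m n hmn => Ioi_subset_Ioi (by exact_mod_cast hmn)) ⟨0, hf.abs.integrableOn⟩
  have h0 : ⋂ n : ℕ, Ioi (n : ℝ) = ∅ := by
    refine eq_empty_of_forall_notMem fun y hy => ?_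
    obtain ⟨n, hn⟩ := exists_nat_gt y
    exact absurd (mem_iInter.1 hy n) (not_lt.2 hn.le)
  simpa [h0] using h

lemma energy_box_le_of_tendsto (hε : 0 < ε) (hp : 1 < p) (hp2 : p ≤ 2) (hf : Integrable f)
    (hfm : Measurable f) {δ : ℝ} (hδ : 0 < δ) (T R : ℝ) :
    ENNReal.ofReal (p * (p - 1)) *
        ∫⁻ q in Ioc (-R) R ×ˢ Ioc δ T, ENNReal.ofReal (energy p ε δ f q) ≤
      ENNReal.ofReal (12 * kerConst) ^ p * ∫⁻ x, ‖f x‖ₑ ^ p := by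
  have hp0 : 0 < p := by linarith
  set K := ENNReal.ofReal (12 * kerConst) ^ p * ∫⁻ x, ‖f x‖ₑ ^ p
  have hmono : ∀ {T R T' R' : ℝ}, T ≤ T' → R ≤ R' → ENNReal.ofReal (p * (p - 1)) *
        ∫⁻ q in Ioc (-R) R ×ˢ Ioc δ T, ENNReal.ofReal (energy p ε δ f q) ≤
        ENNReal.ofReal (p * (p - 1)) *
        ∫⁻ q in Ioc (-R') R' ×ˢ Ioc δ T', ENNReal.ofReal (energy p ε δ f q) := by
    intro T R T' R' h1 h2
    gcongr
  have hlimR : ∀ T, δ ≤ T → ∀ R, ENNReal.ofReal (p * (p - 1)) *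
        ∫⁻ q in Ioc (-R) R ×ˢ Ioc δ T, ENNReal.ofReal (energy p ε δ f q) ≤
      (ENNReal.ofReal (p * (ε ^ 2) ^ (p / 2 - 1) * kerConst * (∫ y, |f y|) * (T ^ 2)⁻¹) *
          (ENNReal.ofReal (12 * kerConst) * ∫⁻ x, ‖f x‖ₑ)) + K := by
    intro T hT R
    have h1 : Tendsto (fun n : ℕ =>
        (ENNReal.ofReal (p * (ε ^ 2) ^ (p / 2 - 1) * kerConst * (∫ y, |f y|) * (T ^ 2)⁻¹) *
          (ENNReal.ofReal (12 * kerConst) * ∫⁻ x, ‖f x‖ₑ)) + K +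
        ENNReal.ofReal (T * T * (kerConst * (δ ^ 2)⁻¹ * ∫ y in Ioi (n : ℝ), |f y|) ^ p)) atTop
        (𝓝 ((ENNReal.ofReal (p * (ε ^ 2) ^ (p / 2 - 1) * kerConst * (∫ y, |f y|) * (T ^ 2)⁻¹) *
          (ENNReal.ofReal (12 * kerConst) * ∫⁻ x, ‖f x‖ₑ)) + K +
          ENNReal.ofReal (T * T * (kerConst * (δ ^ 2)⁻¹ * 0) ^ p))) := by
      refine Tendsto.add tendsto_const_nhds (ENNReal.tendsto_ofReal ?_)
      refine Tendsto.const_mul _ (Tendsto.rpow_const ?_ (Or.inr hp0.le))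
      exact (tendsto_tail hf).const_mul _
    simp only [mul_zero, Real.zero_rpow hp0.ne', ofReal_zero, add_zero] at h1
    refine ge_of_tendsto h1 ?_
    obtain ⟨n₀, hn₀⟩ := exists_nat_gt (max R 0)
    filter_upwards [eventually_ge_atTop n₀] with n hn
    have hn' : max R 0 < n := hn₀.trans_le (by exact_mod_cast hn)
    refine (hmono le_rfl ((le_max_left _ _).trans hn'.le)).trans ?_
    exact energy_box_le hε hp hp2 hf hfm hδ hT ((le_max_right _ _).trans_lt hn')
  have h2 : Tendsto (fun n : ℕ =>
      (ENNReal.ofReal (p * (ε ^ 2) ^ (p / 2 - 1) * kerConst * (∫ y, |f y|) * ((n : ℝ) ^ 2)⁻¹) *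
        (ENNReal.ofReal (12 * kerConst) * ∫⁻ x, ‖f x‖ₑ)) + K) atTop
      (𝓝 ((ENNReal.ofReal (p * (ε ^ 2) ^ (p / 2 - 1) * kerConst * (∫ y, |f y|) * 0) *
        (ENNReal.ofReal (12 * kerConst) * ∫⁻ x, ‖f x‖ₑ)) + K)) := by
    refine Tendsto.add ?_ tendsto_const_nhds
    refine ENNReal.Tendsto.mul_const (ENNReal.tendsto_ofReal ?_)
      (Or.inr (mul_ne_top ofReal_ne_top hf.2.ne))
    refine Tendsto.const_mul _ ?_
    exact tendsto_inv_atTop_zero.comp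
      ((tendsto_pow_atTop two_ne_zero).comp tendsto_natCast_atTop_atTop)
  simp only [mul_zero, ofReal_zero, zero_mul, zero_add] at h2
  refine ge_of_tendsto h2 ?_
  obtain ⟨n₀, hn₀⟩ := exists_nat_gt (max T δ)
  filter_upwards [eventually_ge_atTop n₀] with n hn
  have hn' : max T δ < n := hn₀.trans_le (by exact_mod_cast hn)
  exact (hmono ((le_max_left _ _).trans hn'.le) le_rfl).trans
    (hlimR n ((le_max_right _ _).trans hn'.le) R)

lemma energy_le (hε : 0 < ε) (hp : 1 < p) (hp2 : p ≤ 2) (hf : Integrable f)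
    (hfm : Measurable f) :
    ENNReal.ofReal (p * (p - 1)) *
        ∫⁻ q in univ ×ˢ Ioi 0, ENNReal.ofReal (energy p ε 0 f q) ≤
      ENNReal.ofReal (12 * kerConst) ^ p * ∫⁻ x, ‖f x‖ₑ ^ p := by
  set K := ENNReal.ofReal (12 * kerConst) ^ p * ∫⁻ x, ‖f x‖ₑ ^ p
  let S : ℕ → Set (ℝ × ℝ) := fun n => Ioc (-(n : ℝ)) n ×ˢ Ioc ((n : ℝ) + 1)⁻¹ n
  have hS : ∀ n, MeasurableSet (S n) := fun n => measurableSet_Ioc.prod measurableSet_Ioc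
  let F : ℕ → ℝ × ℝ → ℝ≥0∞ := fun n => (S n).indicator fun q =>
    ENNReal.ofReal (p * (p - 1)) * ENNReal.ofReal (energy p ε ((n : ℝ) + 1)⁻¹ f q)
  have hF : ∀ n, Measurable (F n) := fun n =>
    ((measurable_energy hfm).ennreal_ofReal.const_mul _).indicator (hS n)
  have hle : ∀ n, ∫⁻ q, F n q ≤ K := by
    intro n
    rw [lintegral_indicator (hS n), lintegral_const_mul' _ _ ofReal_ne_top]
    exact energy_box_le_of_tendsto hε hp hp2 hf hfm (by positivity) _ _
  have hlim : ∀ q ∈ (univ ×ˢ Ioi 0 : Set (ℝ × ℝ)), Tendsto (fun n => F n q) atTop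
      (𝓝 (ENNReal.ofReal (p * (p - 1)) * ENNReal.ofReal (energy p ε 0 f q))) := by
    intro q hq
    have hq2 : 0 < q.2 := hq.2
    have hd : Tendsto (fun n : ℕ => ((n : ℝ) + 1)⁻¹) atTop (𝓝 0) := by
      simpa using tendsto_one_div_add_atTop_nhds_zero_nat (𝕜 := ℝ)
    have h1 : Tendsto (fun n : ℕ => ENNReal.ofReal (p * (p - 1)) *
        ENNReal.ofReal (energy p ε ((n : ℝ) + 1)⁻¹ f q)) atTop
        (𝓝 (ENNReal.ofReal (p * (p - 1)) * ENNReal.ofReal (energy p ε 0 f q))) := by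
      refine ENNReal.Tendsto.const_mul (ENNReal.tendsto_ofReal ?_) (Or.inr ofReal_ne_top)
      exact (tendsto_const_nhds.sub hd).mul_const _
    refine h1.congr' ?_
    have hc : Tendsto (fun n : ℕ => (n : ℝ)) atTop atTop := tendsto_natCast_atTop_atTop
    filter_upwards [hc.eventually_gt_atTop |q.1|, hc.eventually_gt_atTop q.2,
      hd.eventually_lt_const hq2] with n h2 h3 h4
    have : q ∈ S n := ⟨⟨(abs_lt.1 h2).1, (abs_lt.1 h2).2.le⟩, h4, h3.le⟩
    simp only [F, indicator_of_mem this]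
  calc ENNReal.ofReal (p * (p - 1)) *
        ∫⁻ q in univ ×ˢ Ioi 0, ENNReal.ofReal (energy p ε 0 f q)
      = ∫⁻ q in univ ×ˢ Ioi 0, liminf (fun n => F n q) atTop := by
        rw [← lintegral_const_mul' _ _ ofReal_ne_top]
        exact setLIntegral_congr_fun (MeasurableSet.univ.prod measurableSet_Ioi) fun q hq =>
          (hlim q hq).liminf_eq.symm
    _ ≤ ∫⁻ q, liminf (fun n => F n q) atTop := setLIntegral_le_lintegral _ _
    _ ≤ liminf (fun n => ∫⁻ q, F n q) atTop := lintegral_liminf_le hF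
    _ ≤ K := (liminf_le_liminf (.of_forall hle)).trans_eq (liminf_const K)

end PoissonSquare

/-! ### The square function for small exponents -/

namespace PoissonSquare

open Set ENNReal Metric Filter Topology

/-- The measure `t dt` on the positive half-line. -/
noncomputable def sqMeasure : Measure ℝ :=
  (volume.restrict (Ioi 0)).withDensity ENNReal.ofReal

/-- The square function restricted to the times in `S`. -/
noncomputable def sqFn (S : Set ℝ) (f : ℝ → ℝ) (x : ℝ) : ℝ≥0∞ :=
  eLpNorm (fun t => conv kerT f t x) 2 (sqMeasure.restrict S)

lemma lintegral_sqMeasure_restrict {S : Set ℝ} (hS : MeasurableSet S) {g : ℝ → ℝ≥0∞}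
    (hg : Measurable g) :
    ∫⁻ t, g t ∂(sqMeasure.restrict S) = ∫⁻ t in S ∩ Ioi 0, ENNReal.ofReal t * g t := by
  rw [sqMeasure, restrict_withDensity hS, Measure.restrict_restrict hS,
    lintegral_withDensity_eq_lintegral_mul _ measurable_ofReal hg]
  rfl

lemma ae_sqMeasure_restrict_pos (S : Set ℝ) (hS : MeasurableSet S) :
    ∀ᵐ t ∂(sqMeasure.restrict S), t ∈ S ∧ 0 < t := by
  rw [sqMeasure, restrict_withDensity hS, Measure.restrict_restrict hS]
  exact (withDensity_absolutelyContinuous _ _).ae_le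
    ((ae_restrict_iff' (hS.inter measurableSet_Ioi)).2 (.of_forall fun t ht => ht))

variable {f : ℝ → ℝ}

lemma sqFn_rpow_two (hf : Measurable f) {S : Set ℝ} (hS : MeasurableSet S) (x : ℝ) :
    sqFn S f x ^ (2 : ℝ) =
      ∫⁻ t in S ∩ Ioi 0, ENNReal.ofReal t * ‖conv kerT f t x‖ₑ ^ (2 : ℝ) := by
  rw [sqFn, eLpNorm_eq_lintegral_rpow_enorm_toReal two_ne_zero ofNat_ne_top, ← ENNReal.rpow_mul,
    ← lintegral_sqMeasure_restrict hS
      ((isKernel_kerT.measurable_conv_time hf x).enorm.pow_const _)]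
  simp

lemma measurable_sqFn (hf : Measurable f) {S : Set ℝ} (hS : MeasurableSet S) :
    Measurable (sqFn S f) := by
  have hm1 := (isKernel_kerT.measurable_conv hf).comp measurable_swap
  simp only [Function.comp_def, Prod.fst_swap, Prod.snd_swap] at hm1
  have h : ∀ x, sqFn S f x = (sqFn S f x ^ (2 : ℝ)) ^ (1 / 2 : ℝ) := fun x => by
    rw [← ENNReal.rpow_mul]; norm_num
  have h' : sqFn S f = fun x => (∫⁻ t in S ∩ Ioi 0,
      ENNReal.ofReal t * ‖conv kerT f t x‖ₑ ^ (2 : ℝ)) ^ (1 / 2 : ℝ) := by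
    funext x
    rw [h x, sqFn_rpow_two hf hS]
  rw [h']
  refine Measurable.pow_const ?_ _
  exact Measurable.lintegral_prod_right'
    (f := fun q : ℝ × ℝ => ENNReal.ofReal q.2 * ‖conv kerT f q.2 q.1‖ₑ ^ (2 : ℝ)) (by fun_prop)

lemma rpow_mul_rpow_le_add (a b : ℝ≥0∞) {θ : ℝ} (h0 : 0 ≤ θ) (h1 : θ ≤ 1) :
    a ^ (1 - θ) * b ^ θ ≤ a + b := by
  have h2 : 0 ≤ 1 - θ := by linarith
  calc a ^ (1 - θ) * b ^ θ ≤ (a + b) ^ (1 - θ) * (a + b) ^ θ := by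
        gcongr
        · exact le_self_add
        · exact le_add_self
    _ = a + b := by rw [← ENNReal.rpow_add_of_nonneg _ _ h2 h0]; simp

lemma sqFn_rpow_le {p ε : ℝ} (hε : 0 < ε) (hp : 1 < p) (hp2 : p ≤ 2) (hfm : Measurable f)
    (x : ℝ) :
    sqFn univ f x ^ p ≤
      (ENNReal.ofReal kerConst * (6 * maximalFn (fun y => ‖f y‖ₑ) x)) ^ p +
        ENNReal.ofReal (ε ^ p) + ∫⁻ t in Ioi 0, ENNReal.ofReal (energy p ε 0 f (x, t)) := by
  have hp0 : 0 < p := by linarith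
  set M := ENNReal.ofReal kerConst * (6 * maximalFn (fun y => ‖f y‖ₑ) x) with hM
  by_cases hMt : M = ⊤
  · simp [hMt, hp0]
  set W := M.toReal ^ 2 + ε ^ 2 with hW
  have hW0 : 0 < W := by positivity
  set I := ∫⁻ t in Ioi 0, ENNReal.ofReal (energy p ε 0 f (x, t)) with hI
  have h1 : sqFn univ f x ^ (2 : ℝ) ≤ ENNReal.ofReal W ^ (1 - p / 2) * I := by
    rw [sqFn_rpow_two hfm .univ, univ_inter, ofReal_rpow_of_pos hW0,
      ← lintegral_const_mul' _ _ ofReal_ne_top]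
    refine setLIntegral_mono' measurableSet_Ioi fun t ht => ?_
    have ht : 0 < t := ht
    rw [Real.enorm_eq_ofReal_abs, ofReal_rpow_of_nonneg (abs_nonneg _) (by norm_num),
      ← ofReal_mul ht.le, ← ofReal_mul (by positivity), energy, Real.rpow_two, sq_abs]
    refine ofReal_le_ofReal ?_
    have hu : |conv ker f t x| ≤ M.toReal := by
      have := isKernel_ker.enorm_conv_le_maximalFn hfm ht x
      rw [pow_zero, inv_one, mul_one, ← hM, Real.enorm_eq_ofReal_abs] at this
      exact (ofReal_le_iff_le_toReal hMt).1 this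
    have hV : 0 < conv ker f t x ^ 2 + ε ^ 2 := by positivity
    have h2 : (conv ker f t x ^ 2 + ε ^ 2) ^ (1 - p / 2) ≤ W ^ (1 - p / 2) := by
      refine Real.rpow_le_rpow hV.le ?_ (by linarith)
      rw [hW, ← sq_abs (conv ker f t x)]
      gcongr
    have h3 : (conv ker f t x ^ 2 + ε ^ 2) ^ (1 - p / 2) *
        (conv ker f t x ^ 2 + ε ^ 2) ^ (p / 2 - 1) = 1 := by
      rw [← Real.rpow_add hV]; norm_num
    simp only [sub_zero]
    calc t * conv kerT f t x ^ 2 = ((conv ker f t x ^ 2 + ε ^ 2) ^ (1 - p / 2) *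
          (conv ker f t x ^ 2 + ε ^ 2) ^ (p / 2 - 1)) * (t * conv kerT f t x ^ 2) := by
          rw [h3, one_mul]
      _ = (conv ker f t x ^ 2 + ε ^ 2) ^ (1 - p / 2) * (t * ((conv ker f t x ^ 2 + ε ^ 2) ^
          (p / 2 - 1) * conv kerT f t x ^ 2)) := by ring
      _ ≤ _ := by gcongr
  have hWM : ENNReal.ofReal W ^ (p / 2) ≤ M ^ p + ENNReal.ofReal (ε ^ p) := by
    rw [hW, ofReal_add (by positivity) (by positivity)]
    refine (ENNReal.rpow_add_le_add_rpow _ _ (by linarith) (by linarith)).trans ?_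
    rw [ofReal_rpow_of_nonneg (by positivity) (by linarith),
      ofReal_rpow_of_nonneg (by positivity) (by linarith), sq_rpow_half hε.le,
      sq_rpow_half toReal_nonneg, ← ofReal_rpow_of_nonneg toReal_nonneg hp0.le, ofReal_toReal hMt]
  calc sqFn univ f x ^ p = (sqFn univ f x ^ (2 : ℝ)) ^ (p / 2) := by
        rw [← ENNReal.rpow_mul]; congr 1; ring
    _ ≤ (ENNReal.ofReal W ^ (1 - p / 2) * I) ^ (p / 2) := by gcongr
    _ = (ENNReal.ofReal W ^ (p / 2)) ^ (1 - p / 2) * I ^ (p / 2) := by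
        rw [ENNReal.mul_rpow_of_nonneg _ _ (by linarith), ← ENNReal.rpow_mul, ← ENNReal.rpow_mul,
          mul_comm (1 - p / 2)]
    _ ≤ ENNReal.ofReal W ^ (p / 2) + I := rpow_mul_rpow_le_add _ _ (by linarith) (by linarith)
    _ ≤ _ := by gcongr

lemma lintegral_energy_le {p ε : ℝ} (hε : 0 < ε) (hp : 1 < p) (hp2 : p ≤ 2) (hf : Integrable f)
    (hfm : Measurable f) :
    ∫⁻ x, ∫⁻ t in Ioi 0, ENNReal.ofReal (energy p ε 0 f (x, t)) ≤
      ENNReal.ofReal (12 * kerConst) ^ p * ENNReal.ofReal (p * (p - 1))⁻¹ * ∫⁻ x, ‖f x‖ₑ ^ p := by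
  have hpp : 0 < p * (p - 1) := mul_pos (by linarith) (by linarith)
  have h := energy_le hε hp hp2 hf hfm
  rw [Measure.volume_eq_prod, ← Measure.prod_restrict, Measure.restrict_univ,
    lintegral_prod _ (measurable_energy hfm).ennreal_ofReal.aemeasurable] at h
  have h1 := mul_le_mul_right h (ENNReal.ofReal (p * (p - 1))⁻¹)
  rw [← mul_assoc, ← ofReal_mul (by positivity), inv_mul_cancel₀ hpp.ne', ofReal_one,
    one_mul] at h1
  refine h1.trans_eq ?_
  ring

/-- Stein's estimate for the square function in the range `1 < p ≤ 2`. -/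
lemma lintegral_sqFn_rpow_le_of_le_two {p : ℝ} (hp : 1 < p) (hp2 : p ≤ 2) (hf : Integrable f)
    (hfm : Measurable f) :
    ∫⁻ x, sqFn univ f x ^ p ≤
      ENNReal.ofReal ((24 * kerConst) ^ p * (6 * (p / (p - 1)))) * ∫⁻ x, ‖f x‖ₑ ^ p := by
  have hp0 : 0 < p := by linarith
  have hp1 : 0 < p - 1 := by linarith
  have hk := kerConst_pos
  set J := ∫⁻ x, ‖f x‖ₑ ^ p with hJ
  set A := ENNReal.ofReal ((24 * kerConst) ^ p * (6 * (p / (p - 1)))) * J with hA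
  have hmax : ∫⁻ x, (ENNReal.ofReal kerConst * (6 * maximalFn (fun y => ‖f y‖ₑ) x)) ^ p ≤
      ENNReal.ofReal ((6 * kerConst) ^ p * (5 * 4 ^ p * (p / (p - 1)))) * J := by
    have h6 : ∀ x, (ENNReal.ofReal kerConst * (6 * maximalFn (fun y => ‖f y‖ₑ) x)) ^ p =
        ENNReal.ofReal ((6 * kerConst) ^ p) * maximalFn (fun y => ‖f y‖ₑ) x ^ p := fun x => by
      rw [← ofReal_rpow_of_nonneg (by positivity) hp0.le,
        ← ENNReal.mul_rpow_of_nonneg _ _ hp0.le, ofReal_mul (by norm_num)]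
      congr 1
      norm_num
      ring
    simp only [h6]
    rw [lintegral_const_mul' _ _ ofReal_ne_top, ofReal_mul (by positivity), mul_assoc]
    gcongr
    exact maximalFn_strong hfm.enorm hp
  have hbox : ∀ R : ℝ, 0 < R → ∫⁻ x in Ioc (-R) R, sqFn univ f x ^ p ≤ A := by
    intro R hR
    have hε : ∀ ε : ℝ, 0 < ε → ∫⁻ x in Ioc (-R) R, sqFn univ f x ^ p ≤
        A + ENNReal.ofReal (ε ^ p * (2 * R)) := by
      intro ε hε
      have hmI : Measurable fun x => ∫⁻ t in Ioi 0, ENNReal.ofReal (energy p ε 0 f (x, t)) :=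
        (measurable_energy hfm).ennreal_ofReal.lintegral_prod_right'
      calc _ ≤ ∫⁻ x in Ioc (-R) R,
            ((ENNReal.ofReal kerConst * (6 * maximalFn (fun y => ‖f y‖ₑ) x)) ^ p +
              ENNReal.ofReal (ε ^ p) + ∫⁻ t in Ioi 0, ENNReal.ofReal (energy p ε 0 f (x, t))) :=
            lintegral_mono fun x => sqFn_rpow_le hε hp hp2 hfm x
        _ = (∫⁻ x in Ioc (-R) R,
            (ENNReal.ofReal kerConst * (6 * maximalFn (fun y => ‖f y‖ₑ) x)) ^ p) +
              ENNReal.ofReal (ε ^ p * (2 * R)) +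
            ∫⁻ x in Ioc (-R) R, ∫⁻ t in Ioi 0, ENNReal.ofReal (energy p ε 0 f (x, t)) := by
            rw [lintegral_add_right _ hmI, lintegral_add_right _ measurable_const, lintegral_const,
              Measure.restrict_apply_univ, Real.volume_Ioc, ← ofReal_mul (by positivity)]
            ring_nf
        _ ≤ ENNReal.ofReal ((6 * kerConst) ^ p * (5 * 4 ^ p * (p / (p - 1)))) * J +
              ENNReal.ofReal (ε ^ p * (2 * R)) +
            ENNReal.ofReal (12 * kerConst) ^ p * ENNReal.ofReal (p * (p - 1))⁻¹ * J := by
            gcongr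
            · exact (setLIntegral_le_lintegral _ _).trans hmax
            · exact (setLIntegral_le_lintegral _ _).trans (lintegral_energy_le hε hp hp2 hf hfm)
        _ = (ENNReal.ofReal ((6 * kerConst) ^ p * (5 * 4 ^ p * (p / (p - 1)))) +
              ENNReal.ofReal (12 * kerConst) ^ p * ENNReal.ofReal (p * (p - 1))⁻¹) * J +
              ENNReal.ofReal (ε ^ p * (2 * R)) := by ring
        _ ≤ _ := by
            rw [hA]
            gcongr
            rw [ofReal_rpow_of_nonneg (by positivity) hp0.le, ← ofReal_mul (by positivity),
              ← ofReal_add (by positivity) (by positivity)]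
            refine ofReal_le_ofReal ?_
            have e1 : (24 * kerConst) ^ p = (6 * kerConst) ^ p * 4 ^ p := by
              rw [← Real.mul_rpow (by positivity) (by norm_num)]; ring_nf
            have e2 : (12 * kerConst) ^ p ≤ (24 * kerConst) ^ p := by gcongr; norm_num
            have e3 : (p * (p - 1))⁻¹ ≤ p / (p - 1) := by
              rw [mul_inv, div_eq_mul_inv]
              gcongr
              exact (inv_le_one_of_one_le₀ hp.le).trans hp.le
            have e4 : (12 * kerConst) ^ p * (p * (p - 1))⁻¹ ≤
                (24 * kerConst) ^ p * (p / (p - 1)) := by gcongr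
            calc (6 * kerConst) ^ p * (5 * 4 ^ p * (p / (p - 1))) +
                  (12 * kerConst) ^ p * (p * (p - 1))⁻¹
                = (24 * kerConst) ^ p * (5 * (p / (p - 1))) +
                  (12 * kerConst) ^ p * (p * (p - 1))⁻¹ := by rw [e1]; ring
              _ ≤ (24 * kerConst) ^ p * (5 * (p / (p - 1))) +
                  (24 * kerConst) ^ p * (p / (p - 1)) := by gcongr
              _ = _ := by ring
    have hlim : Tendsto (fun ε : ℝ => A + ENNReal.ofReal (ε ^ p * (2 * R))) (𝓝[>] 0) (𝓝 A) := by
      have h : Tendsto (fun ε : ℝ => A + ENNReal.ofReal (ε ^ p * (2 * R))) (𝓝[>] 0)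
          (𝓝 (A + ENNReal.ofReal (0 ^ p * (2 * R)))) := by
        refine Tendsto.mono_left ?_ nhdsWithin_le_nhds
        refine tendsto_const_nhds.add (ENNReal.tendsto_ofReal (Tendsto.mul_const _ ?_))
        exact tendsto_id.rpow_const (Or.inr hp0.le)
      simpa [Real.zero_rpow hp0.ne'] using h
    exact ge_of_tendsto hlim (eventually_mem_nhdsWithin.mono fun ε h => hε ε h)
  have hun : (⋃ n : ℕ, Ioc (-((n : ℝ) + 1)) ((n : ℝ) + 1)) = univ := by
    refine eq_univ_of_forall fun x => ?_
    obtain ⟨n, hn⟩ := exists_nat_gt |x|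
    exact mem_iUnion.2 ⟨n, by linarith [(abs_lt.1 hn).1], by linarith [(abs_lt.1 hn).2]⟩
  have hmon : Directed (· ⊆ ·) fun n : ℕ => Ioc (-((n : ℝ) + 1)) ((n : ℝ) + 1) := by
    refine (monotone_nat_of_le_succ fun n => ?_).directed_le
    push_cast
    exact Ioc_subset_Ioc (by linarith) (by linarith)
  have hU := setLIntegral_iUnion_of_directed (μ := volume) (fun x => sqFn univ f x ^ p) hmon
  rw [hun, setLIntegral_univ] at hU
  rw [hU]
  exact iSup_le fun n => hbox _ (by positivity)

end PoissonSquare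

/-! ### Comparison estimates for the square function -/

namespace PoissonSquare

open Set ENNReal Metric Filter Topology

variable {f : ℝ → ℝ}

lemma eLpNorm_sqMeasure_le {S : Set ℝ} (hS : MeasurableSet S) {v φ : ℝ → ℝ} {B : ℝ≥0∞} {c : ℝ}
    (hφ : Measurable φ) (hφ0 : ∀ t, 0 < t → 0 ≤ φ t) (hc : 0 ≤ c)
    (hv : ∀ t ∈ S, 0 < t → ‖v t‖ₑ ≤ B * ENNReal.ofReal (φ t))
    (hint : ∫⁻ t in S ∩ Ioi 0, ENNReal.ofReal (t * φ t ^ 2) ≤ ENNReal.ofReal (c ^ 2)) :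
    eLpNorm v 2 (sqMeasure.restrict S) ≤ B * ENNReal.ofReal c := by
  rw [eLpNorm_eq_lintegral_rpow_enorm_toReal two_ne_zero ofNat_ne_top]
  have h1 : ∫⁻ t, ‖v t‖ₑ ^ (2 : ℝ≥0∞).toReal ∂(sqMeasure.restrict S) ≤
      (B * ENNReal.ofReal c) ^ (2 : ℝ) := by
    calc _ ≤ ∫⁻ t, (B ^ (2 : ℝ) * ENNReal.ofReal (φ t) ^ (2 : ℝ)) ∂(sqMeasure.restrict S) := by
          refine lintegral_mono_ae ?_
          filter_upwards [ae_sqMeasure_restrict_pos S hS] with t ht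
          rw [← ENNReal.mul_rpow_of_nonneg _ _ zero_le_two]
          simp only [toReal_ofNat]
          gcongr
          exact hv t ht.1 ht.2
      _ = B ^ (2 : ℝ) * ∫⁻ t in S ∩ Ioi 0, ENNReal.ofReal (t * φ t ^ 2) := by
          rw [lintegral_const_mul _ (by fun_prop), lintegral_sqMeasure_restrict hS (by fun_prop)]
          congr 1
          refine setLIntegral_congr_fun (hS.inter measurableSet_Ioi) fun t ht => ?_
          have ht : 0 < t := ht.2
          rw [ofReal_rpow_of_nonneg (hφ0 t ht) zero_le_two, ← ofReal_mul ht.le, Real.rpow_two]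
      _ ≤ B ^ (2 : ℝ) * ENNReal.ofReal (c ^ 2) := by gcongr
      _ = _ := by
          rw [ENNReal.mul_rpow_of_nonneg _ _ zero_le_two, ofReal_rpow_of_nonneg hc zero_le_two,
            Real.rpow_two]
  calc _ ≤ ((B * ENNReal.ofReal c) ^ (2 : ℝ)) ^ (1 / (2 : ℝ≥0∞).toReal) := by gcongr
    _ = _ := by
      rw [← ENNReal.rpow_mul]
      norm_num

lemma two_inv_mul_rpow_le {W q : ℝ} (hW : 0 < W) {V : ℝ} (hV : W / 2 ≤ V) (hq : 0 ≤ q)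
    (hq3 : q ≤ 3) : V ^ (-q) ≤ 8 * W ^ (-q) := by
  calc V ^ (-q) ≤ (W / 2) ^ (-q) :=
        Real.rpow_le_rpow_of_nonpos (by positivity) hV (by linarith)
    _ = 2 ^ q * W ^ (-q) := by
        rw [Real.div_rpow hW.le (by norm_num), Real.rpow_neg (by norm_num : (0:ℝ) ≤ 2)]
        field_simp
    _ ≤ 2 ^ (3 : ℝ) * W ^ (-q) := by
        gcongr
        norm_num
    _ = _ := by norm_num

lemma abs_kerT_sub_le {t : ℝ} (ht : 0 < t) {a b : ℝ} (hab : |a - b| ≤ t ^ 2) :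
    |kerT t a - kerT t b| ≤ 8 * kerConst * |a - b| * (t ^ 3)⁻¹ * majorant t a := by
  have hk := kerConst_pos
  have h : ∀ σ ∈ uIcc b a, ‖kerTS t σ‖ ≤ kerConst * (8 * ((t ^ 3)⁻¹ * majorant t a)) := by
    intro σ hσ
    have h1 : |a - σ| ≤ |a - b| := abs_sub_right_of_mem_uIcc hσ
    rw [Real.norm_eq_abs]
    refine (abs_kerTS_le ht σ).trans ?_
    have h2 : (t ^ 2 + |a|) / 2 ≤ t ^ 2 + |σ| := by
      have := abs_sub_abs_le_abs_sub a σ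
      linarith [abs_nonneg σ]
    have h3 := two_inv_mul_rpow_le (q := 5 / 2) (by positivity) h2 (by norm_num) (by norm_num)
    have h4 := rpow_five_half_le ht a
    gcongr
    exact h3.trans (by gcongr)
  have := (convex_uIcc b a).norm_image_sub_le_of_norm_hasDerivWithin_le
    (fun σ _ => (hasDerivAt_kerT_space ht σ).hasDerivWithinAt) h left_mem_uIcc right_mem_uIcc
  rw [Real.norm_eq_abs, Real.norm_eq_abs] at this
  refine this.trans_eq ?_
  ring

/-- The constant in the pointwise comparison estimates. -/
noncomputable def cmpConst : ℝ := 96 * kerConst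

lemma cmpConst_pos : 0 < cmpConst := mul_pos (by norm_num) kerConst_pos

lemma enorm_conv_sub_le (hf : Integrable f) (hfm : Measurable f) {t : ℝ} (ht : 0 < t) {x z : ℝ}
    (hxz : |x - z| ≤ t ^ 2) :
    ‖conv kerT f t x - conv kerT f t z‖ₑ ≤
      ENNReal.ofReal (cmpConst * |x - z| * (t ^ 3)⁻¹) * maximalFn (fun y => ‖f y‖ₑ) x := by
  have hk := kerConst_pos
  have h0 : conv kerT f t x - conv kerT f t z =
      ∫ y, (kerT t (y - x) - kerT t (y - z)) * f y := by
    simp only [sub_mul]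
    exact (integral_sub (isKernel_kerT.integrable hf ht x)
      (isKernel_kerT.integrable hf ht z)).symm
  rw [h0]
  calc _ ≤ ∫⁻ y, ‖(kerT t (y - x) - kerT t (y - z)) * f y‖ₑ := enorm_integral_le_lintegral_enorm _
    _ ≤ ∫⁻ y, ENNReal.ofReal (8 * kerConst * |x - z| * (t ^ 3)⁻¹) *
        (ENNReal.ofReal (majorant t (y - x)) * ‖f y‖ₑ) := by
        refine lintegral_mono fun y => ?_
        rw [enorm_mul, ← mul_assoc, ← ofReal_mul (by positivity), Real.enorm_eq_ofReal_abs]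
        gcongr
        have e : |(y - x) - (y - z)| = |x - z| := by rw [← abs_neg]; congr 1; ring
        have := abs_kerT_sub_le ht (a := y - x) (b := y - z) (by rwa [e])
        rwa [e] at this
    _ = ENNReal.ofReal (8 * kerConst * |x - z| * (t ^ 3)⁻¹) *
          majorantConv t (fun y => ‖f y‖ₑ) x := by
        rw [lintegral_const_mul' _ _ ofReal_ne_top, majorantConv]
    _ ≤ ENNReal.ofReal (8 * kerConst * |x - z| * (t ^ 3)⁻¹) *
          (ENNReal.ofReal 6 * maximalFn (fun y => ‖f y‖ₑ) x) := by
        gcongr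
        simpa using majorantConv_le_maximalFn hfm.enorm ht x
    _ ≤ _ := by
        rw [← mul_assoc, ← ofReal_mul (by positivity), cmpConst]
        gcongr ENNReal.ofReal ?_ * _
        have : 0 ≤ kerConst * |x - z| * (t ^ 3)⁻¹ := by positivity
        linarith

lemma lintegral_Ici_tail {r : ℝ} (hr : 0 < r) :
    ∫⁻ t in Ici r ∩ Ioi 0, ENNReal.ofReal (t * ((t ^ 3)⁻¹) ^ 2) ≤
      ENNReal.ofReal (((r ^ 2)⁻¹) ^ 2) := by
  have h1 : Ici r ∩ Ioi 0 = Ici r := inter_eq_left.2 fun t ht => hr.trans_le ht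
  rw [h1, ← restrict_Ioi_eq_restrict_Ici]
  have h2 : ∀ t ∈ Ioi r, ENNReal.ofReal (t * ((t ^ 3)⁻¹) ^ 2) = ENNReal.ofReal (t ^ (-5 : ℝ)) := by
    intro t ht
    have ht : 0 < t := hr.trans ht
    rw [show (-5 : ℝ) = ((-5 : ℤ) : ℝ) by norm_num, Real.rpow_intCast]
    congr 1
    field_simp
  rw [setLIntegral_congr_fun measurableSet_Ioi h2, ← ofReal_integral_eq_lintegral_ofReal
    (integrableOn_Ioi_rpow_of_lt (by norm_num) hr)
    ((ae_restrict_iff' measurableSet_Ioi).2 (.of_forall fun t ht =>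
      Real.rpow_nonneg (hr.trans ht).le _)), integral_Ioi_rpow_of_lt (by norm_num) hr]
  refine ofReal_le_ofReal ?_
  rw [show (-5 + 1 : ℝ) = ((-4 : ℤ) : ℝ) by norm_num, Real.rpow_intCast]
  have : r ^ (-4 : ℤ) = ((r ^ 2)⁻¹) ^ 2 := by field_simp
  rw [this]
  have : 0 ≤ ((r ^ 2)⁻¹) ^ 2 := by positivity
  push_cast
  linarith

/-- The large-time part of the square function varies slowly. -/
lemma sqFn_Ici_le (hf : Integrable f) (hfm : Measurable f) {r : ℝ} (hr : 0 < r) {x z : ℝ}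
    (hxz : |x - z| ≤ r ^ 2) :
    sqFn (Ici r) f x ≤
      sqFn (Ici r) f z + ENNReal.ofReal cmpConst * maximalFn (fun y => ‖f y‖ₑ) x := by
  have hk := cmpConst_pos
  have hmx := isKernel_kerT.measurable_conv_time hfm x
  have hmz := isKernel_kerT.measurable_conv_time hfm z
  have h1 : eLpNorm (fun t => conv kerT f t x - conv kerT f t z) 2 (sqMeasure.restrict (Ici r)) ≤
      (ENNReal.ofReal (cmpConst * |x - z|) * maximalFn (fun y => ‖f y‖ₑ) x) *
        ENNReal.ofReal (r ^ 2)⁻¹ := by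
    refine eLpNorm_sqMeasure_le measurableSet_Ici (φ := fun t => (t ^ 3)⁻¹) (by fun_prop)
      (fun t ht => by positivity) (by positivity) (fun t ht ht0 => ?_) (lintegral_Ici_tail hr)
    have ht : r ≤ t := ht
    refine (enorm_conv_sub_le hf hfm ht0 (hxz.trans (by gcongr))).trans_eq ?_
    rw [ofReal_mul (by positivity)]
    ring
  have h2 : (fun t => conv kerT f t x) =
      (fun t => conv kerT f t z) + fun t => conv kerT f t x - conv kerT f t z := by
    funext t; simp
  calc sqFn (Ici r) f x ≤ sqFn (Ici r) f z +
        eLpNorm (fun t => conv kerT f t x - conv kerT f t z) 2 (sqMeasure.restrict (Ici r)) := by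
        rw [sqFn, h2]
        exact eLpNorm_add_le hmz.aestronglyMeasurable (hmx.sub hmz).aestronglyMeasurable
          one_le_two
    _ ≤ _ := by
        gcongr
        refine h1.trans ?_
        rw [mul_right_comm, ← ofReal_mul (by positivity)]
        gcongr
        rw [mul_assoc]
        refine mul_le_of_le_one_right hk.le ?_
        rw [← div_eq_mul_inv]
        exact div_le_one_of_le₀ hxz (by positivity)

/-- The small-time part of the square function of a function vanishing near the base point. -/
lemma sqFn_Iio_le_of_far (hfm : Measurable f) {r ρ : ℝ} (hr : 0 < r) (hρ : 0 < ρ)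
    (hrρ : r ≤ 2 * ρ) {x : ℝ} (hx : ∀ y, |y - x| < ρ ^ 2 → f y = 0) :
    sqFn (Iio r) f x ≤ ENNReal.ofReal cmpConst * maximalFn (fun y => ‖f y‖ₑ) x := by
  have hk := kerConst_pos
  have h1 : ∀ t, 0 < t → ‖conv kerT f t x‖ₑ ≤
      (ENNReal.ofReal (8 * kerConst * ρ⁻¹) * (ENNReal.ofReal 6 * maximalFn (fun y => ‖f y‖ₑ) x)) *
        ENNReal.ofReal 1 := by
    intro t ht
    rw [ofReal_one, mul_one]
    calc _ ≤ ∫⁻ y, ‖kerT t (y - x) * f y‖ₑ := enorm_integral_le_lintegral_enorm _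
      _ ≤ ∫⁻ y, ENNReal.ofReal (8 * kerConst * ρ⁻¹) *
          (ENNReal.ofReal (majorant ρ (y - x)) * ‖f y‖ₑ) := by
          refine lintegral_mono fun y => ?_
          by_cases hy : |y - x| < ρ ^ 2
          · simp [hx y hy]
          rw [enorm_mul, ← mul_assoc, ← ofReal_mul (by positivity), Real.enorm_eq_ofReal_abs]
          gcongr
          refine (abs_kerT_le' ht _).trans ?_
          have h2 := two_inv_mul_rpow_le (W := ρ ^ 2 + |y - x|) (V := t ^ 2 + |y - x|)
            (q := 3 / 2) (by positivity) (by nlinarith) (by norm_num) (by norm_num)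
          calc _ ≤ kerConst * (8 * (ρ ^ 2 + |y - x|) ^ (-(3 / 2) : ℝ)) := by gcongr
            _ = _ := by rw [majorant]; field_simp
      _ = ENNReal.ofReal (8 * kerConst * ρ⁻¹) * majorantConv ρ (fun y => ‖f y‖ₑ) x := by
          rw [lintegral_const_mul' _ _ ofReal_ne_top, majorantConv]
      _ ≤ _ := by
          gcongr
          simpa using majorantConv_le_maximalFn hfm.enorm hρ x
  have h2 := eLpNorm_sqMeasure_le (S := Iio r) measurableSet_Iio (v := fun t => conv kerT f t x)
    (φ := fun _ => 1) (c := r) measurable_const (fun _ _ => zero_le_one) hr.le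
    (fun t _ ht => h1 t ht) (by
      calc _ ≤ ∫⁻ t in Iio r ∩ Ioi 0, ENNReal.ofReal r := by
            refine setLIntegral_mono' (measurableSet_Iio.inter measurableSet_Ioi) fun t ht => ?_
            refine ofReal_le_ofReal ?_
            have : t < r := ht.1
            linarith
        _ = ENNReal.ofReal (r ^ 2) := by
            rw [lintegral_const, Measure.restrict_apply_univ, inter_comm, Ioi_inter_Iio,
              Real.volume_Ioo, ← ofReal_mul hr.le]
            ring_nf)
  refine h2.trans ?_
  rw [← mul_assoc, mul_right_comm, ← ofReal_mul (by positivity), ← ofReal_mul (by positivity)]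
  gcongr
  rw [cmpConst]
  have : ρ⁻¹ * r ≤ 1 * 2 := by rw [inv_mul_le_iff₀ hρ]; linarith
  have := mul_le_mul_of_nonneg_left this (mul_pos (by norm_num : (0 : ℝ) < 48) hk).le
  linarith

lemma sqFn_add_le {g : ℝ → ℝ} (hf : Integrable f) (hfm : Measurable f) (hg : Integrable g)
    (hgm : Measurable g) {S : Set ℝ} (hS : MeasurableSet S) (x : ℝ) :
    sqFn S (fun y => f y + g y) x ≤ sqFn S f x + sqFn S g x := by
  have h : sqFn S (fun y => f y + g y) x =
      eLpNorm ((fun t => conv kerT f t x) + fun t => conv kerT g t x) 2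
        (sqMeasure.restrict S) := by
    refine eLpNorm_congr_ae ?_
    filter_upwards [ae_sqMeasure_restrict_pos S hS] with t ht
    exact isKernel_kerT.conv_add hf hg ht.2 x
  rw [h]
  exact eLpNorm_add_le (isKernel_kerT.measurable_conv_time hfm x).aestronglyMeasurable
    (isKernel_kerT.measurable_conv_time hgm x).aestronglyMeasurable one_le_two

lemma sqFn_mono {S T : Set ℝ} (h : S ⊆ T) (x : ℝ) : sqFn S f x ≤ sqFn T f x :=
  eLpNorm_mono_measure _ (Measure.restrict_mono h le_rfl)

lemma sqFn_univ_le_add (hfm : Measurable f) (r x : ℝ) :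
    sqFn univ f x ≤ sqFn (Iio r) f x + sqFn (Ici r) f x := by
  have hm := isKernel_kerT.measurable_conv_time hfm x
  have h : (fun t => conv kerT f t x) = (Iio r).indicator (fun t => conv kerT f t x) +
      (Ici r).indicator fun t => conv kerT f t x := by
    rw [show Ici r = (Iio r)ᶜ from compl_Iio.symm, indicator_self_add_compl]
  calc sqFn univ f x = eLpNorm ((Iio r).indicator (fun t => conv kerT f t x) +
        (Ici r).indicator fun t => conv kerT f t x) 2 sqMeasure := by
        rw [← h, sqFn, Measure.restrict_univ]
    _ ≤ _ := eLpNorm_add_le (hm.indicator measurableSet_Iio).aestronglyMeasurable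
        (hm.indicator measurableSet_Ici).aestronglyMeasurable one_le_two
    _ = _ := by
        rw [eLpNorm_indicator_eq_eLpNorm_restrict measurableSet_Iio,
          eLpNorm_indicator_eq_eLpNorm_restrict measurableSet_Ici, sqFn, sqFn]

lemma isOpen_lt_sqFn (hf : Integrable f) (hfm : Measurable f) (S : Set ℝ) (hS : MeasurableSet S)
    (a : ℝ≥0∞) : IsOpen {x | a < sqFn S f x} := by
  rw [← isClosed_compl_iff]
  refine IsSeqClosed.isClosed fun u x hu hux => ?_
  have hu' : ∀ n, sqFn S f (u n) ≤ a := fun n => not_lt.1 (hu n)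
  refine (not_lt (a := a) (b := sqFn S f x)).2 ?_
  have h : sqFn S f x ≤ liminf (fun n => sqFn S f (u n)) atTop := by
    refine Lp.eLpNorm_lim_le_liminf_eLpNorm
      (fun n => (isKernel_kerT.measurable_conv_time hfm (u n)).aestronglyMeasurable) _ ?_
    filter_upwards [ae_sqMeasure_restrict_pos S hS] with t ht
    exact ((hasDerivAt_extT_space hf ht.2 x).continuousAt.tendsto).comp hux
  exact h.trans ((liminf_le_liminf (.of_forall hu')).trans_eq (liminf_const a))

end PoissonSquare

/-! ### The exceptional set -/

namespace PoissonSquare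

open Set ENNReal Metric Filter Topology

variable {f : ℝ → ℝ}

lemma maximalFn_mono {g h : ℝ → ℝ≥0∞} (hgh : ∀ y, g y ≤ h y) (x : ℝ) :
    maximalFn g x ≤ maximalFn h x := by
  rw [maximalFn, maximalFn]
  gcongr with n y
  exact hgh y

lemma half_le_mul_volume_ball {c : ℝ} (hc : 0 < c) :
    (2 : ℝ≥0∞)⁻¹ ≤ (ENNReal.ofReal (4 / 3 * c))⁻¹ * ENNReal.ofReal (2 * (c / 3)) := by
  rw [← ofReal_inv_of_pos (by positivity), ← ofReal_mul (by positivity),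
    ← ofReal_ofNat 2, ← ofReal_inv_of_pos two_pos]
  refine ofReal_le_ofReal (le_of_eq ?_)
  field_simp
  norm_num

/-- A set whose density on each of the Whitney-type balls `ball x (d x / 2)` is small has small
measure relative to `{x | 0 < d x}`. -/
lemma volume_le_of_volume_inter_ball_le {d : ℝ → ℝ} (hd : LipschitzWith 1 d) {E : Set ℝ}
    (hE : MeasurableSet E) (hEd : ∀ y ∈ E, 0 < d y) (η : ℝ≥0∞)
    (h : ∀ x, 0 < d x → volume (E ∩ ball x (d x / 2)) ≤ η * ENNReal.ofReal (d x)) :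
    volume E ≤ 2 * (η * volume {x | 0 < d x}) := by
  have hdm : Measurable d := hd.continuous.measurable
  set w : ℝ → ℝ≥0∞ := fun x => (ENNReal.ofReal (d x))⁻¹
  have hw : Measurable w := by fun_prop
  set T : Set (ℝ × ℝ) := {q | dist q.2 q.1 < d q.1 / 2}
  have hT : MeasurableSet T := measurableSet_lt (by fun_prop) (by fun_prop)
  have hTd : ∀ {x y : ℝ}, (x, y) ∈ T → 0 < d x := fun {x y} hxy => by
    have hxy : dist y x < d x / 2 := hxy
    linarith [dist_nonneg (x := y) (y := x)]
  have hup : ∫⁻ x, ∫⁻ y in E, T.indicator (fun q => w q.1) (x, y) ≤ η * volume {x | 0 < d x} := by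
    rw [← lintegral_indicator_const (measurableSet_lt measurable_const hdm)]
    refine lintegral_mono fun x => ?_
    have h1 : ∀ y, T.indicator (fun q => w q.1) (x, y) =
        (ball x (d x / 2)).indicator (fun _ => w x) y := fun y => rfl
    simp only [h1]
    rw [lintegral_indicator_const measurableSet_ball, Measure.restrict_apply measurableSet_ball,
      inter_comm]
    by_cases hx : 0 < d x
    · rw [indicator_of_mem (show x ∈ {x | 0 < d x} from hx)]
      calc _ ≤ w x * (η * ENNReal.ofReal (d x)) := by gcongr; exact h x hx
        _ = η * (w x * ENNReal.ofReal (d x)) := by ring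
        _ = η := by
          rw [ENNReal.inv_mul_cancel (by simpa using hx) ofReal_ne_top, mul_one]
    · rw [ball_eq_empty.2 (by linarith)]
      simp
  have hlow : 2⁻¹ * volume E ≤ ∫⁻ y in E, ∫⁻ x, T.indicator (fun q => w q.1) (x, y) := by
    rw [← setLIntegral_const]
    refine setLIntegral_mono' hE fun y hy => ?_
    have hy0 := hEd y hy
    calc (2 : ℝ≥0∞)⁻¹ ≤ (ENNReal.ofReal (4 / 3 * d y))⁻¹ * ENNReal.ofReal (2 * (d y / 3)) :=
          half_le_mul_volume_ball hy0
      _ = ∫⁻ x, (ball y (d y / 3)).indicator (fun _ => (ENNReal.ofReal (4 / 3 * d y))⁻¹) x := by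
          rw [lintegral_indicator_const measurableSet_ball, Real.volume_ball]
      _ ≤ _ := by
          refine lintegral_mono fun x => ?_
          by_cases hx : x ∈ ball y (d y / 3)
          swap
          · rw [indicator_of_notMem hx]
            exact zero_le
          rw [indicator_of_mem hx]
          have hx : dist x y < d y / 3 := hx
          have h2 := hd.dist_le_mul x y
          rw [Real.dist_eq (d x)] at h2
          have h3 := abs_le.1 (h2.trans_eq (by simp : _ = dist x y))
          have h4 : (x, y) ∈ T := by
            change dist y x < d x / 2
            rw [dist_comm]
            linarith [h3.1]
          rw [indicator_of_mem h4]
          change _ ≤ (ENNReal.ofReal (d x))⁻¹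
          gcongr
          linarith [h3.2]
  have hswap : ∫⁻ x, ∫⁻ y in E, T.indicator (fun q => w q.1) (x, y) =
      ∫⁻ y in E, ∫⁻ x, T.indicator (fun q => w q.1) (x, y) :=
    lintegral_lintegral_swap ((hw.comp measurable_fst).indicator hT).aemeasurable
  calc volume E = 2 * (2⁻¹ * volume E) := by
        rw [← mul_assoc, ENNReal.mul_inv_cancel two_ne_zero ofNat_ne_top, one_mul]
    _ ≤ _ := by
        exact mul_le_mul_right (hlow.trans (hswap ▸ hup)) _

lemma volume_lt_sqFn_le (hf : Integrable f) (hfm : Measurable f) {s : ℝ} (hs : 0 < s) :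
    volume {y | ENNReal.ofReal (3456 * kerConst * s) < sqFn univ f y} ≤
      ENNReal.ofReal (1 / 96 * s ^ (-(3 / 2) : ℝ)) * ∫⁻ y, ‖f y‖ₑ ^ (3 / 2 : ℝ) := by
  have hk := kerConst_pos
  have hc : 0 < 3456 * kerConst * s := by positivity
  have hc' : 0 < ENNReal.ofReal (3456 * kerConst * s) ^ (3 / 2 : ℝ) :=
    ENNReal.rpow_pos (ofReal_pos.2 hc) ofReal_ne_top
  have h1 := mul_meas_ge_le_lintegral (μ := volume)
    ((measurable_sqFn hfm MeasurableSet.univ).pow_const (3 / 2 : ℝ))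
    (ENNReal.ofReal (3456 * kerConst * s) ^ (3 / 2 : ℝ))
  have h2 := lintegral_sqFn_rpow_le_of_le_two (p := 3 / 2) (by norm_num) (by norm_num) hf hfm
  have h3 : volume {y | ENNReal.ofReal (3456 * kerConst * s) < sqFn univ f y} ≤
      volume {y | ENNReal.ofReal (3456 * kerConst * s) ^ (3 / 2 : ℝ) ≤
        sqFn univ f y ^ (3 / 2 : ℝ)} := by
    refine measure_mono fun y hy => ?_
    have hy : ENNReal.ofReal (3456 * kerConst * s) < sqFn univ f y := hy
    exact ENNReal.rpow_le_rpow hy.le (by norm_num)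
  rw [ofReal_rpow_of_pos hc] at h1 hc' h3
  have h4 := ((mul_le_mul_right h3 _).trans h1).trans h2
  have h5 : (3456 * kerConst * s) ^ (3 / 2 : ℝ) * (1 / 96 * s ^ (-(3 / 2) : ℝ)) =
      (24 * kerConst) ^ (3 / 2 : ℝ) * (6 * (3 / 2 / (3 / 2 - 1))) := by
    have e : 3456 * kerConst * s = 12 ^ (2 : ℝ) * ((24 * kerConst) * s) := by
      norm_num; ring
    rw [e, Real.mul_rpow (by positivity) (by positivity), ← Real.rpow_mul (by norm_num),
      Real.mul_rpow (by positivity) hs.le, Real.rpow_neg hs.le]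
    have : s ^ (3 / 2 : ℝ) ≠ 0 := by positivity
    field_simp
    norm_num
  rw [← h5, ofReal_mul (p := (3456 * kerConst * s) ^ (3 / 2 : ℝ)) (by positivity),
    mul_assoc (ENNReal.ofReal ((3456 * kerConst * s) ^ (3 / 2 : ℝ)))] at h4
  exact (ENNReal.mul_le_mul_iff_right hc'.ne' ofReal_ne_top).1 h4

/-- The set of points where the square function is much larger than `l` although the
maximal functions are at most `s`. -/
def exceptionalSet (f : ℝ → ℝ) (l s : ℝ) : Set ℝ :=
  {y | ENNReal.ofReal (l + 3648 * kerConst * s) < sqFn univ f y ∧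
    maximalFn (fun w => ‖f w‖ₑ) y ≤ ENNReal.ofReal s ∧
    maximalFn (fun w => ‖f w‖ₑ ^ (3 / 2 : ℝ)) y ≤ ENNReal.ofReal (s ^ (3 / 2 : ℝ))}

lemma lt_sqFn_indicator_of_mem_exceptionalSet (hf : Integrable f) (hfm : Measurable f)
    {l s d x y z : ℝ} (hl : 0 < l) (hs : 0 < s) (hd : 0 < d) (hxz : |x - z| ≤ d)
    (hz : sqFn univ f z ≤ ENNReal.ofReal l) (hy : y ∈ exceptionalSet f l s)
    (hyx : |y - x| < d / 2) :
    ENNReal.ofReal (3456 * kerConst * s) < sqFn univ ((ball x (2 * d)).indicator f) y := by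
  have hk := kerConst_pos
  have hc : 0 < cmpConst := cmpConst_pos
  obtain ⟨hy1, hy2, -⟩ := hy
  set r := √(2 * d)
  have hr : 0 < r := Real.sqrt_pos.2 (by positivity)
  have hr2 : r ^ 2 = 2 * d := Real.sq_sqrt (by positivity)
  set ρ := √d
  have hρ : 0 < ρ := Real.sqrt_pos.2 hd
  have hρ2 : ρ ^ 2 = d := Real.sq_sqrt hd.le
  have hrρ : r ≤ 2 * ρ := by nlinarith
  have hbm : MeasurableSet (ball x (2 * d)) := measurableSet_ball
  set f₁ := (ball x (2 * d)).indicator f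
  set f₂ := (ball x (2 * d))ᶜ.indicator f
  have hsum : f = fun w => f₁ w + f₂ w := by
    funext w
    exact (congrFun (indicator_self_add_compl (ball x (2 * d)) f) w).symm
  have hM2 : maximalFn (fun w => ‖f₂ w‖ₑ) y ≤ ENNReal.ofReal s := by
    refine (maximalFn_mono (fun w => ?_) y).trans hy2
    exact enorm_indicator_le_enorm_self _ _
  have h1 : sqFn (Iio r) f y ≤ sqFn univ f₁ y + ENNReal.ofReal (cmpConst * s) := by
    calc sqFn (Iio r) f y ≤ sqFn (Iio r) f₁ y + sqFn (Iio r) f₂ y := by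
          conv_lhs => rw [hsum]
          exact sqFn_add_le (hf.indicator hbm) (hfm.indicator hbm) (hf.indicator hbm.compl)
            (hfm.indicator hbm.compl) measurableSet_Iio y
      _ ≤ _ := by
          refine add_le_add (sqFn_mono (subset_univ _) y) ?_
          rw [ofReal_mul hc.le]
          refine (sqFn_Iio_le_of_far (hfm.indicator hbm.compl) hr hρ hrρ fun w hw => ?_).trans
            (mul_le_mul_right hM2 _)
          refine indicator_of_notMem (notMem_compl_iff.2 ?_) _
          rw [mem_ball, Real.dist_eq]
          rw [hρ2] at hw
          calc |w - x| = |(w - y) + (y - x)| := by ring_nf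
            _ ≤ |w - y| + |y - x| := abs_add_le _ _
            _ < 2 * d := by linarith
  have h2 : sqFn (Ici r) f y ≤ ENNReal.ofReal l + ENNReal.ofReal (cmpConst * s) := by
    refine (sqFn_Ici_le hf hfm hr (z := z) ?_).trans ?_
    · rw [hr2]
      calc |y - z| = |(y - x) + (x - z)| := by ring_nf
        _ ≤ |y - x| + |x - z| := abs_add_le _ _
        _ ≤ 2 * d := by linarith
    · rw [ofReal_mul hc.le]
      gcongr
      exact (sqFn_mono (subset_univ _) z).trans hz
  have h3 : ENNReal.ofReal (3456 * kerConst * s) + ENNReal.ofReal (l + 2 * (cmpConst * s)) <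
      sqFn univ f₁ y + ENNReal.ofReal (l + 2 * (cmpConst * s)) := by
    calc _ = ENNReal.ofReal (l + 3648 * kerConst * s) := by
          rw [← ofReal_add (by positivity) (by positivity), cmpConst]
          ring_nf
      _ < sqFn univ f y := hy1
      _ ≤ sqFn (Iio r) f y + sqFn (Ici r) f y := sqFn_univ_le_add hfm r y
      _ ≤ (sqFn univ f₁ y + ENNReal.ofReal (cmpConst * s)) +
          (ENNReal.ofReal l + ENNReal.ofReal (cmpConst * s)) := add_le_add h1 h2
      _ = _ := by
          rw [add_assoc, ← ofReal_add (by positivity) (by positivity),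
            ← ofReal_add (by positivity) (by positivity)]
          ring_nf
  exact lt_of_add_lt_add_right h3

lemma volume_exceptionalSet_inter_ball_le (hf : Integrable f) (hfm : Measurable f)
    {l s d x z : ℝ} (hl : 0 < l) (hs : 0 < s) (hd : 0 < d) (hxz : |x - z| ≤ d)
    (hz : sqFn univ f z ≤ ENNReal.ofReal l) :
    volume (exceptionalSet f l s ∩ ball x (d / 2)) ≤
      ENNReal.ofReal (5 / 96) * ENNReal.ofReal d := by
  rcases (exceptionalSet f l s ∩ ball x (d / 2)).eq_empty_or_nonempty with h0 | ⟨y, hy, hyx⟩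
  · simp [h0]
  have hbm : MeasurableSet (ball x (2 * d)) := measurableSet_ball
  have hyx : dist y x < d / 2 := hyx
  have h1 : ∫⁻ w, ‖(ball x (2 * d)).indicator f w‖ₑ ^ (3 / 2 : ℝ) ≤
      ENNReal.ofReal (5 * d) * ENNReal.ofReal (s ^ (3 / 2 : ℝ)) := by
    calc _ = ∫⁻ w, (ball x (2 * d)).indicator (fun w => ‖f w‖ₑ ^ (3 / 2 : ℝ)) w := by
          refine lintegral_congr fun w => ?_
          by_cases hw : w ∈ ball x (2 * d) <;> simp [hw]
      _ = ∫⁻ w in ball x (2 * d), ‖f w‖ₑ ^ (3 / 2 : ℝ) := lintegral_indicator hbm _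
      _ ≤ ∫⁻ w in closedBall y (5 / 2 * d), ‖f w‖ₑ ^ (3 / 2 : ℝ) := by
          refine lintegral_mono_set (ball_subset_closedBall.trans
            (closedBall_subset_closedBall' ?_))
          rw [dist_comm]
          linarith
      _ ≤ ENNReal.ofReal (2 * (5 / 2 * d)) * maximalFn (fun w => ‖f w‖ₑ ^ (3 / 2 : ℝ)) y :=
          setLIntegral_closedBall_le _ _ (by positivity)
      _ ≤ _ := by
          rw [show 2 * (5 / 2 * d) = 5 * d by ring]
          gcongr
          exact hy.2.2
  calc _ ≤ volume {y | ENNReal.ofReal (3456 * kerConst * s) <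
          sqFn univ ((ball x (2 * d)).indicator f) y} :=
        measure_mono fun y hy =>
          lt_sqFn_indicator_of_mem_exceptionalSet hf hfm hl hs hd hxz hz hy.1 hy.2
    _ ≤ ENNReal.ofReal (1 / 96 * s ^ (-(3 / 2) : ℝ)) *
        (ENNReal.ofReal (5 * d) * ENNReal.ofReal (s ^ (3 / 2 : ℝ))) :=
        (volume_lt_sqFn_le (hf.indicator hbm) (hfm.indicator hbm) hs).trans
          (mul_le_mul_right h1 _)
    _ = _ := by
        rw [← ofReal_mul (by positivity), ← ofReal_mul (by positivity),
          ← ofReal_mul (by positivity), Real.rpow_neg hs.le]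
        congr 1
        field_simp

lemma volume_lt_sqFn_lt_top (hf : Integrable f) (hfm : Measurable f)
    (hf' : ∫⁻ y, ‖f y‖ₑ ^ (3 / 2 : ℝ) < ∞) {l : ℝ} (hl : 0 < l) :
    volume {x | ENNReal.ofReal l < sqFn univ f x} < ∞ := by
  have hk := kerConst_pos
  have h := volume_lt_sqFn_le hf hfm (s := l / (3456 * kerConst)) (by positivity)
  rw [mul_div_cancel₀ _ (by positivity)] at h
  exact h.trans_lt (mul_lt_top ofReal_lt_top hf')

lemma volume_exceptionalSet_le (hf : Integrable f) (hfm : Measurable f)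
    (hf' : ∫⁻ y, ‖f y‖ₑ ^ (3 / 2 : ℝ) < ∞) {l s : ℝ} (hl : 0 < l) (hs : 0 < s) :
    volume (exceptionalSet f l s) ≤
      ENNReal.ofReal (5 / 48) * volume {x | ENNReal.ofReal l < sqFn univ f x} := by
  have hk := kerConst_pos
  set Ω := {x | ENNReal.ofReal l < sqFn univ f x}
  have hΩ : IsClosed Ωᶜ := (isOpen_lt_sqFn hf hfm univ MeasurableSet.univ _).isClosed_compl
  have hne : Ωᶜ.Nonempty := by
    rw [nonempty_compl]
    intro h
    have := volume_lt_sqFn_lt_top hf hfm hf' hl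
    change volume Ω < ∞ at this
    simp [h] at this
  have hpos : ∀ x, 0 < infDist x Ωᶜ ↔ x ∈ Ω := fun x => by
    rw [← hΩ.notMem_iff_infDist_pos hne, notMem_compl_iff]
  have hset : {x | 0 < infDist x Ωᶜ} = Ω := by ext x; exact hpos x
  have hG := measurable_sqFn hfm MeasurableSet.univ
  have hE : MeasurableSet (exceptionalSet f l s) :=
    (measurableSet_lt measurable_const hG).inter
      ((measurableSet_le (measurable_maximalFn hfm.enorm) measurable_const).inter
        (measurableSet_le (measurable_maximalFn (hfm.enorm.pow_const _)) measurable_const))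
  have h := volume_le_of_volume_inter_ball_le (d := fun x => infDist x Ωᶜ)
    (lipschitz_infDist_pt _) hE (fun y hy => (hpos y).2 ?_) (ENNReal.ofReal (5 / 96)) ?_
  · rw [hset, ← mul_assoc, ← ofReal_ofNat 2, ← ofReal_mul zero_le_two] at h
    norm_num at h ⊢
    exact h
  · refine lt_of_le_of_lt (ofReal_le_ofReal ?_) hy.1
    have : 0 < 3648 * kerConst * s := by positivity
    linarith
  · intro x hx
    obtain ⟨z, hz, hxz⟩ := hΩ.exists_infDist_eq_dist hne x
    refine volume_exceptionalSet_inter_ball_le hf hfm hl hs hx (z := z) ?_ (not_lt.1 hz)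
    rw [hxz, Real.dist_eq]

end PoissonSquare

/-! ### The square function for all exponents -/

namespace PoissonSquare

open Set ENNReal Metric Filter Topology

variable {f : ℝ → ℝ}

/-- The maximal function controlling the square function in the good-`λ` inequality. -/
noncomputable def controlFn (f : ℝ → ℝ) (x : ℝ) : ℝ≥0∞ :=
  max (maximalFn (fun w => ‖f w‖ₑ) x)
    (maximalFn (fun w => ‖f w‖ₑ ^ (3 / 2 : ℝ)) x ^ (2 / 3 : ℝ))

lemma measurable_controlFn (hfm : Measurable f) : Measurable (controlFn f) :=
  (measurable_maximalFn hfm.enorm).max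
    ((measurable_maximalFn (hfm.enorm.pow_const _)).pow_const _)

lemma lintegral_controlFn_rpow_le (hfm : Measurable f) {p : ℝ} (hp : 2 ≤ p) :
    ∫⁻ x, controlFn f x ^ p ≤ ENNReal.ofReal (30 * 4 ^ p) * ∫⁻ x, ‖f x‖ₑ ^ p := by
  have h0 : 0 ≤ p := by linarith
  have h1 := maximalFn_strong hfm.enorm (p := p) (by linarith)
  have h2 := maximalFn_strong (hfm.enorm.pow_const (3 / 2 : ℝ)) (p := 2 / 3 * p) (by linarith)
  have e : ∀ y, (‖f y‖ₑ ^ (3 / 2 : ℝ)) ^ (2 / 3 * p) = ‖f y‖ₑ ^ p := fun y => by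
    rw [← ENNReal.rpow_mul]
    congr 1
    ring
  simp only [e] at h2
  have c1 : 5 * 4 ^ p * (p / (p - 1)) ≤ 10 * (4 : ℝ) ^ p := by
    have : p / (p - 1) ≤ 2 := by rw [div_le_iff₀ (by linarith)]; linarith
    calc _ ≤ 5 * (4 : ℝ) ^ p * 2 := by gcongr
      _ = _ := by ring
  have c2 : 5 * 4 ^ (2 / 3 * p) * (2 / 3 * p / (2 / 3 * p - 1)) ≤ 20 * (4 : ℝ) ^ p := by
    have : 2 / 3 * p / (2 / 3 * p - 1) ≤ 4 := by rw [div_le_iff₀ (by linarith)]; linarith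
    calc _ ≤ 5 * (4 : ℝ) ^ p * 4 := by
          gcongr
          · exact div_nonneg (by linarith) (by linarith)
          · norm_num
          · linarith
      _ = _ := by ring
  calc ∫⁻ x, controlFn f x ^ p ≤ ∫⁻ x, (maximalFn (fun w => ‖f w‖ₑ) x ^ p +
        maximalFn (fun w => ‖f w‖ₑ ^ (3 / 2 : ℝ)) x ^ (2 / 3 * p)) := by
        refine lintegral_mono fun x => ?_
        rw [ENNReal.rpow_mul, controlFn]
        rcases le_total (maximalFn (fun w => ‖f w‖ₑ) x)
          (maximalFn (fun w => ‖f w‖ₑ ^ (3 / 2 : ℝ)) x ^ (2 / 3 : ℝ)) with h | h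
        · rw [max_eq_right h]
          exact le_add_self
        · rw [max_eq_left h]
          exact le_self_add
    _ = (∫⁻ x, maximalFn (fun w => ‖f w‖ₑ) x ^ p) +
        ∫⁻ x, maximalFn (fun w => ‖f w‖ₑ ^ (3 / 2 : ℝ)) x ^ (2 / 3 * p) :=
        lintegral_add_left ((measurable_maximalFn hfm.enorm).pow_const _) _
    _ ≤ ENNReal.ofReal (10 * 4 ^ p) * (∫⁻ x, ‖f x‖ₑ ^ p) +
        ENNReal.ofReal (20 * 4 ^ p) * ∫⁻ x, ‖f x‖ₑ ^ p :=
        add_le_add (h1.trans (mul_le_mul_left (ofReal_le_ofReal c1) _))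
          (h2.trans (mul_le_mul_left (ofReal_le_ofReal c2) _))
    _ = _ := by
        rw [← add_mul, ← ofReal_add (by positivity) (by positivity), ← add_mul]
        norm_num

/-- The good-`λ` inequality. -/
lemma goodLambda (hf : Integrable f) (hfm : Measurable f)
    (hf' : ∫⁻ y, ‖f y‖ₑ ^ (3 / 2 : ℝ) < ∞) {γ : ℝ} (hγ : 0 < γ) {l : ℝ} (hl : 0 < l) :
    volume {x | ENNReal.ofReal ((1 + 3648 * kerConst * γ) * l) < sqFn univ f x} ≤
      volume {x | ENNReal.ofReal (γ * l) < controlFn f x} +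
        ENNReal.ofReal (5 / 48) * volume {x | ENNReal.ofReal l < sqFn univ f x} := by
  have hs : 0 < γ * l := mul_pos hγ hl
  refine (measure_mono (t := {x | ENNReal.ofReal (γ * l) < controlFn f x} ∪
    exceptionalSet f l (γ * l)) fun x hx => ?_).trans ((measure_union_le _ _).trans
      (add_le_add_right (volume_exceptionalSet_le hf hfm hf' hl hs) _))
  by_cases hm : ENNReal.ofReal (γ * l) < controlFn f x
  · exact Or.inl hm
  have hm := max_le_iff.1 (not_lt.1 hm)
  refine Or.inr ⟨?_, hm.1, ?_⟩
  · rw [show l + 3648 * kerConst * (γ * l) = (1 + 3648 * kerConst * γ) * l by ring]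
    exact hx
  · have h := ENNReal.rpow_le_rpow hm.2 (by norm_num : (0 : ℝ) ≤ 3 / 2)
    rw [← ENNReal.rpow_mul, ofReal_rpow_of_pos hs] at h
    norm_num at h ⊢
    exact h

lemma lintegral_min_sqFn_rpow_lt_top (hf : Integrable f) (hfm : Measurable f)
    (hf' : ∫⁻ y, ‖f y‖ₑ ^ (3 / 2 : ℝ) < ∞) {p : ℝ} (hp : 2 ≤ p) (N : ℕ) :
    ∫⁻ x, min (sqFn univ f x) N ^ p < ∞ := by
  have h2 := lintegral_sqFn_rpow_le_of_le_two (p := 3 / 2) (by norm_num) (by norm_num) hf hfm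
  calc ∫⁻ x, min (sqFn univ f x) N ^ p ≤
        ∫⁻ x, (N : ℝ≥0∞) ^ (p - 3 / 2) * sqFn univ f x ^ (3 / 2 : ℝ) := by
        refine lintegral_mono fun x => ?_
        have e : p = (p - 3 / 2) + 3 / 2 := by ring
        conv_lhs => rw [e]
        rw [ENNReal.rpow_add_of_nonneg _ _ (by linarith) (by norm_num)]
        exact mul_le_mul' (ENNReal.rpow_le_rpow (min_le_right _ _) (by linarith))
          (ENNReal.rpow_le_rpow (min_le_left _ _) (by norm_num))
    _ = (N : ℝ≥0∞) ^ (p - 3 / 2) * ∫⁻ x, sqFn univ f x ^ (3 / 2 : ℝ) :=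
        lintegral_const_mul' _ _ (rpow_ne_top_of_nonneg (by linarith) (natCast_ne_top N))
    _ < ∞ := mul_lt_top (rpow_lt_top_of_nonneg (by linarith) (natCast_ne_top N))
        (h2.trans_lt (mul_lt_top ofReal_lt_top hf'))

lemma distribution_min_le {F m : ℝ → ℝ≥0∞} {η N : ℝ≥0∞} {b c l : ℝ} (hb : 1 ≤ b) (hl : 0 < l)
    (h : volume {x | ENNReal.ofReal (b * l) < F x} ≤
      volume {x | ENNReal.ofReal (c * l) < m x} + η * volume {x | ENNReal.ofReal l < F x}) :
    volume {x | ENNReal.ofReal (b * l) < min (F x) N} ≤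
      volume {x | ENNReal.ofReal (c * l) < m x} +
        η * volume {x | ENNReal.ofReal l < min (F x) N} := by
  by_cases hN : ENNReal.ofReal (b * l) < N
  · have hN' : ENNReal.ofReal l < N :=
      (ofReal_le_ofReal (le_mul_of_one_le_left hl.le hb)).trans_lt hN
    simpa only [lt_min_iff, hN, hN', and_true] using h
  · simp [hN]

lemma one_add_inv_rpow_le {p : ℝ} (hp : 0 < p) : (1 + p⁻¹) ^ p ≤ 3 := by
  have h := Real.add_one_le_exp p⁻¹
  calc (1 + p⁻¹) ^ p ≤ Real.exp p⁻¹ ^ p := by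
        gcongr
        linarith
    _ = Real.exp 1 := by rw [← Real.exp_mul, inv_mul_cancel₀ hp.ne']
    _ ≤ 3 := Real.exp_one_lt_three.le

lemma lintegral_min_sqFn_rpow_le (hf : Integrable f) (hfm : Measurable f)
    (hf' : ∫⁻ y, ‖f y‖ₑ ^ (3 / 2 : ℝ) < ∞) {p : ℝ} (hp : 2 ≤ p) (N : ℕ) :
    ∫⁻ x, min (sqFn univ f x) N ^ p ≤
      ENNReal.ofReal (6 * (3648 * kerConst * p) ^ p) * ∫⁻ x, controlFn f x ^ p := by
  have hk := kerConst_pos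
  have hp0 : 0 < p := by linarith
  set A := 3648 * kerConst * p with hA
  have hA0 : 0 < A := by positivity
  have hbe : 1 + 3648 * kerConst * A⁻¹ = 1 + p⁻¹ := by
    rw [hA]; field_simp
  have hpi : 0 < p⁻¹ := by positivity
  have hfin := lintegral_min_sqFn_rpow_lt_top hf hfm hf' hp N
  have h := lintegral_rpow_le_of_distribution (F := fun x => min (sqFn univ f x) N)
    (m := controlFn f) ((measurable_sqFn hfm MeasurableSet.univ).min measurable_const)
    (measurable_controlFn hfm) (b := 1 + p⁻¹) (c := A⁻¹) hp0 (by positivity) (by positivity)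
    (ENNReal.ofReal (5 / 48)) (fun l hl => distribution_min_le (by linarith) hl (by
      rw [← hbe]
      exact goodLambda hf hfm hf' (by positivity) hl))
  set I := ∫⁻ x, min (sqFn univ f x) N ^ p
  set J := ∫⁻ x, controlFn f x ^ p
  rw [inv_inv, ofReal_rpow_of_pos (by positivity), ofReal_rpow_of_pos hA0] at h
  have h1 : I ≤ ENNReal.ofReal (3 * A ^ p) * J + ENNReal.ofReal (1 / 2) * I := by
    calc I ≤ ENNReal.ofReal 3 * (ENNReal.ofReal (A ^ p) * J + ENNReal.ofReal (5 / 48) * I) :=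
          h.trans (by gcongr; exact one_add_inv_rpow_le hp0)
      _ = ENNReal.ofReal (3 * A ^ p) * J + ENNReal.ofReal (3 * (5 / 48)) * I := by
          rw [mul_add, ← mul_assoc, ← mul_assoc, ← ofReal_mul (by norm_num),
            ← ofReal_mul (by norm_num)]
      _ ≤ _ := by gcongr; norm_num
  have h2 : I = ENNReal.ofReal (1 / 2) * I + ENNReal.ofReal (1 / 2) * I := by
    rw [← add_mul, ← ofReal_add (by norm_num) (by norm_num)]
    norm_num
  have h3 : ENNReal.ofReal (1 / 2) * I ≤ ENNReal.ofReal (3 * A ^ p) * J := by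
    exact (ENNReal.add_le_add_iff_right (mul_lt_top ofReal_lt_top hfin).ne).1 (h2.symm.trans_le h1)
  calc I = ENNReal.ofReal 2 * (ENNReal.ofReal (1 / 2) * I) := by
        rw [← mul_assoc, ← ofReal_mul zero_le_two]
        norm_num
    _ ≤ ENNReal.ofReal 2 * (ENNReal.ofReal (3 * A ^ p) * J) := by gcongr
    _ = _ := by
        rw [← mul_assoc, ← ofReal_mul zero_le_two]
        ring_nf

lemma lintegral_sqFn_rpow_le_of_two_le (hf : Integrable f) (hfm : Measurable f)
    (hf' : ∫⁻ y, ‖f y‖ₑ ^ (3 / 2 : ℝ) < ∞) {p : ℝ} (hp : 2 ≤ p) :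
    ∫⁻ x, sqFn univ f x ^ p ≤
      ENNReal.ofReal (180 * (14592 * kerConst * p) ^ p) * ∫⁻ x, ‖f x‖ₑ ^ p := by
  have hk := kerConst_pos
  have hp0 : 0 < p := by linarith
  have hG := measurable_sqFn hfm MeasurableSet.univ
  have hsup : ∀ x, sqFn univ f x ^ p = ⨆ N : ℕ, min (sqFn univ f x) N ^ p := fun x => by
    have ht : Tendsto (fun N : ℕ => min (sqFn univ f x) N ^ p) atTop
        (𝓝 (min (sqFn univ f x) ∞ ^ p)) :=
      (ENNReal.continuous_rpow_const.tendsto _).comp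
        (tendsto_const_nhds.min ENNReal.tendsto_nat_nhds_top)
    rw [min_eq_left le_top] at ht
    refine tendsto_nhds_unique ht (tendsto_atTop_iSup fun m n hmn => ?_)
    gcongr
  simp only [hsup]
  rw [lintegral_iSup (fun N => (hG.min measurable_const).pow_const p) (fun m n hmn x => by
    dsimp only
    gcongr)]
  refine iSup_le fun N => (lintegral_min_sqFn_rpow_le hf hfm hf' hp N).trans ?_
  calc _ ≤ ENNReal.ofReal (6 * (3648 * kerConst * p) ^ p) *
        (ENNReal.ofReal (30 * 4 ^ p) * ∫⁻ x, ‖f x‖ₑ ^ p) := by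
        gcongr
        exact lintegral_controlFn_rpow_le hfm hp
    _ = _ := by
        rw [← mul_assoc, ← ofReal_mul (by positivity)]
        congr 2
        rw [show 14592 * kerConst * p = 3648 * kerConst * p * 4 by ring,
          Real.mul_rpow (z := p) (x := 3648 * kerConst * p) (by positivity) (by norm_num)]
        ring

/-- The constant in the `L^p` bound for the square function. -/
noncomputable def sqConst : ℝ := 180 * (1 + 14592 * kerConst)

lemma sqConst_pos : 0 < sqConst := by
  have := kerConst_pos
  rw [sqConst]
  positivity

/-- The `L^p` bound for the square function of a real-valued function. -/
lemma eLpNorm_sqFn_le (hf : Integrable f) (hfm : Measurable f)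
    (hf' : ∫⁻ y, ‖f y‖ₑ ^ (3 / 2 : ℝ) < ∞) {p : ℝ} (hp : 1 < p) :
    eLpNorm (sqFn univ f) (ENNReal.ofReal p) volume ≤
      ENNReal.ofReal (sqConst * max p (p / (p - 1))) *
        eLpNorm f (ENNReal.ofReal p) volume := by
  have hk := kerConst_pos
  have hp0 : 0 < p := by linarith
  have hp1 : 0 < p - 1 := by linarith
  have hne : ENNReal.ofReal p ≠ 0 := (ofReal_pos.2 hp0).ne'
  set K := max p (p / (p - 1))
  have hK : 1 ≤ K := hp.le.trans (le_max_left _ _)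
  have hmain : ∫⁻ x, sqFn univ f x ^ p ≤
      ENNReal.ofReal ((sqConst * K) ^ p) * ∫⁻ x, ‖f x‖ₑ ^ p := by
    rcases le_total p 2 with hp2 | hp2
    · refine (lintegral_sqFn_rpow_le_of_le_two hp hp2 hf hfm).trans ?_
      gcongr
      have h1 : 6 * (p / (p - 1)) ≤ (6 * K) ^ p := by
        have h2 : 6 * (p / (p - 1)) ≤ 6 * K := by gcongr; exact le_max_right _ _
        exact h2.trans (Real.self_le_rpow_of_one_le (by linarith) hp.le)
      calc _ ≤ (24 * kerConst) ^ p * (6 * K) ^ p := by gcongr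
        _ = (24 * kerConst * (6 * K)) ^ p :=
          (Real.mul_rpow (by positivity) (by positivity)).symm
        _ ≤ _ := by
          have : 0 ≤ kerConst * K := by positivity
          gcongr ?_ ^ p
          rw [sqConst]
          nlinarith
    · refine (lintegral_sqFn_rpow_le_of_two_le hf hfm hf' hp2).trans ?_
      gcongr
      calc _ ≤ (180 : ℝ) ^ p * (14592 * kerConst * p) ^ p := by
            gcongr
            exact Real.self_le_rpow_of_one_le (by norm_num) hp.le
        _ = (180 * (14592 * kerConst * p)) ^ p :=
          (Real.mul_rpow (by positivity) (by positivity)).symm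
        _ ≤ _ := by
          have h1 : kerConst * p ≤ kerConst * K := by gcongr; exact le_max_left _ _
          gcongr ?_ ^ p
          rw [sqConst]
          nlinarith
  rw [eLpNorm_eq_lintegral_rpow_enorm_toReal hne ofReal_ne_top,
    eLpNorm_eq_lintegral_rpow_enorm_toReal hne ofReal_ne_top, toReal_ofReal hp0.le]
  simp only [enorm_eq_self]
  have hC : 0 < sqConst * K := mul_pos sqConst_pos (by linarith)
  calc _ ≤ (ENNReal.ofReal ((sqConst * K) ^ p) * ∫⁻ x, ‖f x‖ₑ ^ p) ^ (1 / p) := by gcongr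
    _ = _ := by
      rw [ENNReal.mul_rpow_of_nonneg _ _ (by positivity), ← ofReal_rpow_of_pos hC,
        ← ENNReal.rpow_mul, mul_one_div_cancel hp0.ne', ENNReal.rpow_one]

end PoissonSquare

/-! ### The Poisson semigroup -/

namespace PoissonSquare

open Set ENNReal Metric Filter Topology

lemma half_ker_eq {t s : ℝ} (ht : 0 < t) (hs : 0 < s) :
    t ^ 2 / (4 * s ^ 2) * (Real.exp (-(t ^ 2 / (4 * s))) / √(t ^ 2 / (4 * s))) =
      1 / 2 * ker t s := by
  rw [ker, gaussKernel_of_pos _ _ _ hs, Real.sqrt_div (by positivity), Real.sqrt_sq ht.le,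
    Real.sqrt_mul (by norm_num), show (4 : ℝ) = 2 ^ 2 by norm_num, Real.sqrt_sq zero_le_two,
    show -(t ^ 2 / (2 ^ 2 * s)) = -(t ^ 2 / s) / 4 by ring]
  have h1 : s ^ (-(3 / 2) : ℝ) = √s / s ^ 2 := by
    rw [Real.sqrt_eq_rpow, ← Real.rpow_two, ← Real.rpow_sub hs]
    norm_num
  rw [h1]
  have h2 : √s * √s = s := Real.mul_self_sqrt hs.le
  have h3 : 0 < √s := Real.sqrt_pos.2 hs
  field_simp
  norm_num
  ring

lemma poissonP_eq_integral_ker (f : ℝ → ℂ) {t : ℝ} (ht : 0 < t) (x : ℝ) :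
    poissonP f t x = (((2 * √Real.pi)⁻¹ : ℝ) : ℂ) * ∫ y, (ker t (y - x) : ℂ) * f y := by
  have himg : (fun s : ℝ => t ^ 2 / (4 * s)) '' Ioi 0 = Ioi 0 := by
    ext u
    constructor
    · rintro ⟨s, hs, rfl⟩
      have hs : 0 < s := hs
      change 0 < t ^ 2 / (4 * s)
      positivity
    · intro hu
      have hu : 0 < u := hu
      refine ⟨t ^ 2 / (4 * u), show 0 < t ^ 2 / (4 * u) by positivity, ?_⟩
      field_simp
  have hinj : InjOn (fun s : ℝ => t ^ 2 / (4 * s)) (Ioi 0) := by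
    intro a ha b hb hab
    have ha : 0 < a := ha
    have hb : 0 < b := hb
    simp only at hab
    field_simp at hab
    linarith
  have hder : ∀ s ∈ Ioi (0 : ℝ), HasDerivWithinAt (fun s : ℝ => t ^ 2 / (4 * s))
      (-(t ^ 2 / (4 * s ^ 2))) (Ioi 0) s := by
    intro s hs
    have hs : 0 < s := hs
    have h := ((hasDerivAt_const s (t ^ 2)).div ((hasDerivAt_id' s).const_mul 4)
      (by positivity : 4 * s ≠ 0)).hasDerivWithinAt (s := Ioi 0)
    refine h.congr_deriv ?_
    field_simp
    ring
  have h := integral_image_eq_integral_abs_deriv_smul measurableSet_Ioi hder hinj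
    (fun u => ((Real.exp (-u) / √u : ℝ) : ℂ) * f (x + t ^ 2 / (4 * u)))
  have hcongr : ∀ s ∈ Ioi (0 : ℝ), |-(t ^ 2 / (4 * s ^ 2))| •
      (((Real.exp (-(t ^ 2 / (4 * s))) / √(t ^ 2 / (4 * s)) : ℝ) : ℂ) *
        f (x + t ^ 2 / (4 * (t ^ 2 / (4 * s))))) = (1 / 2 : ℝ) • ((ker t s : ℂ) * f (s + x)) := by
    intro s hs
    have hs : 0 < s := hs
    have e : x + t ^ 2 / (4 * (t ^ 2 / (4 * s))) = s + x := by field_simp; ring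
    rw [e, abs_neg, abs_of_pos (by positivity), Complex.real_smul, Complex.real_smul,
      ← mul_assoc, ← mul_assoc, ← Complex.ofReal_mul, ← Complex.ofReal_mul, half_ker_eq ht hs]
  rw [poissonP, ← himg, h, setIntegral_congr_fun measurableSet_Ioi hcongr, integral_smul,
    setIntegral_eq_integral_of_forall_compl_eq_zero (fun s hs => ?_),
    ← integral_add_right_eq_self (fun y => (ker t (y - x) : ℂ) * f y) x]
  · simp only [add_sub_cancel_right, Complex.real_smul]
    push_cast
    ring
  · rw [ker, gaussKernel_of_nonpos _ _ _ (not_lt.1 hs)]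
    simp

lemma poissonP_eq_conv {f : ℝ → ℂ} (hf : Integrable f) {t : ℝ} (ht : 0 < t) (x : ℝ) :
    poissonP f t x = (((2 * √Real.pi)⁻¹ : ℝ) : ℂ) *
      ((conv ker (fun y => (f y).re) t x : ℂ) +
        (conv ker (fun y => (f y).im) t x : ℂ) * Complex.I) := by
  have h1 := isKernel_ker.integrable hf.re ht x
  have h2 := isKernel_ker.integrable hf.im ht x
  rw [poissonP_eq_integral_ker f ht x, conv, conv, ← integral_complex_ofReal,
    ← integral_complex_ofReal, ← integral_mul_const,
    ← integral_add h1.ofReal (h2.ofReal.mul_const _)]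
  congr 2
  funext y
  conv_lhs => rw [← Complex.re_add_im (f y)]
  push_cast
  ring

lemma deriv_poissonP {f : ℝ → ℂ} (hf : Integrable f) {t : ℝ} (ht : 0 < t) (x : ℝ) :
    deriv (fun s => poissonP f s x) t = (((2 * √Real.pi)⁻¹ : ℝ) : ℂ) *
      ((conv kerT (fun y => (f y).re) t x : ℂ) +
        (conv kerT (fun y => (f y).im) t x : ℂ) * Complex.I) := by
  have h := ((hasDerivAt_ext_time hf.re ht x).ofReal_comp.add
    ((hasDerivAt_ext_time hf.im ht x).ofReal_comp.mul_const Complex.I)).const_mul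
      (((2 * √Real.pi)⁻¹ : ℝ) : ℂ)
  refine (h.congr_of_eventuallyEq ?_).deriv
  filter_upwards [lt_mem_nhds ht] with s hs
  exact poissonP_eq_conv hf hs x

lemma enorm_deriv_poissonP_le {f : ℝ → ℂ} (hf : Integrable f) {t : ℝ} (ht : 0 < t) (x : ℝ) :
    ‖deriv (fun s => poissonP f s x) t‖ₑ ≤
      ‖|conv kerT (fun y => (f y).re) t x| + |conv kerT (fun y => (f y).im) t x|‖ₑ := by
  rw [enorm_le_iff_norm_le, deriv_poissonP hf ht, norm_mul, Complex.norm_real,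
    Real.norm_of_nonneg (by positivity), Real.norm_of_nonneg (by positivity)]
  have h1 : (2 * √Real.pi)⁻¹ ≤ 1 := by
    refine inv_le_one_of_one_le₀ ?_
    have : 1 ≤ √Real.pi := Real.one_le_sqrt.2 (by linarith [Real.pi_gt_three])
    linarith
  refine (mul_le_of_le_one_left (norm_nonneg _) h1).trans ((norm_add_le _ _).trans_eq ?_)
  simp

lemma enorm_sqrt_integral_le {f : ℝ → ℂ} (hf : Integrable f) (hfm : Measurable f) (x : ℝ) :
    ‖√(∫ t in Ioi (0 : ℝ), ‖(t : ℂ) * deriv (fun s => poissonP f s x) t‖ ^ 2 / t)‖ₑ ≤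
      sqFn univ (fun y => (f y).re) x + sqFn univ (fun y => (f y).im) x := by
  have hm1 := isKernel_kerT.measurable_conv_time (Complex.measurable_re.comp hfm) x
  have hm2 := isKernel_kerT.measurable_conv_time (Complex.measurable_im.comp hfm) x
  set a : ℝ → ℝ := fun t => conv kerT (fun y => (f y).re) t x
  set b : ℝ → ℝ := fun t => conv kerT (fun y => (f y).im) t x
  have ha : Measurable a := hm1
  have hb : Measurable b := hm2
  have hL : eLpNorm (fun t => |a t| + |b t|) 2 sqMeasure ≤
      sqFn univ (fun y => (f y).re) x + sqFn univ (fun y => (f y).im) x := by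
    rw [sqFn, sqFn, Measure.restrict_univ]
    refine (eLpNorm_add_le (f := fun t => |a t|) (g := fun t => |b t|)
      ha.norm.aestronglyMeasurable hb.norm.aestronglyMeasurable one_le_two).trans_eq ?_
    exact congrArg₂ (· + ·) (eLpNorm_norm a) (eLpNorm_norm b)
  have hm : Measurable fun t => ‖|a t| + |b t|‖ₑ ^ (2 : ℝ≥0∞).toReal :=
    (ha.norm.add hb.norm).enorm.pow_const _
  refine le_trans ?_ hL
  rw [Real.enorm_of_nonneg (Real.sqrt_nonneg _), Real.sqrt_eq_rpow,
    ← ofReal_rpow_of_nonneg (setIntegral_nonneg measurableSet_Ioi fun t ht => by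
      have ht : 0 < t := ht
      positivity) (by norm_num), eLpNorm_eq_lintegral_rpow_enorm_toReal two_ne_zero ofNat_ne_top,
    ← Measure.restrict_univ (μ := sqMeasure),
    lintegral_sqMeasure_restrict MeasurableSet.univ hm, univ_inter, toReal_ofNat]
  refine ENNReal.rpow_le_rpow ?_ (by norm_num)
  refine (ofReal_integral_le_lintegral _).trans ?_
  refine setLIntegral_mono' measurableSet_Ioi fun t ht => ?_
  have ht : 0 < t := ht
  have e : ENNReal.ofReal (‖(t : ℂ) * deriv (fun s => poissonP f s x) t‖ ^ 2 / t) =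
      ENNReal.ofReal t * ‖deriv (fun s => poissonP f s x) t‖ₑ ^ (2 : ℝ) := by
    rw [← ofReal_norm, ofReal_rpow_of_nonneg (norm_nonneg _) zero_le_two,
      ← ofReal_mul ht.le, norm_mul, Complex.norm_real, Real.norm_of_nonneg ht.le, Real.rpow_two]
    congr 1
    field_simp
  rw [e]
  gcongr
  exact enorm_deriv_poissonP_le hf ht x

/-- The `L^p` bound for the square function of a component of a Schwartz function. -/
lemma eLpNorm_sqFn_comp_le (f : SchwartzMap ℝ ℂ) {π : ℂ → ℝ} (hπ : Continuous π)
    (hle : ∀ z, ‖π z‖ ≤ ‖z‖) {p : ℝ} (hp : 1 < p) :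
    eLpNorm (sqFn univ fun y => π (f y)) (ENNReal.ofReal p) volume ≤
      ENNReal.ofReal (sqConst * max p (p / (p - 1))) *
        eLpNorm f (ENNReal.ofReal p) volume := by
  have hc : Continuous fun y => π (f y) := hπ.comp f.continuous
  have hle' : ∀ y, ‖π (f y)‖ ≤ ‖f y‖ := fun y => hle _
  have hmem : MemLp (fun y => π (f y)) (ENNReal.ofReal (3 / 2)) :=
    (f.memLp _ volume).mono hc.aestronglyMeasurable (.of_forall hle')
  have h32 := lintegral_rpow_enorm_lt_top_of_eLpNorm_lt_top (by simp) ofReal_ne_top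
    hmem.eLpNorm_lt_top
  rw [toReal_ofReal (by norm_num)] at h32
  refine (eLpNorm_sqFn_le (f.integrable.mono hc.aestronglyMeasurable (.of_forall hle'))
    hc.measurable h32 hp).trans ?_
  gcongr
  exact eLpNorm_mono hle'

end PoissonSquare

/-- There is an absolute constant `C > 0` such that for every `1 < p < ∞` and every
Schwartz function `f`, the Littlewood–Paley–Stein square function
`G^P f(x) = (∫_0^∞ |t·∂_t P_t f(x)|² dt/t)^{1/2}` of the subordinated Poisson
semigroup of the translation group satisfies `‖G^P f‖_p ≤ C·max{p, p/(p−1)}·‖f‖_p`. -/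
theorem poisson_square_function_Lp_bound :
    ∃ C : ℝ, 0 < C ∧ ∀ p : ℝ, 1 < p → ∀ f : SchwartzMap ℝ ℂ,
      eLpNorm
          (fun x => Real.sqrt (∫ t in Set.Ioi (0 : ℝ),
            ‖(t : ℂ) * deriv (fun s => poissonP (⇑f) s x) t‖ ^ 2 / t))
          (ENNReal.ofReal p) volume
        ≤ ENNReal.ofReal (C * max p (p / (p - 1))) * eLpNorm (⇑f) (ENNReal.ofReal p) volume := by
  refine ⟨2 * PoissonSquare.sqConst, mul_pos two_pos PoissonSquare.sqConst_pos,
    fun p hp f => ?_⟩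
  have hfm : Measurable f := f.continuous.measurable
  have hre := PoissonSquare.eLpNorm_sqFn_comp_le f Complex.continuous_re Complex.abs_re_le_norm hp
  have him := PoissonSquare.eLpNorm_sqFn_comp_le f Complex.continuous_im Complex.abs_im_le_norm hp
  have hmr := PoissonSquare.measurable_sqFn (f := fun y => (f y).re)
    (Complex.measurable_re.comp hfm) MeasurableSet.univ
  have hmi := PoissonSquare.measurable_sqFn (f := fun y => (f y).im)
    (Complex.measurable_im.comp hfm) MeasurableSet.univ
  calc _ ≤ eLpNorm (PoissonSquare.sqFn Set.univ (fun y => (f y).re) +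
        PoissonSquare.sqFn Set.univ fun y => (f y).im) (ENNReal.ofReal p) volume :=
        eLpNorm_mono_enorm fun x => PoissonSquare.enorm_sqrt_integral_le f.integrable hfm x
    _ ≤ _ := eLpNorm_add_le hmr.aestronglyMeasurable hmi.aestronglyMeasurable
        (by simpa using ENNReal.ofReal_le_ofReal hp.le)
    _ ≤ _ := add_le_add hre him
    _ = _ := by
        have hC : 0 ≤ PoissonSquare.sqConst * max p (p / (p - 1)) :=
          mul_nonneg PoissonSquare.sqConst_pos.le (le_max_of_le_left (by linarith))
        rw [← add_mul, ← ENNReal.ofReal_add hC hC]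
        ring_nf
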